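/- Let m ≥ 1 and n ≥ 2 be integers and let G : ℂ^m → SL_n(ℂ) be a holomorphic map (each matrix entry of G is holomorphic and det G(w) = 1 for all w). Then there exist an integer M ≥ 1 and matrix-valued maps E_1, …, E_M : ℂ^m → SL_n(ℂ) with all entries holomorphic on ℂ^m, such that for each odd i the matrix E_i(w) is unipotent lower triangular for every w, for each even i the matrix E_i(w) is unipotent upper triangular for every w, and G(w) = E_1(w) E_2(w) ⋯ E_M(w) for all w ∈ ℂ^m. -/

import Mathlib

section

open Matrix

section Algebra

variable {R : Type*} [CommRing R]

/-- Lower triangular with ones on the diagonal. -/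
def IsLowerUnipotent {n : ℕ} (A : Matrix (Fin n) (Fin n) R) : Prop :=
  (∀ a, A a a = 1) ∧ ∀ a b, a < b → A a b = 0

/-- Upper triangular with ones on the diagonal. -/
def IsUpperUnipotent {n : ℕ} (A : Matrix (Fin n) (Fin n) R) : Prop :=
  (∀ a, A a a = 1) ∧ ∀ a b, b < a → A a b = 0

variable (R) in
/-- The monoid generated by lower and upper unipotent matrices. -/
def unipotentClosure (n : ℕ) : Submonoid (Matrix (Fin n) (Fin n) R) :=
  Submonoid.closure {A | IsLowerUnipotent A ∨ IsUpperUnipotent A}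

lemma IsLowerUnipotent.mem_closure {n : ℕ} {A : Matrix (Fin n) (Fin n) R}
    (h : IsLowerUnipotent A) : A ∈ unipotentClosure R n :=
  Submonoid.subset_closure (Or.inl h)

lemma IsUpperUnipotent.mem_closure {n : ℕ} {A : Matrix (Fin n) (Fin n) R}
    (h : IsUpperUnipotent A) : A ∈ unipotentClosure R n :=
  Submonoid.subset_closure (Or.inr h)

lemma det_eq_one_of_mem_unipotentClosure {n : ℕ} {A : Matrix (Fin n) (Fin n) R}
    (h : A ∈ unipotentClosure R n) : A.det = 1 := by
  induction h using Submonoid.closure_induction with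
  | mem A hA =>
    rcases hA with hA | hA
    · have h : A.BlockTriangular OrderDual.toDual := fun i j hij => hA.2 i j hij
      have := Matrix.det_of_isLowerTriangular A h
      simpa [hA.1] using this
    · have h : A.BlockTriangular id := fun i j hij => hA.2 i j hij
      have := Matrix.det_of_isUpperTriangular h
      simpa [hA.1] using this
  | one => simp
  | mul A B _ _ hA hB => simp [hA, hB]

/-- The first basis vector. -/
abbrev firstVec (R : Type*) [CommRing R] (n : ℕ) : Fin (n + 1) → R := Pi.single 0 1

lemma isUpperUnipotent_one_add {n : ℕ} {z : Fin (n + 1) → R} (hz : z 0 = 0) :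
    IsUpperUnipotent (1 + vecMulVec (firstVec R n) z) := by
  refine ⟨fun a => ?_, fun a b hab => ?_⟩
  · by_cases ha : a = 0
    · subst ha; simp [vecMulVec_apply, hz]
    · simp [vecMulVec_apply, ha]
  · have ha : a ≠ 0 := by rintro rfl; exact absurd hab (Fin.not_lt_zero b)
    simp [vecMulVec_apply, ha, Matrix.one_apply_ne hab.ne']

lemma isLowerUnipotent_one_add {n : ℕ} {z : Fin (n + 1) → R} (hz : z 0 = 0) :
    IsLowerUnipotent (1 + vecMulVec z (firstVec R n)) := by
  refine ⟨fun a => ?_, fun a b hab => ?_⟩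
  · by_cases ha : a = 0
    · subst ha; simp [vecMulVec_apply, hz]
    · simp [vecMulVec_apply, ha]
  · have ha : b ≠ 0 := by rintro rfl; exact absurd hab (Fin.not_lt_zero a)
    simp [vecMulVec_apply, ha, Matrix.one_apply_ne hab.ne]

lemma one_add_vecMulVec_mul {n : ℕ} {x y : Fin n → R} (h : y ⬝ᵥ x = 0) :
    (1 + vecMulVec x y) * (1 + vecMulVec x (-y)) = 1 := by
  have : vecMulVec x y * vecMulVec x y = 0 := by
    rw [vecMulVec_mul_vecMulVec]; simp [h]
  simp [add_mul, mul_add, this, vecMulVec_neg]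

/-- Two consecutive edges of a chain are realised by unipotent factors. -/
lemma exists_extend_two {n : ℕ} {W W' : Matrix (Fin (n + 1)) (Fin (n + 1)) R}
    (hW : W ∈ unipotentClosure R (n + 1)) (hW' : W' ∈ unipotentClosure R (n + 1))
    (h : W * W' = 1) {c : R} (hc : IsUnit c) {q q' q'' : Fin (n + 1) → R}
    (hq : W *ᵥ firstVec R n = c • q) (h1 : IsUnit (q ⬝ᵥ q')) (h2 : IsUnit (q' ⬝ᵥ q'')) :
    ∃ X ∈ unipotentClosure R (n + 1), ∃ X' ∈ unipotentClosure R (n + 1), X * X' = 1 ∧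
      ∃ d : R, IsUnit d ∧ X *ᵥ firstVec R n = d • q'' := by
  obtain ⟨u, hu⟩ : IsUnit ((q' ᵥ* W) 0) := by
    have : (q' ᵥ* W) 0 = c * (q ⬝ᵥ q') := by
      have e : (q' ᵥ* W) 0 = (q' ᵥ* W) ⬝ᵥ firstVec R n := by simp
      rw [e, ← dotProduct_mulVec, hq, dotProduct_smul, dotProduct_comm, smul_eq_mul]
    rw [this]; exact hc.mul h1
  set z : Fin (n + 1) → R := (↑u⁻¹ : R) • (q' ᵥ* W) - firstVec R n with hz
  have hz0 : z 0 = 0 := by simp [hz, ← hu]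
  have hzd : z ⬝ᵥ firstVec R n = 0 := by simp [hz0]
  set V := 1 + vecMulVec (firstVec R n) (-z) with hV
  set U := 1 + vecMulVec (firstVec R n) z with hU
  have hUV : U * V = 1 := one_add_vecMulVec_mul hzd
  have hVU : V * U = 1 := mul_eq_one_comm.mp hUV
  have hUm : U ∈ unipotentClosure R (n + 1) := (isUpperUnipotent_one_add hz0).mem_closure
  have hVm : V ∈ unipotentClosure R (n + 1) :=
    (isUpperUnipotent_one_add (by simp [hz0])).mem_closure
  have hrow : firstVec R n ᵥ* (U * W') = (↑u⁻¹ : R) • q' := by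
    rw [← vecMul_vecMul]
    have : firstVec R n ᵥ* U = (↑u⁻¹ : R) • (q' ᵥ* W) := by
      rw [hU, vecMul_add, vecMul_one, vecMul_vecMulVec]
      simp [hz]
    rw [this, smul_vecMul, vecMul_vecMul, h, vecMul_one]
  have hinv : (W * V) * (U * W') = 1 := by
    rw [Matrix.mul_assoc, ← Matrix.mul_assoc V, hVU, Matrix.one_mul, h]
  obtain ⟨w, hw⟩ : IsUnit (((U * W') *ᵥ q'') 0) := by
    have : ((U * W') *ᵥ q'') 0 = ↑u⁻¹ * (q' ⬝ᵥ q'') := by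
      have e : ((U * W') *ᵥ q'') 0 = firstVec R n ⬝ᵥ ((U * W') *ᵥ q'') := by simp
      rw [e, dotProduct_mulVec, hrow, smul_dotProduct, smul_eq_mul]
    rw [this]; exact (Units.isUnit _).mul h2
  set y : Fin (n + 1) → R := (↑w⁻¹ : R) • ((U * W') *ᵥ q'') - firstVec R n with hy
  have hy0 : y 0 = 0 := by simp [hy, ← hw]
  have hyd : firstVec R n ⬝ᵥ y = 0 := by simp [hy0]
  set L := 1 + vecMulVec y (firstVec R n) with hL
  set L' := 1 + vecMulVec y (-firstVec R n) with hL'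
  have hLL : L * L' = 1 := one_add_vecMulVec_mul hyd
  have hLm : L ∈ unipotentClosure R (n + 1) := (isLowerUnipotent_one_add hy0).mem_closure
  have hLm' : L' ∈ unipotentClosure R (n + 1) := by
    have : L' = 1 + vecMulVec (-y) (firstVec R n) := by
      rw [hL', vecMulVec_neg, neg_vecMulVec]
    rw [this]
    exact (isLowerUnipotent_one_add (by simp [hy0])).mem_closure
  refine ⟨W * V * L, mul_mem (mul_mem hW hVm) hLm, L' * (U * W'),
    mul_mem hLm' (mul_mem hUm hW'), ?_, ↑w⁻¹, Units.isUnit _, ?_⟩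
  · rw [Matrix.mul_assoc, ← Matrix.mul_assoc L, hLL, Matrix.one_mul, hinv]
  · have : L *ᵥ firstVec R n = (↑w⁻¹ : R) • ((U * W') *ᵥ q'') := by
      rw [hL, add_mulVec, one_mulVec, vecMulVec_mulVec]
      simp [hy]
    rw [← mulVec_mulVec, this, mulVec_smul, mulVec_mulVec, hinv, one_mulVec]

lemma exists_mulVec_eq_of_chain {n : ℕ} (q : ℕ → Fin (n + 1) → R) (h0 : q 0 = firstVec R n)
    (K : ℕ) (hq : ∀ k < 2 * K, IsUnit (q k ⬝ᵥ q (k + 1))) :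
    ∃ X ∈ unipotentClosure R (n + 1), ∃ X' ∈ unipotentClosure R (n + 1), X * X' = 1 ∧
      ∃ d : R, IsUnit d ∧ X *ᵥ firstVec R n = d • q (2 * K) := by
  induction K with
  | zero => exact ⟨1, one_mem _, 1, one_mem _, by simp, 1, isUnit_one,
      by rw [one_mulVec, one_smul]; exact h0.symm⟩
  | succ K ih =>
    obtain ⟨W, hW, W', hW', h, c, hc, hWq⟩ := ih (fun k hk => hq k (by omega))
    exact exists_extend_two hW hW' h hc hWq (hq _ (by omega)) (hq (2 * K + 1) (by omega))

/-- Block matrix `diag (1, A)`. -/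
def blockOne {n : ℕ} (A : Matrix (Fin n) (Fin n) R) : Matrix (Fin (n + 1)) (Fin (n + 1)) R :=
  Matrix.of fun i => Fin.cases (Pi.single 0 1) (fun i' => Fin.cons 0 (A i')) i

@[simp] lemma blockOne_zero_zero {n : ℕ} (A : Matrix (Fin n) (Fin n) R) :
    blockOne A 0 0 = 1 := by simp [blockOne]
@[simp] lemma blockOne_zero_succ {n : ℕ} (A : Matrix (Fin n) (Fin n) R) (j : Fin n) :
    blockOne A 0 j.succ = 0 := by simp [blockOne]
@[simp] lemma blockOne_succ_zero {n : ℕ} (A : Matrix (Fin n) (Fin n) R) (i : Fin n) :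
    blockOne A i.succ 0 = 0 := by simp [blockOne]
@[simp] lemma blockOne_succ_succ {n : ℕ} (A : Matrix (Fin n) (Fin n) R) (i j : Fin n) :
    blockOne A i.succ j.succ = A i j := by simp [blockOne]

lemma blockOne_one {n : ℕ} : blockOne (1 : Matrix (Fin n) (Fin n) R) = 1 := by
  ext i j
  refine Fin.cases ?_ (fun i => ?_) i <;> refine Fin.cases ?_ (fun j => ?_) j <;>
    simp [Matrix.one_apply, Fin.succ_ne_zero, (Fin.succ_ne_zero _).symm]

lemma blockOne_mul {n : ℕ} (A B : Matrix (Fin n) (Fin n) R) :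
    blockOne (A * B) = blockOne A * blockOne B := by
  ext i j
  refine Fin.cases ?_ (fun i => ?_) i <;> refine Fin.cases ?_ (fun j => ?_) j <;>
    simp [Matrix.mul_apply, Fin.sum_univ_succ]

lemma blockOne_mem {n : ℕ} {A : Matrix (Fin n) (Fin n) R} (h : A ∈ unipotentClosure R n) :
    blockOne A ∈ unipotentClosure R (n + 1) := by
  induction h using Submonoid.closure_induction with
  | mem A hA =>
    rcases hA with hA | hA
    · refine IsLowerUnipotent.mem_closure ⟨fun a => ?_, fun a b => ?_⟩
      · refine Fin.cases ?_ (fun a => ?_) a <;> simp [hA.1]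
      · refine Fin.cases ?_ (fun a => ?_) a <;> refine Fin.cases ?_ (fun b => ?_) b <;>
          simp +contextual [hA.2]
    · refine IsUpperUnipotent.mem_closure ⟨fun a => ?_, fun a b => ?_⟩
      · refine Fin.cases ?_ (fun a => ?_) a <;> simp [hA.1]
      · refine Fin.cases ?_ (fun a => ?_) a <;> refine Fin.cases ?_ (fun b => ?_) b <;>
          simp +contextual [hA.2]
  | one => rw [blockOne_one]; exact one_mem _
  | mul A B _ _ hA hB => rw [blockOne_mul]; exact mul_mem hA hB

lemma transvection_mem {n : ℕ} {i j : Fin n} (hij : i ≠ j) (c : R) :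
    transvection i j c ∈ unipotentClosure R n := by
  rcases lt_or_gt_of_ne hij with h | h
  · refine IsUpperUnipotent.mem_closure ⟨fun a => ?_, fun a b hab => ?_⟩
    · have : ¬ (i = a ∧ j = a) := by rintro ⟨rfl, rfl⟩; exact hij rfl
      simp [transvection, this]
    · have : ¬ (i = a ∧ j = b) := by rintro ⟨rfl, rfl⟩; exact lt_asymm h hab
      simp [transvection, this, Matrix.one_apply_ne hab.ne']
  · refine IsLowerUnipotent.mem_closure ⟨fun a => ?_, fun a b hab => ?_⟩
    · have : ¬ (i = a ∧ j = a) := by rintro ⟨rfl, rfl⟩; exact hij rfl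
      simp [transvection, this]
    · have : ¬ (i = a ∧ j = b) := by rintro ⟨rfl, rfl⟩; exact lt_asymm h hab
      simp [transvection, this, Matrix.one_apply_ne hab.ne]

lemma exists_mul_eq_of_col {n : ℕ} (H : Matrix (Fin (n + 2)) (Fin (n + 2)) R) {a : R}
    (ha : IsUnit a) (hH : H *ᵥ firstVec R (n + 1) = a • firstVec R (n + 1)) :
    ∃ X ∈ unipotentClosure R (n + 2), ∃ H' : Matrix (Fin (n + 2)) (Fin (n + 2)) R,
      H = X * H' ∧ H' *ᵥ firstVec R (n + 1) = firstVec R (n + 1) := by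
  obtain ⟨u, rfl⟩ := ha
  have h01 : (0 : Fin (n + 2)) ≠ 1 := by simp
  have inv : ∀ {i j : Fin (n + 2)} (_ : i ≠ j) (c : R),
      transvection i j (-c) * transvection i j c = 1 := fun {i j} hij c => by
    rw [transvection_mul_transvection_same i j hij]; simp
  refine ⟨transvection 1 0 (-(↑u⁻¹ : R)) * transvection 0 1 (-(1 - (u : R))) * transvection 1 0 1,
    mul_mem (mul_mem (transvection_mem h01.symm _) (transvection_mem h01 _))
      (transvection_mem h01.symm _),
    transvection 1 0 (-1) * (transvection 0 1 (1 - (u : R)) *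
      (transvection 1 0 (↑u⁻¹ : R) * H)), ?_, ?_⟩
  · have e1 := inv h01.symm (-1 : R)
    rw [neg_neg] at e1
    rw [Matrix.mul_assoc, ← Matrix.mul_assoc (transvection 1 0 1), e1, Matrix.one_mul,
      Matrix.mul_assoc, ← Matrix.mul_assoc (transvection 0 1 (-(1 - (u : R)))), inv h01,
      Matrix.one_mul, ← Matrix.mul_assoc, inv h01.symm, Matrix.one_mul]
  · simp only [← mulVec_mulVec, hH]
    have key : ∀ (i j : Fin (n + 2)) (c : R) (x : Fin (n + 2) → R),
        transvection i j c *ᵥ x = x + Pi.single i (c * x j) := by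
      intro i j c x
      rw [transvection, add_mulVec, one_mulVec, Matrix.single_mulVec]
      rfl
    simp only [key]
    ext k
    by_cases hk0 : k = 0
    · subst hk0; simp
    · by_cases hk1 : k = 1
      · subst hk1; simp
      · simp [hk0, hk1]

lemma mem_of_col_eq {n : ℕ} (H : Matrix (Fin (n + 1)) (Fin (n + 1)) R)
    (hH : H *ᵥ firstVec R n = firstVec R n) (hdet : H.det = 1)
    (IH : ∀ G : Matrix (Fin n) (Fin n) R, G.det = 1 → G ∈ unipotentClosure R n) :
    H ∈ unipotentClosure R (n + 1) := by
  have hcol : ∀ i, H i 0 = firstVec R n i := fun i => by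
    rw [← hH]; simp
  set G : Matrix (Fin n) (Fin n) R := H.submatrix Fin.succ Fin.succ with hG
  have hGd : G.det = 1 := by
    rw [det_succ_column_zero, Fin.sum_univ_succ] at hdet
    simpa [hcol, hG, Fin.succ_ne_zero, Fin.succAbove_zero] using hdet
  set z : Fin (n + 1) → R := fun j => if j = 0 then 0 else H 0 j with hz
  have hz0 : z 0 = 0 := by simp [hz]
  have : H = blockOne G * (1 + vecMulVec (firstVec R n) z) := by
    rw [mul_add, Matrix.mul_one, mul_vecMulVec]
    ext i j
    refine Fin.cases ?_ (fun i => ?_) i <;> refine Fin.cases ?_ (fun j => ?_) j <;>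
      simp [hcol, vecMulVec_apply, hz, hG, Fin.succ_ne_zero]
  rw [this]
  exact mul_mem (blockOne_mem (IH G hGd)) (isUpperUnipotent_one_add hz0).mem_closure

variable (R) in
/-- Every determinant one matrix is joined to the identity by a chain of vectors and covectors
with invertible pairings. -/
def HasChains : Prop :=
  ∀ (n : ℕ) (G : Matrix (Fin (n + 1)) (Fin (n + 1)) R), G.det = 1 →
    ∃ (K : ℕ) (q : ℕ → Fin (n + 1) → R), q 0 = firstVec R n ∧
      q (2 * K) = G *ᵥ firstVec R n ∧ ∀ k < 2 * K, IsUnit (q k ⬝ᵥ q (k + 1))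

theorem mem_unipotentClosure_of_hasChains (hR : HasChains R) (n : ℕ)
    (G : Matrix (Fin n) (Fin n) R) (hG : G.det = 1) : G ∈ unipotentClosure R n := by
  induction n with
  | zero =>
    have : G = 1 := Subsingleton.elim _ _
    rw [this]; exact one_mem _
  | succ n ih =>
    cases n with
    | zero =>
      refine mem_of_col_eq G ?_ hG ih
      have : G 0 0 = 1 := by simpa using hG
      ext i
      fin_cases i
      simpa using this
    | succ n =>
      obtain ⟨K, q, h0, h1, hq⟩ := hR (n + 1) G hG
      obtain ⟨X, hX, X', hX', hXX, d, ⟨u, rfl⟩, hd⟩ := exists_mulVec_eq_of_chain q h0 K hq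
      have hXX' : X' * X = 1 := mul_eq_one_comm.mp hXX
      have hcol : (X' * G) *ᵥ firstVec R (n + 1) = (↑u⁻¹ : R) • firstVec R (n + 1) := by
        rw [← mulVec_mulVec, ← h1]
        have : q (2 * K) = (↑u⁻¹ : R) • (X *ᵥ firstVec R (n + 1)) := by
          rw [hd, smul_smul]; simp
        rw [this, mulVec_smul, mulVec_mulVec, hXX', one_mulVec]
      obtain ⟨Y, hY, H, hYH, hH⟩ := exists_mul_eq_of_col _ (Units.isUnit _) hcol
      have hHd : H.det = 1 := by
        have := congrArg Matrix.det hYH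
        rw [det_mul, det_mul, hG, det_eq_one_of_mem_unipotentClosure hX',
          det_eq_one_of_mem_unipotentClosure hY] at this
        simpa using this.symm
      have : G = X * (Y * H) := by
        rw [← hYH, ← Matrix.mul_assoc, hXX, Matrix.one_mul]
      rw [this]
      exact mul_mem hX (mul_mem hY (mem_of_col_eq H hH hHd ih))

end Algebra

section Alternating

variable {R : Type*} [CommRing R]

lemma isLowerUnipotent_one {n : ℕ} : IsLowerUnipotent (1 : Matrix (Fin n) (Fin n) R) :=
  ⟨fun a => by simp, fun _ _ h => Matrix.one_apply_ne h.ne⟩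

lemma isUpperUnipotent_one {n : ℕ} : IsUpperUnipotent (1 : Matrix (Fin n) (Fin n) R) :=
  ⟨fun a => by simp, fun _ _ h => Matrix.one_apply_ne h.ne'⟩

/-- An alternating factorization into lower and upper unipotent matrices. -/
def HasAlternating {n : ℕ} (A : Matrix (Fin n) (Fin n) R) : Prop :=
  ∃ (M : ℕ) (_ : 1 ≤ M) (E : Fin M → Matrix (Fin n) (Fin n) R),
    (∀ i : Fin M, Odd (i.1 + 1) → IsLowerUnipotent (E i)) ∧
    (∀ i : Fin M, Even (i.1 + 1) → IsUpperUnipotent (E i)) ∧ A = (List.ofFn E).prod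

lemma HasAlternating.mul_left {n : ℕ} {A L U : Matrix (Fin n) (Fin n) R}
    (hL : IsLowerUnipotent L) (hU : IsUpperUnipotent U) (h : HasAlternating A) :
    HasAlternating (L * (U * A)) := by
  obtain ⟨M, hM, E, h1, h2, rfl⟩ := h
  refine ⟨M + 2, by omega, Fin.cons L (Fin.cons U E), fun i => ?_, fun i => ?_, ?_⟩
  · refine Fin.cases (fun _ => hL) (fun i => ?_) i
    refine Fin.cases (fun h => absurd h (by simp [Nat.odd_iff])) (fun i h => ?_) i
    have : Odd (i.1 + 1) := by
      simp only [Fin.val_succ] at h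
      rcases h with ⟨k, hk⟩
      exact ⟨k - 1, by omega⟩
    simpa using h1 i this
  · refine Fin.cases (fun h => absurd h (by simp [Nat.even_iff])) (fun i => ?_) i
    refine Fin.cases (fun _ => hU) (fun i h => ?_) i
    have : Even (i.1 + 1) := by
      simp only [Fin.val_succ] at h
      rcases h with ⟨k, hk⟩
      exact ⟨k - 1, by omega⟩
    simpa using h2 i this
  · simp

lemma hasAlternating_of_mem {n : ℕ} {A : Matrix (Fin n) (Fin n) R}
    (h : A ∈ unipotentClosure R n) : HasAlternating A := by
  induction h using Submonoid.closure_induction_left with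
  | one =>
    refine ⟨1, le_rfl, fun _ => 1, fun _ _ => isLowerUnipotent_one, fun _ _ =>
      isUpperUnipotent_one, by simp⟩
  | mul_left A hA B _ hB =>
    rcases hA with hA | hA
    · simpa using hB.mul_left hA isUpperUnipotent_one
    · simpa using hB.mul_left isLowerUnipotent_one hA

end Alternating

section Entire

variable {W : Type*} [NormedAddCommGroup W] [NormedSpace ℂ W]

variable (W) in
/-- The ring of entire functions. -/
def entireRing : Subring (W → ℂ) where
  carrier := {f | Differentiable ℂ f}
  mul_mem' hf hg := Differentiable.mul hf hg
  one_mem' := differentiable_const 1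
  add_mem' hf hg := Differentiable.add hf hg
  zero_mem' := differentiable_const 0
  neg_mem' hf := Differentiable.neg hf

lemma isUnit_entireRing {f : entireRing W} (hf : ∀ w, (f : W → ℂ) w ≠ 0) : IsUnit f := by
  refine IsUnit.of_mul_eq_one ⟨fun w => ((f : W → ℂ) w)⁻¹, fun w => ?_⟩ ?_
  · exact (f.2 w).inv (hf w)
  · ext w
    exact mul_inv_cancel₀ (hf w)

/-- Evaluation of entire functions at a point. -/
def entireEval (w : W) : entireRing W →+* ℂ := (Pi.evalRingHom _ w).comp (entireRing W).subtype

@[simp] lemma entireEval_apply (w : W) (f : entireRing W) : entireEval w f = (f : W → ℂ) w := rfl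

/-- Chains over the ring of entire functions, spelled out pointwise. -/
def HasEntireChains (W : Type*) [NormedAddCommGroup W] [NormedSpace ℂ W] : Prop :=
  ∀ (n : ℕ) (G : W → Matrix (Fin (n + 1)) (Fin (n + 1)) ℂ),
    (∀ a b, Differentiable ℂ fun w => G w a b) → (∀ w, (G w).det = 1) →
    ∃ (K : ℕ) (q : W → ℕ → Fin (n + 1) → ℂ), (∀ k, Differentiable ℂ fun w => q w k) ∧
      ∀ w, q w 0 = firstVec ℂ n ∧ q w (2 * K) = G w *ᵥ firstVec ℂ n ∧
        ∀ k < 2 * K, q w k ⬝ᵥ q w (k + 1) ≠ 0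

lemma HasEntireChains.hasChains (h : HasEntireChains W) : HasChains (entireRing W) := by
  intro n G hG
  obtain ⟨K, q, hq, hw⟩ := h n (fun w => G.map (entireEval w)) (fun a b => (G a b).2) (fun w => by
    have := congrArg (entireEval w) hG
    rw [RingHom.map_det, map_one] at this
    exact this)
  refine ⟨K, fun k i => ⟨fun w => q w k i, differentiable_pi.mp (hq k) i⟩, ?_, ?_, ?_⟩
  · ext i w
    have := congrFun (hw w).1 i
    refine this.trans ?_
    by_cases hi : i = 0
    · subst hi; simp
    · simp [hi]
  · ext i w
    have := congrFun (hw w).2.1 i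
    refine this.trans ?_
    simp
  · intro k hk
    refine isUnit_entireRing fun w => ?_
    have := (hw w).2.2 k hk
    have e : ∀ f : entireRing W, (f : W → ℂ) w = entireEval w f := fun _ => rfl
    rw [e]
    simpa [dotProduct] using this

theorem exists_factorization_of_hasEntireChains (h : HasEntireChains W) (n : ℕ)
    (G : W → Matrix (Fin n) (Fin n) ℂ)
    (hG : ∀ a b, Differentiable ℂ (fun w => G w a b)) (hdet : ∀ w, (G w).det = 1) :
    ∃ (M : ℕ) (_ : 1 ≤ M) (E : Fin M → W → Matrix (Fin n) (Fin n) ℂ),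
      (∀ i a b, Differentiable ℂ (fun w => E i w a b)) ∧
      (∀ i : Fin M, Odd (i.1 + 1) → ∀ w, IsLowerUnipotent (E i w)) ∧
      (∀ i : Fin M, Even (i.1 + 1) → ∀ w, IsUpperUnipotent (E i w)) ∧
      (∀ w, G w = (List.ofFn fun i => E i w).prod) := by
  set G' : Matrix (Fin n) (Fin n) (entireRing W) :=
    Matrix.of fun a b => ⟨fun w => G w a b, hG a b⟩ with hG'
  have hev : ∀ w, G'.map (entireEval w) = G w := fun w => by ext a b; simp [hG']
  have hd : G'.det = 1 := by
    ext w
    have : entireEval w G'.det = 1 := by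
      rw [RingHom.map_det]
      exact (congrArg Matrix.det (hev w)).trans (hdet w)
    exact this
  obtain ⟨M, hM, E, h1, h2, h3⟩ :=
    hasAlternating_of_mem (mem_unipotentClosure_of_hasChains h.hasChains n G' hd)
  refine ⟨M, hM, fun i w => (E i).map (entireEval w), fun i a b => (E i a b).2,
    fun i hi w => ⟨fun a => ?_, fun a b hab => ?_⟩, fun i hi w => ⟨fun a => ?_, fun a b hab => ?_⟩,
    fun w => ?_⟩
  · simp [(h1 i hi).1 a]
  · simp [(h1 i hi).2 a b hab]
  · simp [(h2 i hi).1 a]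
  · simp [(h2 i hi).2 a b hab]
  · rw [← hev w, h3]
    have := map_list_prod (entireEval w).mapMatrix (List.ofFn E)
    rw [List.map_ofFn] at this
    exact this

end Entire

end

noncomputable section

open Matrix Filter Topology Set

section Moves

variable {ι : Type*} [Fintype ι]

/-- The entire function `(exp z - 1) / z`. -/
def expQuot : ℂ → ℂ := dslope Complex.exp 0

lemma mul_expQuot (z : ℂ) : z * expQuot z = Complex.exp z - 1 := by
  have := sub_smul_dslope Complex.exp 0 z
  simpa [expQuot] using this

lemma expQuot_zero : expQuot 0 = 1 := by simp [expQuot, dslope_same]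

lemma differentiable_expQuot : Differentiable ℂ expQuot := by
  have := (Complex.differentiableOn_dslope (s := Set.univ) (c := 0) (f := Complex.exp)
    Filter.univ_mem).mpr Complex.differentiable_exp.differentiableOn
  exact differentiableOn_univ.mp this

lemma expQuot_log_ne_zero {w : ℂ} (hw : w ≠ 0) : expQuot (Complex.log w) ≠ 0 := by
  intro h
  have h1 := mul_expQuot (Complex.log w)
  rw [h, mul_zero, Complex.exp_log hw] at h1
  have : w = 1 := by linear_combination -h1
  rw [this, Complex.log_one, expQuot_zero] at h
  exact one_ne_zero h

/-- The direction of a move, annihilated by `b`. -/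
def moveDir (b q η : ι → ℂ) : ι → ℂ := (b ⬝ᵥ q) • η - (b ⬝ᵥ η) • q

/-- The result of moving the vertex `q` with neighbours `b` and `b'` by the parameter `t`. -/
def moveVec (t : ℂ × (ι → ℂ)) (b q b' : ι → ℂ) : ι → ℂ :=
  Complex.exp t.1 • (q + ((b' ⬝ᵥ q) * expQuot (b' ⬝ᵥ moveDir b q t.2)) • moveDir b q t.2)

lemma dot_moveDir (b q η : ι → ℂ) : b ⬝ᵥ moveDir b q η = 0 := by
  simp [moveDir, dotProduct_sub, dotProduct_smul, mul_comm]

lemma dot_moveVec_left (t : ℂ × (ι → ℂ)) (b q b' : ι → ℂ) :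
    b ⬝ᵥ moveVec t b q b' = Complex.exp t.1 * (b ⬝ᵥ q) := by
  simp [moveVec, dotProduct_add, dotProduct_smul, dot_moveDir]

lemma dot_moveVec_right (t : ℂ × (ι → ℂ)) (b q b' : ι → ℂ) :
    b' ⬝ᵥ moveVec t b q b' = Complex.exp (t.1 + b' ⬝ᵥ moveDir b q t.2) * (b' ⬝ᵥ q) := by
  have := mul_expQuot (b' ⬝ᵥ moveDir b q t.2)
  simp only [moveVec, dotProduct_add, dotProduct_smul, smul_eq_mul, Complex.exp_add]
  linear_combination Complex.exp t.1 * (b' ⬝ᵥ q) * this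

lemma moveVec_zero (b q b' : ι → ℂ) : moveVec 0 b q b' = q := by
  simp [moveVec, moveDir]

lemma contDiff_dot {E : Type*} [NormedAddCommGroup E] [NormedSpace ℂ E] {n : WithTop ℕ∞}
    {f g : E → ι → ℂ} (hf : ContDiff ℂ n f) (hg : ContDiff ℂ n g) :
    ContDiff ℂ n fun x => f x ⬝ᵥ g x := by
  simp only [dotProduct]
  exact ContDiff.sum fun i _ => (contDiff_pi.mp hf i).mul (contDiff_pi.mp hg i)

/-- `moveVec` as a function on a product space. -/
def moveFun (x : (ℂ × (ι → ℂ)) × (ι → ℂ) × (ι → ℂ) × (ι → ℂ)) : ι → ℂ :=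
  moveVec x.1 x.2.1 x.2.2.1 x.2.2.2

lemma contDiff_moveFun {n : ℕ∞} : ContDiff ℂ n (moveFun (ι := ι)) := by
  have hE : ContDiff ℂ n expQuot := differentiable_expQuot.contDiff
  have hη : ContDiff ℂ n fun x : (ℂ × (ι → ℂ)) × (ι → ℂ) × (ι → ℂ) × (ι → ℂ) =>
      moveDir x.2.1 x.2.2.1 x.1.2 := by
    have h1 : ContDiff ℂ n fun x : (ℂ × (ι → ℂ)) × (ι → ℂ) × (ι → ℂ) × (ι → ℂ) =>
        x.2.1 ⬝ᵥ x.2.2.1 := contDiff_dot (by fun_prop) (by fun_prop)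
    have h2 : ContDiff ℂ n fun x : (ℂ × (ι → ℂ)) × (ι → ℂ) × (ι → ℂ) × (ι → ℂ) =>
        x.2.1 ⬝ᵥ x.1.2 := contDiff_dot (by fun_prop) (by fun_prop)
    unfold moveDir
    exact (h1.smul (by fun_prop)).sub (h2.smul (by fun_prop))
  have h1 : ContDiff ℂ n fun x : (ℂ × (ι → ℂ)) × (ι → ℂ) × (ι → ℂ) × (ι → ℂ) =>
      x.2.2.2 ⬝ᵥ x.2.2.1 := contDiff_dot (by fun_prop) (by fun_prop)
  have h2 : ContDiff ℂ n fun x : (ℂ × (ι → ℂ)) × (ι → ℂ) × (ι → ℂ) × (ι → ℂ) =>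
      x.2.2.2 ⬝ᵥ moveDir x.2.1 x.2.2.1 x.1.2 := contDiff_dot (by fun_prop) hη
  have h3 : ContDiff ℂ n fun x : (ℂ × (ι → ℂ)) × (ι → ℂ) × (ι → ℂ) × (ι → ℂ) =>
      Complex.exp x.1.1 := by fun_prop
  have h4 : ContDiff ℂ n fun x : (ℂ × (ι → ℂ)) × (ι → ℂ) × (ι → ℂ) × (ι → ℂ) =>
      x.2.2.1 := by fun_prop
  exact h3.smul (h4.add ((h1.mul (hE.comp h2)).smul hη))

/-- Consecutive vertices pair nontrivially; the end vertices are `e` and `v`. -/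
structure Gallery (N : ℕ) (e v : ι → ℂ) (c : ℕ → ι → ℂ) : Prop where
  left : c 0 = e
  right : ∀ k, N ≤ k → c k = v
  ne : ∀ k < N, c k ⬝ᵥ c (k + 1) ≠ 0

/-- The move at the vertex `k`. -/
def moveAt (k : ℕ) (t : ℂ × (ι → ℂ)) (c : ℕ → ι → ℂ) : ℕ → ι → ℂ :=
  Function.update c k (moveVec t (c (k - 1)) (c k) (c (k + 1)))

lemma moveAt_same (k : ℕ) (t : ℂ × (ι → ℂ)) (c : ℕ → ι → ℂ) :
    moveAt k t c k = moveVec t (c (k - 1)) (c k) (c (k + 1)) := by simp [moveAt]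

lemma moveAt_of_ne {k j : ℕ} (h : j ≠ k) (t : ℂ × (ι → ℂ)) (c : ℕ → ι → ℂ) :
    moveAt k t c j = c j := by simp [moveAt, h]

lemma moveAt_zero (k : ℕ) (c : ℕ → ι → ℂ) : moveAt k 0 c = c := by
  simp [moveAt, moveVec_zero]

lemma Gallery.moveAt {N : ℕ} {e v : ι → ℂ} {c : ℕ → ι → ℂ} (h : Gallery N e v c) {k : ℕ}
    (hk : 0 < k) (hkN : k < N) (t : ℂ × (ι → ℂ)) : Gallery N e v (moveAt k t c) := by
  refine ⟨?_, fun j hj => ?_, fun j hj => ?_⟩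
  · rw [moveAt_of_ne (by omega)]; exact h.left
  · rw [moveAt_of_ne (by omega)]; exact h.right j hj
  · by_cases h1 : j = k
    · subst h1
      rw [moveAt_same, moveAt_of_ne (by omega), dotProduct_comm, dot_moveVec_right]
      refine mul_ne_zero (Complex.exp_ne_zero _) ?_
      rw [dotProduct_comm]; exact h.ne j hj
    · by_cases h2 : j + 1 = k
      · subst h2
        rw [moveAt_same, moveAt_of_ne (by omega)]
        have : j + 1 - 1 = j := rfl
        rw [this, dot_moveVec_left]
        exact mul_ne_zero (Complex.exp_ne_zero _) (h.ne j hj)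
      · rw [moveAt_of_ne h1, moveAt_of_ne h2]; exact h.ne j hj

end Moves

section Chains

variable {𝔼 : Type*} [NormedAddCommGroup 𝔼] [NormedSpace ℂ 𝔼] {ι : Type*} [Fintype ι]

lemma eventually_nhdsSet_iff_open {X : Type*} [TopologicalSpace X] {S : Set X} {P : X → Prop} :
    (∀ᶠ y in 𝓝ˢ S, P y) ↔ ∃ U, IsOpen U ∧ S ⊆ U ∧ ∀ y ∈ U, P y := by
  rw [Filter.Eventually, mem_nhdsSet_iff_exists]; rfl

lemma eventually_nhdsSet_of_open {X : Type*} [TopologicalSpace X] {S U : Set X} {P : X → Prop}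
    (hU : IsOpen U) (hS : S ⊆ U) (h : ∀ y ∈ U, P y) : ∀ᶠ y in 𝓝ˢ S, P y :=
  eventually_nhdsSet_iff_open.mpr ⟨U, hU, hS, h⟩

/-- Holomorphic in a neighbourhood of `S`. -/
def HolNear {F : Type*} [NormedAddCommGroup F] [NormedSpace ℂ F] (f : 𝔼 → F) (S : Set 𝔼) : Prop :=
  ∀ᶠ y in 𝓝ˢ S, DifferentiableAt ℂ f y

/-- A holomorphic family of galleries near `S`. -/
structure ChainOn (N : ℕ) (e v : 𝔼 → ι → ℂ) (S : Set 𝔼) (p : 𝔼 → ℕ → ι → ℂ) : Prop where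
  gallery : ∀ᶠ y in 𝓝ˢ S, Gallery N (e y) (v y) (p y)
  hol : ∀ k, HolNear (fun z => p z k) S

/-- One move with coefficients holomorphic near `S`. -/
def MoveStep (N : ℕ) (S : Set 𝔼) (p p' : 𝔼 → ℕ → ι → ℂ) : Prop :=
  ∃ k, 0 < k ∧ k < N ∧ ∃ t : 𝔼 → ℂ × (ι → ℂ), HolNear t S ∧
    ∀ᶠ y in 𝓝ˢ S, p' y = moveAt k (t y) (p y)

/-- Finitely many moves with coefficients holomorphic near `S`. -/
abbrev Reach (N : ℕ) (S : Set 𝔼) : (𝔼 → ℕ → ι → ℂ) → (𝔼 → ℕ → ι → ℂ) → Prop :=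
  Relation.ReflTransGen (MoveStep N S)

lemma differentiableAt_moveVec {t : 𝔼 → ℂ × (ι → ℂ)} {b q b' : 𝔼 → ι → ℂ} {x : 𝔼}
    (ht : DifferentiableAt ℂ t x) (hb : DifferentiableAt ℂ b x) (hq : DifferentiableAt ℂ q x)
    (hb' : DifferentiableAt ℂ b' x) :
    DifferentiableAt ℂ (fun z => moveVec (t z) (b z) (q z) (b' z)) x :=
  ((contDiff_moveFun (ι := ι) (n := 1)).differentiable (by simp)).differentiableAt.comp x
    (ht.prodMk (hb.prodMk (hq.prodMk hb')))

lemma HolNear.congr {F : Type*} [NormedAddCommGroup F] [NormedSpace ℂ F] {f g : 𝔼 → F}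
    {S : Set 𝔼} (hf : HolNear f S) (h : ∀ᶠ y in 𝓝ˢ S, g y = f y) : HolNear g S := by
  obtain ⟨U, hU, hS, h⟩ := eventually_nhdsSet_iff_open.mp h
  filter_upwards [hf, hU.mem_nhdsSet.mpr hS] with y hy hy'
  exact hy.congr_of_eventuallyEq (mem_of_superset (hU.mem_nhds hy') h)

lemma ChainOn.step {N : ℕ} {e v : 𝔼 → ι → ℂ} {S : Set 𝔼} {p p' : 𝔼 → ℕ → ι → ℂ}
    (h : ChainOn N e v S p) (hs : MoveStep N S p p') : ChainOn N e v S p' := by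
  obtain ⟨k, hk, hkN, t, ht, he⟩ := hs
  refine ⟨?_, fun j => ?_⟩
  · filter_upwards [h.gallery, he] with y hy hy'
    rw [hy']; exact hy.moveAt hk hkN _
  · have : HolNear (fun z => moveAt k (t z) (p z) j) S := by
      by_cases hj : j = k
      · subst hj
        simp only [moveAt_same]
        filter_upwards [ht, h.hol (j - 1), h.hol j, h.hol (j + 1)] with y h1 h2 h3 h4
        exact differentiableAt_moveVec h1 h2 h3 h4
      · simp only [moveAt_of_ne hj]
        exact h.hol j
    exact this.congr (he.mono fun y hy => by rw [hy])

lemma ChainOn.reach {N : ℕ} {e v : 𝔼 → ι → ℂ} {S : Set 𝔼} {p p' : 𝔼 → ℕ → ι → ℂ}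
    (h : ChainOn N e v S p) (hs : Reach N S p p') : ChainOn N e v S p' := by
  induction hs with
  | refl => exact h
  | tail _ hs ih => exact ih.step hs

lemma HolNear.mono {F : Type*} [NormedAddCommGroup F] [NormedSpace ℂ F] {f : 𝔼 → F}
    {S T : Set 𝔼} (hf : HolNear f S) (h : T ⊆ S) : HolNear f T :=
  Filter.Eventually.filter_mono (nhdsSet_mono h) hf

lemma ChainOn.mono {N : ℕ} {e v : 𝔼 → ι → ℂ} {S T : Set 𝔼} {p : 𝔼 → ℕ → ι → ℂ}
    (h : ChainOn N e v S p) (hT : T ⊆ S) : ChainOn N e v T p :=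
  ⟨h.gallery.filter_mono (nhdsSet_mono hT), fun k => (h.hol k).mono hT⟩

lemma MoveStep.mono {N : ℕ} {S T : Set 𝔼} {p p' : 𝔼 → ℕ → ι → ℂ} (h : MoveStep N S p p')
    (hT : T ⊆ S) : MoveStep N T p p' := by
  obtain ⟨k, hk, hkN, t, ht, he⟩ := h
  exact ⟨k, hk, hkN, t, ht.mono hT, he.filter_mono (nhdsSet_mono hT)⟩

lemma Reach.mono {N : ℕ} {S T : Set 𝔼} {p p' : 𝔼 → ℕ → ι → ℂ} (h : Reach N S p p')
    (hT : T ⊆ S) : Reach N T p p' :=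
  Relation.ReflTransGen.mono (fun _ _ hs => MoveStep.mono hs hT) _ _ h

lemma HolNear.exists_open {F : Type*} [NormedAddCommGroup F] [NormedSpace ℂ F] {f : 𝔼 → F}
    {S : Set 𝔼} (h : HolNear f S) : ∃ U, IsOpen U ∧ S ⊆ U ∧ HolNear f U := by
  obtain ⟨U, hU, hS, h⟩ := eventually_nhdsSet_iff_open.mp h
  exact ⟨U, hU, hS, eventually_nhdsSet_of_open hU subset_rfl h⟩

lemma ChainOn.exists_open {N : ℕ} {e v : 𝔼 → ι → ℂ} {S : Set 𝔼} {p : 𝔼 → ℕ → ι → ℂ}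
    (h : ChainOn N e v S p) (hv : Differentiable ℂ v) :
    ∃ U, IsOpen U ∧ S ⊆ U ∧ ChainOn N e v U p := by
  obtain ⟨U, hU, hS, h1⟩ := eventually_nhdsSet_iff_open.mp h.gallery
  choose V hV hSV h2 using fun k => (h.hol k).exists_open
  have hW : IsOpen (⋂ k ∈ Finset.range N, V k) := isOpen_biInter_finset fun k _ => hV k
  refine ⟨U ∩ ⋂ k ∈ Finset.range N, V k, hU.inter hW, subset_inter hS ?_,
    eventually_nhdsSet_of_open hU inter_subset_left h1, fun k => ?_⟩
  · exact subset_iInter₂ fun k _ => hSV k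
  · by_cases hk : k < N
    · exact (h2 k).mono (inter_subset_right.trans
        (iInter₂_subset (s := fun k (_ : k ∈ Finset.range N) => V k) k (Finset.mem_range.mpr hk)))
    · have : HolNear v (U ∩ ⋂ k ∈ Finset.range N, V k) := Eventually.of_forall fun y => hv y
      exact this.congr (eventually_nhdsSet_of_open hU inter_subset_left fun y hy =>
        (h1 y hy).right k (by omega))

lemma MoveStep.exists_open {N : ℕ} {S : Set 𝔼} {p p' : 𝔼 → ℕ → ι → ℂ} (h : MoveStep N S p p') :
    ∃ U, IsOpen U ∧ S ⊆ U ∧ MoveStep N U p p' := by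
  obtain ⟨k, hk, hkN, t, ht, he⟩ := h
  obtain ⟨U, hU, hS, h1⟩ := eventually_nhdsSet_iff_open.mp he
  obtain ⟨V, hV, hSV, h2⟩ := ht.exists_open
  exact ⟨U ∩ V, hU.inter hV, subset_inter hS hSV, k, hk, hkN, t, h2.mono inter_subset_right,
    eventually_nhdsSet_of_open hU inter_subset_left h1⟩

lemma Reach.exists_open {N : ℕ} {S : Set 𝔼} {p p' : 𝔼 → ℕ → ι → ℂ} (h : Reach N S p p') :
    ∃ U, IsOpen U ∧ S ⊆ U ∧ Reach N U p p' := by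
  induction h with
  | refl => exact ⟨univ, isOpen_univ, subset_univ _, Relation.ReflTransGen.refl⟩
  | tail _ hs ih =>
    obtain ⟨U, hU, hS, h1⟩ := ih
    obtain ⟨V, hV, hSV, h2⟩ := hs.exists_open
    exact ⟨U ∩ V, hU.inter hV, subset_inter hS hSV,
      (Reach.mono h1 inter_subset_left).tail (h2.mono inter_subset_right)⟩

lemma Reach.of_eventually_eq {N : ℕ} (hN : 2 ≤ N) {S : Set 𝔼} {p p' : 𝔼 → ℕ → ι → ℂ}
    (h : ∀ᶠ y in 𝓝ˢ S, p' y = p y) : Reach N S p p' :=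
  Relation.ReflTransGen.single ⟨1, by omega, by omega, 0, Eventually.of_forall fun y =>
    differentiableAt_const 0, h.mono fun y hy => by simp [hy, moveAt_zero]⟩

end Chains

section Near

variable {ι : Type*} [Fintype ι]

/-- The vertex `q'` is reachable from `q` by the logarithmic move `nearMove`. -/
def NearAt (b q q' b' : ι → ℂ) : Prop :=
  b ⬝ᵥ q ≠ 0 ∧ b' ⬝ᵥ q ≠ 0 ∧ (b ⬝ᵥ q') / (b ⬝ᵥ q) ∈ Complex.slitPlane ∧
    ((b' ⬝ᵥ q') / (b' ⬝ᵥ q)) / ((b ⬝ᵥ q') / (b ⬝ᵥ q)) ∈ Complex.slitPlane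

/-- The parameter of the move from `q` to `q'`. -/
def nearMove (b q q' b' : ι → ℂ) : ℂ × (ι → ℂ) :=
  (Complex.log ((b ⬝ᵥ q') / (b ⬝ᵥ q)),
    ((b ⬝ᵥ q) * (b' ⬝ᵥ q) * expQuot (Complex.log
      (((b' ⬝ᵥ q') / (b' ⬝ᵥ q)) / ((b ⬝ᵥ q') / (b ⬝ᵥ q)))))⁻¹ •
      (((b ⬝ᵥ q') / (b ⬝ᵥ q))⁻¹ • q' - q))

lemma moveVec_nearMove {b q q' b' : ι → ℂ} (h : NearAt b q q' b') :
    moveVec (nearMove b q q' b') b q b' = q' := by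
  obtain ⟨h1, h2, h3, h4⟩ := h
  have h3 := Complex.slitPlane_ne_zero h3
  have h4 := Complex.slitPlane_ne_zero h4
  set w := (b ⬝ᵥ q') / (b ⬝ᵥ q) with hw
  set w' := ((b' ⬝ᵥ q') / (b' ⬝ᵥ q)) / w with hw'
  have hE := expQuot_log_ne_zero h4
  set E := expQuot (Complex.log w') with hEdef
  set η := ((b ⬝ᵥ q) * (b' ⬝ᵥ q) * E)⁻¹ • (w⁻¹ • q' - q) with hη
  have hnm : nearMove b q q' b' = (Complex.log w, η) := rfl
  have hbq' : b ⬝ᵥ q' = w * (b ⬝ᵥ q) := by rw [hw]; field_simp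
  have hbq'' : b' ⬝ᵥ q' = w' * w * (b' ⬝ᵥ q) := by rw [hw']; field_simp
  have hb : b ⬝ᵥ η = 0 := by
    simp only [hη, dotProduct_smul, dotProduct_sub, smul_eq_mul, hbq']
    field_simp; ring
  have hdir : moveDir b q η = (b ⬝ᵥ q) • η := by simp [moveDir, hb]
  have hlog : b' ⬝ᵥ moveDir b q η = Complex.log w' := by
    have := mul_expQuot (Complex.log w')
    rw [Complex.exp_log h4, ← hEdef] at this
    rw [hdir, dotProduct_smul, hη, dotProduct_smul, dotProduct_sub, dotProduct_smul, hbq'']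
    simp only [smul_eq_mul]
    clear_value w w' E
    field_simp
    linear_combination -this
  rw [hnm, moveVec]
  simp only [hlog, ← hEdef, Complex.exp_log h3]
  rw [hdir, hη, smul_smul, smul_smul]
  have : b' ⬝ᵥ q * E * (b ⬝ᵥ q) * ((b ⬝ᵥ q) * (b' ⬝ᵥ q) * E)⁻¹ = 1 := by field_simp
  rw [this, one_smul, add_sub_cancel, smul_smul, mul_inv_cancel₀ h3, one_smul]

lemma nearAt_self {b q b' : ι → ℂ} (h1 : b ⬝ᵥ q ≠ 0) (h2 : b' ⬝ᵥ q ≠ 0) : NearAt b q q b' := by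
  refine ⟨h1, h2, ?_, ?_⟩ <;> simp [h1, h2]

lemma ContinuousAt.dotProduct' {X : Type*} [TopologicalSpace X] {f g : X → ι → ℂ} {x : X}
    (hf : ContinuousAt f x) (hg : ContinuousAt g x) : ContinuousAt (fun y => f y ⬝ᵥ g y) x := by
  simp only [dotProduct]
  exact tendsto_finsetSum _ fun i _ => (continuousAt_pi.mp hf i).mul (continuousAt_pi.mp hg i)

lemma NearAt.eventually {X : Type*} [TopologicalSpace X] {b q q' b' : X → ι → ℂ} {x : X}
    (h : NearAt (b x) (q x) (q' x) (b' x)) (hb : ContinuousAt b x) (hq : ContinuousAt q x)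
    (hq' : ContinuousAt q' x) (hb' : ContinuousAt b' x) :
    ∀ᶠ y in 𝓝 x, NearAt (b y) (q y) (q' y) (b' y) := by
  obtain ⟨h1, h2, h3, h4⟩ := h
  have c1 := hb.dotProduct' hq
  have c2 := hb'.dotProduct' hq
  have c3 := (hb.dotProduct' hq').div₀ c1 h1
  have c4 := ((hb'.dotProduct' hq').div₀ c2 h2).div₀ c3 (Complex.slitPlane_ne_zero h3)
  filter_upwards [c1.eventually_ne h1, c2.eventually_ne h2,
    c3.eventually_mem (Complex.isOpen_slitPlane.mem_nhds h3),
    c4.eventually_mem (Complex.isOpen_slitPlane.mem_nhds h4)] with y e1 e2 e3 e4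
  exact ⟨e1, e2, e3, e4⟩

variable {𝔼 : Type*} [NormedAddCommGroup 𝔼] [NormedSpace ℂ 𝔼]

lemma DifferentiableAt.dotProduct' {f g : 𝔼 → ι → ℂ} {x : 𝔼} (hf : DifferentiableAt ℂ f x)
    (hg : DifferentiableAt ℂ g x) : DifferentiableAt ℂ (fun y => f y ⬝ᵥ g y) x := by
  simp only [dotProduct]
  exact DifferentiableAt.fun_sum fun i _ =>
    (differentiableAt_pi.mp hf i).mul (differentiableAt_pi.mp hg i)

lemma differentiableAt_nearMove {b q q' b' : 𝔼 → ι → ℂ} {x : 𝔼}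
    (h : NearAt (b x) (q x) (q' x) (b' x)) (hb : DifferentiableAt ℂ b x)
    (hq : DifferentiableAt ℂ q x) (hq' : DifferentiableAt ℂ q' x) (hb' : DifferentiableAt ℂ b' x) :
    DifferentiableAt ℂ (fun y => nearMove (b y) (q y) (q' y) (b' y)) x := by
  obtain ⟨h1, h2, h3, h4⟩ := h
  have c1 := hb.dotProduct' hq
  have c2 := hb'.dotProduct' hq
  have c3 : DifferentiableAt ℂ (fun y => (b y ⬝ᵥ q' y) / (b y ⬝ᵥ q y)) x :=
    (hb.dotProduct' hq').fun_mul (c1.fun_inv h1)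
  have c4 : DifferentiableAt ℂ (fun y =>
      ((b' y ⬝ᵥ q' y) / (b' y ⬝ᵥ q y)) / ((b y ⬝ᵥ q' y) / (b y ⬝ᵥ q y))) x :=
    ((hb'.dotProduct' hq').fun_mul (c2.fun_inv h2)).fun_mul
      (c3.fun_inv (Complex.slitPlane_ne_zero h3))
  have c5 : DifferentiableAt ℂ (fun y => expQuot (Complex.log
      (((b' y ⬝ᵥ q' y) / (b' y ⬝ᵥ q y)) / ((b y ⬝ᵥ q' y) / (b y ⬝ᵥ q y))))) x :=
    differentiable_expQuot.differentiableAt.comp x (c4.clog h4)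
  refine (c3.clog h3).prodMk (DifferentiableAt.fun_smul (DifferentiableAt.fun_inv
    ((c1.fun_mul c2).fun_mul c5) ?_)
    (((c3.fun_inv (Complex.slitPlane_ne_zero h3)).fun_smul hq').fun_sub hq))
  exact mul_ne_zero (mul_ne_zero h1 h2) (expQuot_log_ne_zero (Complex.slitPlane_ne_zero h4))

lemma HolNear.differentiableAt {F : Type*} [NormedAddCommGroup F] [NormedSpace ℂ F] {f : 𝔼 → F}
    {S : Set 𝔼} (h : HolNear f S) {x : 𝔼} (hx : x ∈ S) : DifferentiableAt ℂ f x :=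
  (eventually_nhdsSet_iff_forall.mp h x hx).self_of_nhds

lemma HolNear.continuousAt {F : Type*} [NormedAddCommGroup F] [NormedSpace ℂ F] {f : 𝔼 → F}
    {S : Set 𝔼} (h : HolNear f S) {x : 𝔼} (hx : x ∈ S) : ContinuousAt f x :=
  (h.differentiableAt hx).continuousAt

lemma ChainOn.gallery_at {N : ℕ} {e v : 𝔼 → ι → ℂ} {S : Set 𝔼} {p : 𝔼 → ℕ → ι → ℂ}
    (h : ChainOn N e v S p) {x : 𝔼} (hx : x ∈ S) : Gallery N (e x) (v x) (p x) :=
  (eventually_nhdsSet_iff_forall.mp h.gallery x hx).self_of_nhds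

/-- Two chains whose vertices are close can be joined by moves. -/
lemma reach_of_nearAt {N : ℕ} (hN : 2 ≤ N) {e v : 𝔼 → ι → ℂ} {S : Set 𝔼}
    {p q : 𝔼 → ℕ → ι → ℂ} (hp : ChainOn N e v S p) (hq : ChainOn N e v S q)
    (h : ∀ k, 0 < k → k < N → ∀ x ∈ S, NearAt (q x (k - 1)) (p x k) (q x k) (p x (k + 1))) :
    Reach N S p q := by
  have near : ∀ k, k + 1 < N → ∀ x ∈ S, ∀ᶠ y in 𝓝 x,
      NearAt (q y k) (p y (k + 1)) (q y (k + 1)) (p y (k + 2)) := fun k hk x hx =>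
    NearAt.eventually (b := fun y => q y k) (q := fun y => p y (k + 1))
      (q' := fun y => q y (k + 1)) (b' := fun y => p y (k + 2)) (h (k + 1) (by omega) hk x hx)
      ((hq.hol k).continuousAt hx) ((hp.hol (k + 1)).continuousAt hx)
      ((hq.hol (k + 1)).continuousAt hx) ((hp.hol (k + 2)).continuousAt hx)
  have key : ∀ k < N, Reach N S p fun x j => if j ≤ k then q x j else p x j := by
    intro k
    induction k with
    | zero =>
      intro _
      refine Reach.of_eventually_eq hN ?_
      filter_upwards [hp.gallery, hq.gallery] with y h1 h2
      funext j
      rcases Nat.eq_zero_or_pos j with rfl | hj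
      · simp [h1.left, h2.left]
      · simp [hj.ne']
    | succ k ih =>
      intro hk
      refine (ih (by omega)).tail ⟨k + 1, by omega, hk,
        fun x => nearMove (q x k) (p x (k + 1)) (q x (k + 1)) (p x (k + 2)), ?_, ?_⟩
      · rw [HolNear, eventually_nhdsSet_iff_forall]
        intro x hx
        have e1 := near k hk x hx
        filter_upwards [e1, eventually_nhdsSet_iff_forall.mp (hq.hol k) x hx,
          eventually_nhdsSet_iff_forall.mp (hp.hol (k + 1)) x hx,
          eventually_nhdsSet_iff_forall.mp (hq.hol (k + 1)) x hx,
          eventually_nhdsSet_iff_forall.mp (hp.hol (k + 2)) x hx] with y a1 a2 a3 a4 a5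
        exact differentiableAt_nearMove (b := fun y => q y k) (q := fun y => p y (k + 1))
          (q' := fun y => q y (k + 1)) (b' := fun y => p y (k + 2)) a1 a2 a3 a4 a5
      · rw [eventually_nhdsSet_iff_forall]
        intro x hx
        have e1 := near k hk x hx
        filter_upwards [e1] with y a1
        funext j
        by_cases hj : j = k + 1
        · subst hj
          rw [moveAt_same]
          simpa using (moveVec_nearMove a1).symm
        · rw [moveAt_of_ne hj]
          have : j ≤ k + 1 ↔ j ≤ k := by omega
          simp [this]
  refine (key (N - 1) (by omega)).trans (Reach.of_eventually_eq hN ?_)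
  filter_upwards [hp.gallery, hq.gallery] with y h1 h2
  funext j
  by_cases hj : j ≤ N - 1
  · simp [hj]
  · simp [hj, h1.right j (by omega), h2.right j (by omega)]

/-- Chains in a continuous family are joined by moves. -/
lemma reach_of_homotopy {N : ℕ} (hN : 2 ≤ N) {e v : 𝔼 → ι → ℂ} {S : Set 𝔼} (hS : IsCompact S)
    {T : Type*} [TopologicalSpace T] [PreconnectedSpace T] {H : T → 𝔼 → ℕ → ι → ℂ}
    (hH : ∀ t, ChainOn N e v S (H t))
    (hc : ∀ t, ∀ x ∈ S, ∀ k, ContinuousAt (fun y : T × 𝔼 => H y.1 y.2 k) (t, x)) (s t : T) :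
    Reach N S (H s) (H t) := by
  refine (isPreconnected_univ (α := T)).induction₂' (fun s t => Reach N S (H s) (H t))
    (fun s _ => ?_) (fun x y z _ _ _ h h' => h.trans h') (mem_univ s) (mem_univ t)
  rw [nhdsWithin_univ]
  have key : ∀ k, 0 < k → k < N → ∀ᶠ t in 𝓝 s, ∀ x ∈ S,
      NearAt (H t x (k - 1)) (H s x k) (H t x k) (H s x (k + 1)) ∧
      NearAt (H s x (k - 1)) (H t x k) (H s x k) (H t x (k + 1)) := by
    intro k hk hkN
    refine hS.eventually_forall_of_forall_eventually fun x hx => ?_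
    have hg := (hH s).gallery_at hx
    have g1 := hg.ne (k - 1) (by omega)
    rw [Nat.sub_add_cancel hk] at g1
    have g2 := hg.ne k hkN
    rw [dotProduct_comm] at g2
    have c : ∀ j, ContinuousAt (fun y : T × 𝔼 => H s y.2 j) (s, x) := fun j =>
      ContinuousAt.comp' (f := Prod.snd) (g := fun z => H s z j) (((hH s).hol j).continuousAt hx)
        continuousAt_snd
    exact (NearAt.eventually (b := fun y : T × 𝔼 => H y.1 y.2 (k - 1)) (q := fun y => H s y.2 k)
        (q' := fun y => H y.1 y.2 k) (b' := fun y => H s y.2 (k + 1)) (x := (s, x))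
        (nearAt_self g1 g2) (hc s x hx _) (c _) (hc s x hx _) (c _)).and
      (NearAt.eventually (b := fun y : T × 𝔼 => H s y.2 (k - 1)) (q := fun y => H y.1 y.2 k)
        (q' := fun y => H s y.2 k) (b' := fun y => H y.1 y.2 (k + 1)) (x := (s, x))
        (nearAt_self g1 g2) (c _) (hc s x hx _) (c _) (hc s x hx _))
  have key2 : ∀ᶠ t in 𝓝 s, ∀ k ∈ Finset.range N, 0 < k → ∀ x ∈ S,
      NearAt (H t x (k - 1)) (H s x k) (H t x k) (H s x (k + 1)) ∧
      NearAt (H s x (k - 1)) (H t x k) (H s x k) (H t x (k + 1)) := by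
    rw [Finset.eventually_all]
    intro k hk
    by_cases h0 : 0 < k
    · exact (key k h0 (Finset.mem_range.mp hk)).mono fun t ht _ => ht
    · exact Eventually.of_forall fun t h => absurd h h0
  filter_upwards [key2] with t ht
  exact ⟨reach_of_nearAt hN (hH s) (hH t) fun k hk hkN x hx =>
      (ht k (Finset.mem_range.mpr hkN) hk x hx).1,
    reach_of_nearAt hN (hH t) (hH s) fun k hk hkN x hx =>
      (ht k (Finset.mem_range.mpr hkN) hk x hx).2⟩

end Near

section Loop

variable {ι : Type*} [Fintype ι] {𝔼 : Type*} [NormedAddCommGroup 𝔼] [NormedSpace ℂ 𝔼]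

/-- The action of `A` on the vertices of even index, and of its contragredient on the others. -/
def vertexAct (A B : Matrix ι ι ℂ) (j : ℕ) (u : ι → ℂ) : ι → ℂ :=
  if Even j then A *ᵥ u else Bᵀ *ᵥ u

lemma vertexAct_dot [DecidableEq ι] {A B : Matrix ι ι ℂ} (h : A * B = 1) (j : ℕ) (u w : ι → ℂ) :
    vertexAct A B j u ⬝ᵥ vertexAct A B (j + 1) w = u ⬝ᵥ w := by
  have h' := mul_eq_one_comm.mp h
  by_cases hj : Even j
  · have hj' : ¬ Even (j + 1) := by simp [Nat.even_add_one, hj]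
    simp only [vertexAct, hj, hj', if_true, if_false]
    rw [dotProduct_mulVec, vecMul_transpose, mulVec_mulVec, h', one_mulVec]
  · have hj' : Even (j + 1) := by simp [Nat.even_add_one, hj]
    simp only [vertexAct, hj, hj', if_true, if_false]
    rw [dotProduct_comm, dotProduct_mulVec, vecMul_transpose, mulVec_mulVec, h', one_mulVec,
      dotProduct_comm]

lemma vertexAct_vertexAct [DecidableEq ι] {A B : Matrix ι ι ℂ} (h : A * B = 1) (j : ℕ)
    (u : ι → ℂ) : vertexAct A B j (vertexAct B A j u) = u := by
  by_cases hj : Even j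
  · simp [vertexAct, hj, mulVec_mulVec, h]
  · simp only [vertexAct, hj, if_false]
    rw [mulVec_mulVec, ← transpose_mul, h, transpose_one, one_mulVec]

lemma continuousAt_mulVec' {X : Type*} [TopologicalSpace X] {A : X → Matrix ι ι ℂ}
    {u : X → ι → ℂ} {x : X} (hA : ∀ a b, ContinuousAt (fun y => A y a b) x)
    (hu : ContinuousAt u x) : ContinuousAt (fun y => A y *ᵥ u y) x :=
  continuousAt_pi.mpr fun a => ContinuousAt.dotProduct' (continuousAt_pi.mpr (hA a)) hu

lemma continuousAt_vertexAct {X : Type*} [TopologicalSpace X] {A B : X → Matrix ι ι ℂ}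
    {u : X → ι → ℂ} {x : X} (hA : ∀ a b, ContinuousAt (fun y => A y a b) x)
    (hB : ∀ a b, ContinuousAt (fun y => B y a b) x) (j : ℕ)
    (hu : ContinuousAt u x) : ContinuousAt (fun y => vertexAct (A y) (B y) j (u y)) x := by
  by_cases hj : Even j
  · simp only [vertexAct, hj, if_true]
    exact continuousAt_mulVec' hA hu
  · simp only [vertexAct, hj, if_false]
    exact continuousAt_mulVec' (A := fun y => (B y)ᵀ) (fun a b => hB b a) hu

lemma differentiableAt_mulVec' {A : 𝔼 → Matrix ι ι ℂ} {u : 𝔼 → ι → ℂ} {x : 𝔼}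
    (hA : ∀ a b, DifferentiableAt ℂ (fun y => A y a b) x)
    (hu : DifferentiableAt ℂ u x) : DifferentiableAt ℂ (fun y => A y *ᵥ u y) x :=
  differentiableAt_pi.mpr fun a => DifferentiableAt.dotProduct' (differentiableAt_pi.mpr (hA a)) hu

lemma differentiableAt_vertexAct {A B : 𝔼 → Matrix ι ι ℂ} {u : 𝔼 → ι → ℂ} {x : 𝔼}
    (hA : ∀ a b, DifferentiableAt ℂ (fun y => A y a b) x)
    (hB : ∀ a b, DifferentiableAt ℂ (fun y => B y a b) x) (j : ℕ)
    (hu : DifferentiableAt ℂ u x) :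
    DifferentiableAt ℂ (fun y => vertexAct (A y) (B y) j (u y)) x := by
  by_cases hj : Even j
  · simp only [vertexAct, hj, if_true]
    exact differentiableAt_mulVec' hA hu
  · simp only [vertexAct, hj, if_false]
    exact differentiableAt_mulVec' (A := fun y => (B y)ᵀ) (fun a b => hB b a) hu

/-- Replacing the vertices of index between `off` and `off + M` by the translate of `d`. -/
def splice (A B : 𝔼 → Matrix ι ι ℂ) (off M : ℕ) (p d : 𝔼 → ℕ → ι → ℂ) (x : 𝔼) (k : ℕ) : ι → ℂ :=
  if off ≤ k ∧ k ≤ off + M then vertexAct (A x) (B x) (k - off) (d x k) else p x k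

lemma continuousAt_splice {off M : ℕ} {A B : 𝔼 → Matrix ι ι ℂ}
    (hA : ∀ a b, Differentiable ℂ (fun y => A y a b))
    (hB : ∀ a b, Differentiable ℂ (fun y => B y a b)) {T : Type*} [TopologicalSpace T]
    {p : 𝔼 → ℕ → ι → ℂ} {d : T → 𝔼 → ℕ → ι → ℂ} {t : T} {x : 𝔼} {k : ℕ}
    (hp : ContinuousAt (fun y => p y k) x)
    (hd : off ≤ k → k ≤ off + M → ContinuousAt (fun y : T × 𝔼 => d y.1 y.2 k) (t, x)) :
    ContinuousAt (fun y : T × 𝔼 => splice A B off M p (d y.1) y.2 k) (t, x) := by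
  by_cases a : off ≤ k ∧ k ≤ off + M
  · simp only [splice, a, true_and, if_true]
    exact continuousAt_vertexAct (A := fun y : T × 𝔼 => A y.2) (B := fun y : T × 𝔼 => B y.2)
      (fun a b => ContinuousAt.comp' (f := Prod.snd) (g := fun z => A z a b)
        (hA a b x).continuousAt continuousAt_snd)
      (fun a b => ContinuousAt.comp' (f := Prod.snd) (g := fun z => B z a b)
        (hB a b x).continuousAt continuousAt_snd) _ (hd a.1 a.2)
  · simp only [splice, a, if_false]
    exact ContinuousAt.comp' (f := Prod.snd) (g := fun z => p z k) hp continuousAt_snd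

/-- The set of `z` for which the interpolation of two loops is not a loop is finite. -/
lemma finite_setOf_interp_dot_eq_zero {a b c d : ι → ℂ} (h : a ⬝ᵥ c ≠ 0) :
    {z : ℂ | (a + z • (b - a)) ⬝ᵥ (c + z • (d - c)) = 0}.Finite := by
  let P : Polynomial ℂ := Polynomial.C (a ⬝ᵥ c) + Polynomial.X *
    (Polynomial.C (a ⬝ᵥ (d - c) + (b - a) ⬝ᵥ c) +
      Polynomial.X * Polynomial.C ((b - a) ⬝ᵥ (d - c)))
  have hP : P ≠ 0 := by
    intro h0
    have := congrArg (Polynomial.eval 0) h0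
    simp [P] at this
    exact h this
  refine (P.roots.toFinset.finite_toSet).subset fun z hz => ?_
  simp only [Finset.mem_coe, Multiset.mem_toFinset, Polynomial.mem_roots hP, Polynomial.IsRoot]
  rw [mem_ofPred_eq, add_dotProduct, dotProduct_add, dotProduct_add, smul_dotProduct,
    smul_dotProduct, dotProduct_smul, dotProduct_smul] at hz
  simp only [smul_eq_mul] at hz
  simp only [P, Polynomial.eval_add, Polynomial.eval_mul, Polynomial.eval_C, Polynomial.eval_X]
  linear_combination hz

/-- Contracting the base to the point `x₀`. -/
def contractTo (x₀ : 𝔼) (s : unitInterval) (x : 𝔼) : 𝔼 := x₀ + ((s : ℝ) : ℂ) • (x - x₀)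

lemma contractTo_mem {S : Set 𝔼} (hS : Convex ℝ S) {x₀ x : 𝔼} (h₀ : x₀ ∈ S) (hx : x ∈ S)
    (s : unitInterval) : contractTo x₀ s x ∈ S := by
  have := hS.add_smul_sub_mem h₀ hx s.2
  simpa [contractTo, Complex.coe_smul] using this

lemma continuous_contractTo (x₀ : 𝔼) :
    Continuous fun y : unitInterval × 𝔼 => contractTo x₀ y.1 y.2 := by
  unfold contractTo
  have : Continuous fun y : unitInterval × 𝔼 => (((y.1 : ℝ)) : ℂ) :=
    Complex.continuous_ofReal.comp (continuous_subtype_val.comp continuous_fst)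
  exact continuous_const.add (this.smul (continuous_snd.sub continuous_const))

lemma differentiable_contractTo (x₀ : 𝔼) (s : unitInterval) :
    Differentiable ℂ (contractTo x₀ s) := by
  unfold contractTo
  fun_prop

/-- Running back and forth along a chain of length `N`, ending where it ends. -/
def tripled (N : ℕ) (a b : 𝔼 → ℕ → ι → ℂ) (x : 𝔼) (k : ℕ) : ι → ℂ :=
  if k ≤ N then a x k else if k ≤ 2 * N then a x (2 * N - k) else b x (k - 2 * N)

lemma chainOn_tripled {N : ℕ} {e v : 𝔼 → ι → ℂ} {S : Set 𝔼} {a b : 𝔼 → ℕ → ι → ℂ}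
    (ha : ChainOn N e v S a) (hb : ChainOn N e v S b) :
    ChainOn (3 * N) e v S (tripled N a b) := by
  refine ⟨?_, fun k => ?_⟩
  · filter_upwards [ha.gallery, hb.gallery] with y h1 h2
    refine ⟨by simp [tripled, h1.left], fun k hk => ?_, fun k hk => ?_⟩
    · by_cases hN : N = 0
      · subst hN
        by_cases hk0 : k = 0
        · simp [tripled, hk0, h1.right]
        · simp [tripled, hk0, h2.right]
      · rw [tripled, if_neg (by omega), if_neg (by omega)]
        exact h2.right _ (by omega)
    · rcases lt_or_ge k N with h | h
      · rw [tripled, tripled, if_pos (by omega), if_pos (by omega)]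
        exact h1.ne k h
      · rcases lt_or_ge k (2 * N) with h' | h'
        · have e1 : tripled N a b y k = a y (2 * N - k) := by
            rw [tripled]
            split_ifs with h3
            · congr 1; omega
            · rfl
            · omega
          rw [e1, tripled, if_neg (by omega), if_pos (by omega), dotProduct_comm]
          have := h1.ne (2 * N - (k + 1)) (by omega)
          rwa [show 2 * N - (k + 1) + 1 = 2 * N - k by omega] at this
        · have e1 : tripled N a b y k = b y (k - 2 * N) := by
            rw [tripled]
            split_ifs with h3 h4
            · omega
            · have : k = 2 * N := by omega
              subst this
              simp [h1.left, h2.left]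
            · rfl
          rw [e1, tripled, if_neg (by omega), if_neg (by omega)]
          have := h2.ne (k - 2 * N) (by omega)
          rwa [show k - 2 * N + 1 = k + 1 - 2 * N by omega] at this
  · unfold tripled
    split_ifs
    · exact ha.hol _
    · exact ha.hol _
    · exact hb.hol _

variable [DecidableEq ι]

lemma chainOn_splice {N off M : ℕ} (hM : Even M) (hN : off + M ≤ N) {A B : 𝔼 → Matrix ι ι ℂ}
    (hAB : ∀ x, A x * B x = 1) (hA : ∀ a b, Differentiable ℂ (fun y => A y a b))
    (hB : ∀ a b, Differentiable ℂ (fun y => B y a b)) {e₀ : ι → ℂ} {e v : 𝔼 → ι → ℂ} {S : Set 𝔼}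
    {p d : 𝔼 → ℕ → ι → ℂ} (hp : ChainOn N e v S p)
    (hp₀ : ∀ᶠ y in 𝓝ˢ S, p y off = A y *ᵥ e₀) (hp₁ : ∀ᶠ y in 𝓝ˢ S, p y (off + M) = A y *ᵥ e₀)
    (hd : ∀ k, off ≤ k → k ≤ off + M → HolNear (fun y => d y k) S)
    (hd' : ∀ᶠ y in 𝓝ˢ S, d y off = e₀ ∧ d y (off + M) = e₀ ∧
      ∀ k, off ≤ k → k < off + M → d y k ⬝ᵥ d y (k + 1) ≠ 0) :
    ChainOn N e v S (splice A B off M p d) := by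
  refine ⟨?_, fun k => ?_⟩
  · filter_upwards [hp.gallery, hp₀, hp₁, hd'] with y h1 h2 h3 ⟨h4, h5, h6⟩
    have s0 : splice A B off M p d y off = p y off := by
      simp [splice, vertexAct, h4, h2]
    have s1 : splice A B off M p d y (off + M) = p y (off + M) := by
      simp [splice, vertexAct, h5, h3, hM]
    have s2 : ∀ k, k ≤ off ∨ off + M ≤ k → splice A B off M p d y k = p y k := by
      intro k hk
      by_cases a : k = off
      · rw [a, s0]
      by_cases b : k = off + M
      · rw [b, s1]
      · rw [splice, if_neg (by omega)]
    refine ⟨?_, fun k hk => ?_, fun k hk => ?_⟩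
    · rw [s2 0 (by omega), h1.left]
    · rw [s2 k (by omega), h1.right k hk]
    · by_cases a : off ≤ k ∧ k < off + M
      · rw [splice, splice, if_pos (by omega), if_pos (by omega),
          show k + 1 - off = (k - off) + 1 by omega, vertexAct_dot (hAB y)]
        exact h6 k a.1 a.2
      · rw [s2 k (by omega), s2 (k + 1) (by omega)]
        exact h1.ne k hk
  · by_cases a : off ≤ k ∧ k ≤ off + M
    · simp only [splice, a, true_and, if_true]
      filter_upwards [hd k a.1 a.2] with y hy
      exact differentiableAt_vertexAct (fun a b => hA a b y) (fun a b => hB a b y) _ hy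
    · simp only [splice, a, if_false]
      exact hp.hol k

/-- The family of loops obtained by restricting to the segment towards `x₀`. -/
def contractLoop (A B : 𝔼 → Matrix ι ι ℂ) (off : ℕ) (x₀ : 𝔼) (p : 𝔼 → ℕ → ι → ℂ)
    (s : unitInterval) (x : 𝔼) (k : ℕ) : ι → ℂ :=
  vertexAct (B (contractTo x₀ s x)) (A (contractTo x₀ s x)) (k - off) (p (contractTo x₀ s x) k)

section

variable {N off M : ℕ} {A B : 𝔼 → Matrix ι ι ℂ} {e₀ : ι → ℂ} {e v : 𝔼 → ι → ℂ}
  {S : Set 𝔼} {p p' : 𝔼 → ℕ → ι → ℂ}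

lemma gallery_contractLoop (hM : Even M) (hN : off + M ≤ N) (hBA : ∀ x, B x * A x = 1)
    {x₀ y : 𝔼} {s : unitInterval} {e v : ι → ℂ}
    (hp : Gallery N e v (p (contractTo x₀ s y)))
    (hp₀ : p (contractTo x₀ s y) off = A (contractTo x₀ s y) *ᵥ e₀)
    (hp₁ : p (contractTo x₀ s y) (off + M) = A (contractTo x₀ s y) *ᵥ e₀) :
    contractLoop A B off x₀ p s y off = e₀ ∧ contractLoop A B off x₀ p s y (off + M) = e₀ ∧
      ∀ k, off ≤ k → k < off + M →
        contractLoop A B off x₀ p s y k ⬝ᵥ contractLoop A B off x₀ p s y (k + 1) ≠ 0 := by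
  refine ⟨?_, ?_, fun k hk hk' => ?_⟩
  · simp [contractLoop, vertexAct, hp₀, mulVec_mulVec, hBA]
  · simp [contractLoop, vertexAct, hp₁, mulVec_mulVec, hBA, hM]
  · rw [contractLoop, contractLoop, show k + 1 - off = (k - off) + 1 by omega,
      vertexAct_dot (hBA _)]
    exact hp.ne k (by omega)

lemma reach_contractLoop (hN2 : 2 ≤ N) (hM : Even M) (hN : off + M ≤ N)
    (hAB : ∀ x, A x * B x = 1) (hA : ∀ a b, Differentiable ℂ (fun y => A y a b))
    (hB : ∀ a b, Differentiable ℂ (fun y => B y a b))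
    (hS : IsCompact S) (hconv : Convex ℝ S) {x₀ : 𝔼} (h₀ : x₀ ∈ S) (hp : ChainOn N e v S p)
    (hp₀ : ∀ᶠ y in 𝓝ˢ S, p y off = A y *ᵥ e₀) (hp₁ : ∀ᶠ y in 𝓝ˢ S, p y (off + M) = A y *ᵥ e₀)
    (s t : unitInterval) :
    Reach N S (splice A B off M p (contractLoop A B off x₀ p s))
      (splice A B off M p (contractLoop A B off x₀ p t)) := by
  have hBA : ∀ x, B x * A x = 1 := fun x => mul_eq_one_comm.mp (hAB x)
  have hmap : ∀ s, MapsTo (contractTo x₀ s) S S := fun s x hx => contractTo_mem hconv h₀ hx s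
  have htend : ∀ s, Tendsto (contractTo x₀ s) (𝓝ˢ S) (𝓝ˢ S) := fun s =>
    (differentiable_contractTo x₀ s).continuous.tendsto_nhdsSet (hmap s)
  refine reach_of_homotopy hN2 (e := e) (v := v) hS
    (H := fun s => splice A B off M p (contractLoop A B off x₀ p s)) (fun s => ?_)
    (fun s x hx k => ?_) s t
  · refine chainOn_splice hM hN hAB hA hB hp hp₀ hp₁ (fun k _ _ => ?_) ?_
    · filter_upwards [(htend s).eventually (hp.hol k)] with y hy
      refine differentiableAt_vertexAct (A := fun y => B (contractTo x₀ s y))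
        (B := fun y => A (contractTo x₀ s y)) (u := fun y => p (contractTo x₀ s y) k)
        (fun a b => ?_) (fun a b => ?_) _ ?_
      · exact ((hB a b).comp (differentiable_contractTo x₀ s)).differentiableAt
      · exact ((hA a b).comp (differentiable_contractTo x₀ s)).differentiableAt
      · exact DifferentiableAt.comp (g := fun z => p z k) y hy
          (differentiable_contractTo x₀ s).differentiableAt
    · filter_upwards [(htend s).eventually hp.gallery, (htend s).eventually hp₀,
        (htend s).eventually hp₁] with y h1 h2 h3
      exact gallery_contractLoop hM hN hBA h1 h2 h3
  · refine continuousAt_splice hA hB ((hp.hol k).continuousAt hx) fun _ _ => ?_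
    have hc := (continuous_contractTo x₀).continuousAt (x := (s, x))
    refine continuousAt_vertexAct (A := fun y : unitInterval × 𝔼 => B (contractTo x₀ y.1 y.2))
        (B := fun y : unitInterval × 𝔼 => A (contractTo x₀ y.1 y.2))
        (u := fun y : unitInterval × 𝔼 => p (contractTo x₀ y.1 y.2) k)
        (fun a b => ?_) (fun a b => ?_) _ ?_
    · exact ContinuousAt.comp' (g := fun z => B z a b) (hB a b _).continuousAt hc
    · exact ContinuousAt.comp' (g := fun z => A z a b) (hA a b _).continuousAt hc
    · exact ContinuousAt.comp' (g := fun z => p z k)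
        ((hp.hol k).continuousAt (contractTo_mem hconv h₀ hx s)) hc

lemma splice_contractLoop_one (hAB : ∀ x, A x * B x = 1) (x₀ : 𝔼) :
    splice A B off M p (contractLoop A B off x₀ p 1) = p := by
  funext x k
  have : contractTo x₀ 1 x = x := by simp [contractTo]
  by_cases a : off ≤ k ∧ k ≤ off + M
  · simp [splice, a, contractLoop, this, vertexAct_vertexAct (hAB x)]
  · simp only [splice, a, if_false]

lemma reach_splice_const (hN2 : 2 ≤ N) (hM : Even M) (hN : off + M ≤ N)
    (hAB : ∀ x, A x * B x = 1) (hA : ∀ a b, Differentiable ℂ (fun y => A y a b))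
    (hB : ∀ a b, Differentiable ℂ (fun y => B y a b)) (hS : IsCompact S) (hp : ChainOn N e v S p)
    (hp₀ : ∀ᶠ y in 𝓝ˢ S, p y off = A y *ᵥ e₀) (hp₁ : ∀ᶠ y in 𝓝ˢ S, p y (off + M) = A y *ᵥ e₀)
    {c c' : ℕ → ι → ℂ}
    (hc : c off = e₀ ∧ c (off + M) = e₀ ∧ ∀ k, off ≤ k → k < off + M → c k ⬝ᵥ c (k + 1) ≠ 0)
    (hc' : c' off = e₀ ∧ c' (off + M) = e₀ ∧
      ∀ k, off ≤ k → k < off + M → c' k ⬝ᵥ c' (k + 1) ≠ 0) :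
    Reach N S (splice A B off M p fun _ => c) (splice A B off M p fun _ => c') := by
  obtain ⟨R, hR, hmem⟩ : ∃ R : Set ℂ, R.Finite ∧ ∀ z, z ∈ Rᶜ ↔ ∀ k, off ≤ k → k < off + M →
      (c k + z • (c' k - c k)) ⬝ᵥ (c (k + 1) + z • (c' (k + 1) - c (k + 1))) ≠ 0 := by
    refine ⟨⋃ k ∈ Finset.Ico off (off + M), {z : ℂ | (c k + z • (c' k - c k)) ⬝ᵥ
      (c (k + 1) + z • (c' (k + 1) - c (k + 1))) = 0}, ?_, fun z => by simp⟩
    refine Set.Finite.biUnion (Finset.finite_toSet _) fun k hk => ?_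
    rw [Finset.mem_coe, Finset.mem_Ico] at hk
    exact finite_setOf_interp_dot_eq_zero (hc.2.2 k hk.1 hk.2)
  have hconn : IsConnected Rᶜ := hR.countable.isConnected_compl_of_one_lt_rank (by simp)
  have : PreconnectedSpace ↥(Rᶜ) := Subtype.preconnectedSpace hconn.isPreconnected
  have h0 : (0 : ℂ) ∈ Rᶜ := (hmem 0).mpr fun k h h' => by simpa using hc.2.2 k h h'
  have h1 : (1 : ℂ) ∈ Rᶜ := (hmem 1).mpr fun k h h' => by simpa using hc'.2.2 k h h'
  let d : ℂ → 𝔼 → ℕ → ι → ℂ := fun z _ k => c k + z • (c' k - c k)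
  have key : Reach N S (splice A B off M p (d 0)) (splice A B off M p (d 1)) := by
    refine reach_of_homotopy hN2 (e := e) (v := v) hS
      (H := fun z : ↥(Rᶜ) => splice A B off M p (d z)) (fun z => ?_) (fun z x hx k => ?_)
      ⟨0, h0⟩ ⟨1, h1⟩
    · exact chainOn_splice hM hN hAB hA hB hp hp₀ hp₁
        (fun k _ _ => Eventually.of_forall fun y => differentiableAt_const _)
        (Eventually.of_forall fun y => ⟨by simp [d, hc.1, hc'.1], by simp [d, hc.2.1, hc'.2.1],
          (hmem z).mp z.2⟩)
    · refine continuousAt_splice (d := fun z : ↥(Rᶜ) => d z) hA hB ((hp.hol k).continuousAt hx)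
        fun _ _ => ?_
      have : Continuous fun y : ↥(Rᶜ) × 𝔼 => c k + (y.1 : ℂ) • (c' k - c k) := by fun_prop
      exact this.continuousAt
  have e0 : d 0 = fun _ => c := by funext x k; simp [d]
  have e1 : d 1 = fun _ => c' := by funext x k; simp [d]
  rwa [e0, e1] at key

/-- Any two loops inserted at the same place of a chain are joined by moves. -/
lemma reach_of_loops (hN2 : 2 ≤ N) (hM : Even M) (hN : off + M ≤ N)
    (hAB : ∀ x, A x * B x = 1) (hA : ∀ a b, Differentiable ℂ (fun y => A y a b))
    (hB : ∀ a b, Differentiable ℂ (fun y => B y a b))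
    (hS : IsCompact S) (hconv : Convex ℝ S) (hne : S.Nonempty) (hp : ChainOn N e v S p)
    (hp' : ChainOn N e v S p')
    (hp₀ : ∀ᶠ y in 𝓝ˢ S, p y off = A y *ᵥ e₀) (hp₁ : ∀ᶠ y in 𝓝ˢ S, p y (off + M) = A y *ᵥ e₀)
    (hpp' : ∀ᶠ y in 𝓝ˢ S, ∀ k, k ≤ off ∨ off + M ≤ k → p' y k = p y k) :
    Reach N S p p' := by
  obtain ⟨x₀, h₀⟩ := hne
  have hBA : ∀ x, B x * A x = 1 := fun x => mul_eq_one_comm.mp (hAB x)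
  have hp₀' : ∀ᶠ y in 𝓝ˢ S, p' y off = A y *ᵥ e₀ := by
    filter_upwards [hp₀, hpp'] with y h1 h2
    rw [h2 _ (by omega), h1]
  have hp₁' : ∀ᶠ y in 𝓝ˢ S, p' y (off + M) = A y *ᵥ e₀ := by
    filter_upwards [hp₁, hpp'] with y h1 h2
    rw [h2 _ (by omega), h1]
  have hz : ∀ y, contractTo x₀ 0 y = x₀ := fun y => by simp [contractTo]
  have hself : ∀ {P : 𝔼 → Prop}, (∀ᶠ y in 𝓝ˢ S, P y) → P x₀ := fun h =>
    (eventually_nhdsSet_iff_forall.mp h x₀ h₀).self_of_nhds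
  have r1 := reach_contractLoop hN2 hM hN hAB hA hB hS hconv h₀ hp hp₀ hp₁ 1 0
  have r2 := reach_contractLoop hN2 hM hN hAB hA hB hS hconv h₀ hp' hp₀' hp₁' 0 1
  rw [splice_contractLoop_one hAB] at r1 r2
  have g1 := gallery_contractLoop (p := p) (x₀ := x₀) (y := x₀) (s := 0) (e₀ := e₀) hM hN hBA
    (by rw [hz]; exact hp.gallery_at h₀) (by rw [hz]; exact hself hp₀) (by rw [hz]; exact hself hp₁)
  have g2 := gallery_contractLoop (p := p') (x₀ := x₀) (y := x₀) (s := 0) (e₀ := e₀) hM hN hBA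
    (by rw [hz]; exact hp'.gallery_at h₀) (by rw [hz]; exact hself hp₀')
    (by rw [hz]; exact hself hp₁')
  have r3 := reach_splice_const hN2 hM hN hAB hA hB hS hp hp₀ hp₁ g1 g2
  have e1 : ∀ q : 𝔼 → ℕ → ι → ℂ, (fun _ => contractLoop A B off x₀ q 0 x₀) =
      contractLoop A B off x₀ q 0 := by
    intro q; funext x k; simp [contractLoop, hz]
  rw [e1, e1] at r3
  refine (r1.trans r3).trans (Relation.ReflTransGen.trans (Reach.of_eventually_eq hN2 ?_) r2)
  filter_upwards [hpp'] with y hy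
  funext k
  by_cases a : off ≤ k ∧ k ≤ off + M
  · simp only [splice, a, true_and, if_true]
  · simp only [splice, a, if_false]
    exact hy k (by omega)

end

/-- Over a convex set the tripled chains of any two chains are joined by moves. -/
lemma reach_tripled {N : ℕ} (hN : 2 ≤ N) {e₀ : ι → ℂ} {A B : 𝔼 → Matrix ι ι ℂ}
    (hAB : ∀ x, A x * B x = 1) (hA : ∀ a b, Differentiable ℂ (fun y => A y a b))
    (hB : ∀ a b, Differentiable ℂ (fun y => B y a b)) {S : Set 𝔼}
    (hS : IsCompact S) (hconv : Convex ℝ S) (hne : S.Nonempty) {a b : 𝔼 → ℕ → ι → ℂ}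
    (ha : ChainOn N (fun _ => e₀) (fun x => A x *ᵥ e₀) S a)
    (hb : ChainOn N (fun _ => e₀) (fun x => A x *ᵥ e₀) S b) :
    Reach (3 * N) S (tripled N a a) (tripled N b b) := by
  have haa := chainOn_tripled ha ha
  have hab := chainOn_tripled ha hb
  have hbb := chainOn_tripled hb hb
  have r1 : Reach (3 * N) S (tripled N a a) (tripled N a b) := by
    refine reach_of_loops (off := N) (M := 2 * N) (e₀ := e₀) (by omega) (by simp) (by omega)
      hAB hA hB hS
      hconv hne haa hab ?_ ?_ ?_
    · filter_upwards [ha.gallery] with y hy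
      simp [tripled, hy.right]
    · filter_upwards [haa.gallery] with y hy
      exact hy.right _ (by omega)
    · filter_upwards [haa.gallery, hab.gallery] with y h1 h2 k hk
      rcases hk with hk | hk
      · simp [tripled, hk]
      · rw [h1.right k (by omega), h2.right k (by omega)]
  have r2 : Reach (3 * N) S (tripled N a b) (tripled N b b) := by
    refine reach_of_loops (off := 0) (M := 2 * N) (A := fun _ => 1) (B := fun _ => 1) (e₀ := e₀)
      (by omega) (by simp) (by omega) (by simp) (fun _ _ => differentiable_const _)
      (fun _ _ => differentiable_const _) hS hconv hne hab hbb ?_ ?_ ?_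
    · filter_upwards [hab.gallery] with y hy
      simp [hy.left]
    · filter_upwards [ha.gallery] with y hy
      rw [tripled, if_neg (by omega), if_pos (by omega)]
      simp [hy.left]
    · filter_upwards [hab.gallery, hbb.gallery, ha.gallery, hb.gallery] with y h1 h2 h3 h4 k hk
      by_cases hk0 : k = 0
      · rw [hk0, h1.left, h2.left]
      · by_cases hk1 : k = 2 * N
        · rw [tripled, tripled, if_neg (by omega), if_pos (by omega), if_neg (by omega),
            if_pos (by omega)]
          simp [hk1, h3.left, h4.left]
        · rw [tripled, tripled, if_neg (by omega), if_neg (by omega), if_neg (by omega),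
            if_neg (by omega)]
  exact r1.trans r2

end Loop

end

noncomputable section

open Filter Topology Set Metric MeasureTheory

section HolomorphicIntegral

variable {m : ℕ} {E : Type*} [NormedAddCommGroup E] [NormedSpace ℂ E]

/-- A dominated integral of holomorphic functions is holomorphic. -/
lemma differentiableAt_integral_of_dominated {α : Type*} [MeasurableSpace α] {μ : Measure α}
    {F : (Fin m → ℂ) → α → E} {z₀ : Fin m → ℂ} {r : ℝ} (hr : 0 < r) {g : α → ℝ}
    (hF : ∀ᵐ a ∂μ, DifferentiableOn ℂ (fun z => F z a) (ball z₀ r))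
    (hmeas : ∀ z ∈ ball z₀ r, AEStronglyMeasurable (F z) μ)
    (hg : Integrable g μ) (hbound : ∀ᵐ a ∂μ, ∀ z ∈ ball z₀ r, ‖F z a‖ ≤ g a) :
    DifferentiableAt ℂ (fun z => ∫ a, F z a ∂μ) z₀ := by
  have hz₀ : z₀ ∈ ball z₀ r := mem_ball_self hr
  have hd : ∀ᵐ a ∂μ, DifferentiableAt ℂ (fun z => F z a) z₀ := hF.mono fun a ha =>
    ha.differentiableAt (ball_mem_nhds _ hr)
  have hmeas' : ∀ v : Fin m → ℂ,
      AEStronglyMeasurable (fun a => fderiv ℂ (fun z => F z a) z₀ v) μ := by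
    intro v
    have hc : Tendsto (fun n : ℕ => ‖(n : ℂ) + 1‖) atTop atTop := by
      have : (fun n : ℕ => ‖(n : ℂ) + 1‖) = fun n : ℕ => (n : ℝ) + 1 := by
        funext n
        rw [← Nat.cast_succ, Complex.norm_natCast, Nat.cast_succ]
      rw [this]
      exact tendsto_atTop_add_const_right _ _ tendsto_natCast_atTop_atTop
    have hlim : Tendsto (fun n : ℕ => z₀ + ((n : ℂ) + 1)⁻¹ • v) atTop (𝓝 z₀) := by
      have h1 : Tendsto (fun n : ℕ => ((n : ℂ) + 1)⁻¹) atTop (𝓝 0) := by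
        simpa using tendsto_one_div_add_atTop_nhds_zero_nat (𝕜 := ℂ)
      simpa using (tendsto_const_nhds (x := z₀)).add (h1.smul_const v)
    obtain ⟨n₀, hn₀⟩ := eventually_atTop.mp (hlim.eventually (ball_mem_nhds z₀ hr))
    refine aestronglyMeasurable_of_tendsto_ae atTop
      (f := fun n : ℕ => fun a => (((n + n₀ : ℕ) : ℂ) + 1) •
        (F (z₀ + (((n + n₀ : ℕ) : ℂ) + 1)⁻¹ • v) a - F z₀ a)) ?_ ?_
    · intro n
      exact ((hmeas _ (hn₀ _ (Nat.le_add_left _ _))).sub (hmeas _ hz₀)).const_smul _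
    · refine hd.mono fun a ha => ?_
      refine Tendsto.comp (g := fun n : ℕ => ((n : ℂ) + 1) •
        (F (z₀ + ((n : ℂ) + 1)⁻¹ • v) a - F z₀ a)) ?_ (tendsto_add_atTop_nat n₀)
      exact ha.hasFDerivAt.lim v hc
  have hmeasF : AEStronglyMeasurable (fun a => fderiv ℂ (fun z => F z a) z₀) μ := by
    have hrep : (fun a => fderiv ℂ (fun z => F z a) z₀) = fun a => ∑ i,
        ContinuousLinearMap.smulRightL ℂ (Fin m → ℂ) E (ContinuousLinearMap.proj i)
          (fderiv ℂ (fun z => F z a) z₀ (Pi.single i 1)) := by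
      funext a
      ext v
      conv_lhs => rw [pi_eq_sum_univ' v, map_sum]
      simp
    rw [hrep]
    exact Finset.aestronglyMeasurable_fun_sum _ fun i _ =>
      (ContinuousLinearMap.continuous _).comp_aestronglyMeasurable (hmeas' _)
  refine (hasFDerivAt_integral_of_dominated_loc_of_lip' (𝕜 := ℂ) (bound := fun a => 2 * g a / r)
    (F' := fun a => fderiv ℂ (fun z => F z a) z₀) (ball_mem_nhds z₀ hr)
    hmeas (hg.mono' (hmeas _ hz₀) (hbound.mono fun a ha => ha _ hz₀)) hmeasF ?_ ?_
    (hd.mono fun a ha => ha.hasFDerivAt)).2.differentiableAt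
  · filter_upwards [hF, hbound] with a ha hb x hx
    have := Complex.dist_le_div_mul_dist_of_mapsTo_ball (R₂ := 2 * g a) ha (fun y hy => by
      rw [mem_closedBall, dist_eq_norm]
      linarith [norm_sub_le (F y a) (F z₀ a), hb y hy, hb z₀ hz₀]) hx
    rwa [dist_eq_norm, dist_eq_norm] at this
  · exact (hg.const_mul 2).div_const r

/-- Weierstrass: a uniform limit of holomorphic functions is holomorphic. -/
lemma differentiableOn_of_tendstoUniformlyOn [CompleteSpace E] {H : Type*} [NormedAddCommGroup H]
    [NormedSpace ℂ H] {U : Set H} (hU : IsOpen U) {f : ℕ → H → E} {g : H → E}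
    (hf : ∀ n, DifferentiableOn ℂ (f n) U) (h : TendstoUniformlyOn f g atTop U) :
    DifferentiableOn ℂ g U := by
  intro z₀ hz₀
  obtain ⟨r, hr, hrU⟩ := Metric.isOpen_iff.mp hU z₀ hz₀
  have hsub : ball z₀ (r / 2) ⊆ U := (ball_subset_ball (by linarith)).trans hrU
  have hC : UniformCauchySeqOn (fun n => fderiv ℂ (f n)) atTop (ball z₀ (r / 2)) := by
    rw [Metric.uniformCauchySeqOn_iff]
    intro ε hε
    obtain ⟨N, hN⟩ := Metric.uniformCauchySeqOn_iff.mp h.uniformCauchySeqOn (ε * r / 8)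
      (by positivity)
    refine ⟨N, fun i hi j hj x hx => ?_⟩
    have hxb : ball x (r / 2) ⊆ U := fun y hy => hrU (by
      rw [mem_ball] at *
      linarith [dist_triangle y x z₀])
    have hxU := hxb (mem_ball_self (by linarith))
    have := Complex.norm_fderiv_le_div_of_mapsTo_ball (f := fun y => f i y - f j y) (c := x)
      (R₁ := r / 2) (R₂ := ε * r / 4) (((hf i).sub (hf j)).mono hxb) (fun y hy => by
        rw [mem_closedBall, dist_eq_norm]
        have h1 := hN i hi j hj y (hxb hy)
        have h2 := hN i hi j hj x hxU
        rw [dist_eq_norm] at h1 h2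
        linarith [norm_sub_le (f i y - f j y) (f i x - f j x)]) (by linarith)
    rw [dist_eq_norm]
    have hsub' : fderiv ℂ (fun y => f i y - f j y) x = fderiv ℂ (f i) x - fderiv ℂ (f j) x :=
      fderiv_fun_sub ((hf i).differentiableAt (hU.mem_nhds hxU))
        ((hf j).differentiableAt (hU.mem_nhds hxU))
    rw [hsub'] at this
    refine this.trans_lt ?_
    rw [div_lt_iff₀ (by positivity)]
    nlinarith [mul_pos hε hr]
  choose! g' hg' using fun x (hx : x ∈ ball z₀ (r / 2)) =>
    cauchySeq_tendsto_of_complete (hC.cauchySeq hx)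
  exact (hasFDerivAt_of_tendstoUniformlyOn isOpen_ball (hC.tendstoUniformlyOn_of_tendsto hg')
    (fun n x hx => ((hf n).differentiableAt (hU.mem_nhds (hsub hx))).hasFDerivAt)
    (fun x hx => h.tendsto_at (hsub hx))
    (mem_ball_self (by linarith : 0 < r / 2))).differentiableAt.differentiableWithinAt

/-- A compactly parametrised integral of holomorphic functions is holomorphic. -/
lemma differentiableAt_intervalIntegral {F : (Fin m → ℂ) → ℝ → E} {U : Set (Fin m → ℂ)}
    (hU : IsOpen U) {a b : ℝ} (hF : ∀ t ∈ uIcc a b, DifferentiableOn ℂ (fun z => F z t) U)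
    (hc : ContinuousOn (Function.uncurry F) (U ×ˢ uIcc a b)) {z₀ : Fin m → ℂ} (hz₀ : z₀ ∈ U) :
    DifferentiableAt ℂ (fun z => ∫ t in a..b, F z t) z₀ := by
  obtain ⟨r, hr, hrU⟩ := Metric.nhds_basis_closedBall.mem_iff.mp (hU.mem_nhds hz₀)
  obtain ⟨C, hC⟩ := ((isCompact_closedBall z₀ r).prod isCompact_uIcc).exists_bound_of_continuousOn
    (hc.mono (prod_mono hrU subset_rfl))
  have hsub : uIoc a b ⊆ uIcc a b := uIoc_subset_uIcc
  have key : DifferentiableAt ℂ (fun z => ∫ t in uIoc a b, F z t) z₀ := by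
    refine differentiableAt_integral_of_dominated (r := r) hr (g := fun _ => C) ?_ ?_ ?_ ?_
    · refine (ae_restrict_mem measurableSet_uIoc).mono fun t ht => ?_
      exact (hF t (hsub ht)).mono (ball_subset_closedBall.trans hrU)
    · intro z hz
      refine ContinuousOn.aestronglyMeasurable ?_ measurableSet_uIoc
      have : ContinuousOn (fun t => (z, t)) (uIoc a b) := by fun_prop
      exact hc.comp this fun t ht => ⟨hrU (ball_subset_closedBall hz), hsub ht⟩
    · exact integrableOn_const (by simp [uIoc])
    · refine (ae_restrict_mem measurableSet_uIoc).mono fun t ht z hz => ?_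
      exact hC (z, t) ⟨ball_subset_closedBall hz, hsub ht⟩
  simp only [intervalIntegral.intervalIntegral_eq_integral_uIoc]
  exact key.const_smul (if a ≤ b then (1 : ℝ) else -1)

end HolomorphicIntegral

section Rectangle

open Complex

/-- The Cauchy kernel along an edge seen from the right half plane. -/
lemma integral_inv_affine {u v : ℂ} {a b : ℝ}
    (h : ∀ t ∈ uIcc a b, u + t * v ∈ slitPlane) :
    ∫ t in a..b, v / (u + t * v) = log (u + b * v) - log (u + a * v) := by
  refine intervalIntegral.integral_eq_sub_of_hasDerivAt (f := fun t : ℝ => log (u + t * v))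
    (fun t ht => ?_) ?_
  · have h1 : HasDerivAt (fun t : ℝ => u + t * v) v t := by
      simpa using ((hasDerivAt_id t).ofReal_comp.mul_const v).const_add u
    exact h1.clog_real (h t ht)
  · refine ContinuousOn.intervalIntegrable ?_
    refine continuousOn_const.div (by fun_prop) fun t ht => slitPlane_ne_zero (h t ht)

lemma log_sub_log_div_I {a : ℂ} (hre : 0 < a.re) (him : 0 < a.im) :
    log a - log (-I * a) = I * (Real.pi / 2) := by
  have ha : a ≠ 0 := by rintro rfl; simp at hre
  have h1 : log (-I * a) = log (-I) + log a := by
    refine log_mul (by simp) ha ?_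
    rw [arg_neg_I]
    have h2 := (arg_lt_pi_div_two_iff (z := a)).mpr (Or.inl hre)
    have h3 := arg_nonneg_iff.mpr him.le
    constructor <;> linarith [Real.pi_pos]
  rw [h1, log_neg_I]
  ring

variable {E : Type*} [NormedAddCommGroup E] [NormedSpace ℂ E]

/-- The integral over the boundary of the rectangle `[a, b] × [c, d]`. -/
def rectIntegral (a b c d : ℝ) (f : ℂ → E) : E :=
  (((∫ x : ℝ in a..b, f (x + c * I)) - ∫ x : ℝ in a..b, f (x + d * I)) +
    I • ∫ y : ℝ in c..d, f (b + y * I)) - I • ∫ y : ℝ in c..d, f (a + y * I)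

/-- The closed rectangle `[a, b] × [c, d]`. -/
def closedRect (a b c d : ℝ) : Set ℂ := Icc a b ×ℂ Icc c d

variable {a b c d : ℝ} {w : ℂ}

lemma edges_subset (hab : a ≤ b) (hcd : c ≤ d) (hw : w ∈ Ioo a b ×ℂ Ioo c d) :
    MapsTo (fun x : ℝ => (x + c * I : ℂ)) (uIcc a b) (closedRect a b c d \ {w}) ∧
    MapsTo (fun x : ℝ => (x + d * I : ℂ)) (uIcc a b) (closedRect a b c d \ {w}) ∧
    MapsTo (fun y : ℝ => (b + y * I : ℂ)) (uIcc c d) (closedRect a b c d \ {w}) ∧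
    MapsTo (fun y : ℝ => (a + y * I : ℂ)) (uIcc c d) (closedRect a b c d \ {w}) := by
  obtain ⟨⟨h1, h2⟩, h3, h4⟩ := hw
  rw [uIcc_of_le hab, uIcc_of_le hcd]
  refine ⟨fun x hx => ⟨?_, ?_⟩, fun x hx => ⟨?_, ?_⟩, fun x hx => ⟨?_, ?_⟩, fun x hx => ⟨?_, ?_⟩⟩
  any_goals
    rintro rfl
    simp at h1 h2 h3 h4
  all_goals
    obtain ⟨hx₁, hx₂⟩ := hx
    refine ⟨?_, ?_⟩ <;> simp [*]

lemma edges_intervalIntegrable {F : Type*} [NormedAddCommGroup F] {f : ℂ → F} (hab : a ≤ b)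
    (hcd : c ≤ d) (hw : w ∈ Ioo a b ×ℂ Ioo c d) (hf : ContinuousOn f (closedRect a b c d \ {w})) :
    IntervalIntegrable (fun x : ℝ => f (x + c * I)) volume a b ∧
    IntervalIntegrable (fun x : ℝ => f (x + d * I)) volume a b ∧
    IntervalIntegrable (fun y : ℝ => f (b + y * I)) volume c d ∧
    IntervalIntegrable (fun y : ℝ => f (a + y * I)) volume c d := by
  obtain ⟨h1, h2, h3, h4⟩ := edges_subset hab hcd hw
  exact ⟨(hf.comp (by fun_prop) h1).intervalIntegrable,
    (hf.comp (by fun_prop) h2).intervalIntegrable,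
    (hf.comp (by fun_prop) h3).intervalIntegrable, (hf.comp (by fun_prop) h4).intervalIntegrable⟩

lemma rectIntegral_add {f g : ℂ → E} (hab : a ≤ b) (hcd : c ≤ d)
    (hw : w ∈ Ioo a b ×ℂ Ioo c d) (hf : ContinuousOn f (closedRect a b c d \ {w}))
    (hg : ContinuousOn g (closedRect a b c d \ {w})) :
    rectIntegral a b c d (fun ζ => f ζ + g ζ) =
      rectIntegral a b c d f + rectIntegral a b c d g := by
  obtain ⟨h1, h2, h3, h4⟩ := edges_intervalIntegrable hab hcd hw hf
  obtain ⟨k1, k2, k3, k4⟩ := edges_intervalIntegrable hab hcd hw hg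
  unfold rectIntegral
  rw [intervalIntegral.integral_add h1 k1, intervalIntegral.integral_add h2 k2,
    intervalIntegral.integral_add h3 k3, intervalIntegral.integral_add h4 k4]
  simp only [smul_add]
  abel

lemma rectIntegral_congr {f g : ℂ → E} (hab : a ≤ b) (hcd : c ≤ d)
    (hw : w ∈ Ioo a b ×ℂ Ioo c d) (h : EqOn f g (closedRect a b c d \ {w})) :
    rectIntegral a b c d f = rectIntegral a b c d g := by
  obtain ⟨h1, h2, h3, h4⟩ := edges_subset hab hcd hw
  unfold rectIntegral
  rw [intervalIntegral.integral_congr fun x hx => h (h1 hx),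
    intervalIntegral.integral_congr fun x hx => h (h2 hx),
    intervalIntegral.integral_congr fun x hx => h (h3 hx),
    intervalIntegral.integral_congr fun x hx => h (h4 hx)]

lemma rectIntegral_inv_sub (hw : w ∈ Ioo a b ×ℂ Ioo c d) :
    rectIntegral a b c d (fun ζ => (ζ - w)⁻¹) = 2 * Real.pi * I := by
  obtain ⟨⟨h1, h2⟩, h3, h4⟩ := hw
  have right : I • ∫ y : ℝ in c..d, ((b + y * I : ℂ) - w)⁻¹ =
      log (b - w + d * I) - log (b - w + c * I) := by
    rw [← integral_inv_affine (fun t _ => Or.inl (by simpa using h2)), smul_eq_mul,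
      ← intervalIntegral.integral_const_mul]
    congr 1; funext t; rw [div_eq_mul_inv]; ring_nf
  have left : I • ∫ y : ℝ in c..d, ((a + y * I : ℂ) - w)⁻¹ =
      log (w - a + d * (-I)) - log (w - a + c * (-I)) := by
    rw [← integral_inv_affine (fun t _ => Or.inl (by simpa using h1)), smul_eq_mul,
      ← intervalIntegral.integral_const_mul]
    congr 1; funext t; rw [div_eq_mul_inv, ← neg_sub w, inv_neg]; ring_nf
  have bot : ∫ x : ℝ in a..b, ((x + c * I : ℂ) - w)⁻¹ =
      log (I * (c * I - w) + b * I) - log (I * (c * I - w) + a * I) := by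
    rw [← integral_inv_affine (fun t _ => Or.inl (by simpa using h3))]
    congr 1; funext t
    rw [show I * (c * I - w) + t * I = I * (t + c * I - w) by ring, div_mul_cancel_left₀ I_ne_zero]
  have top : ∫ x : ℝ in a..b, ((x + d * I : ℂ) - w)⁻¹ =
      log (-I * (d * I - w) + b * (-I)) - log (-I * (d * I - w) + a * (-I)) := by
    rw [← integral_inv_affine (fun t _ => Or.inl (by simpa using h4))]
    congr 1; funext t
    rw [show -I * (d * I - w) + t * -I = -I * (t + d * I - w) by ring,
      div_mul_cancel_left₀ (neg_ne_zero.mpr I_ne_zero)]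
  have c1 := log_sub_log_div_I (a := b - w + d * I) (by simpa using h2) (by simpa using h4)
  have c2 := log_sub_log_div_I (a := -I * (d * I - w) + a * (-I)) (by simpa using h4)
    (by simpa using h1)
  have c3 := log_sub_log_div_I (a := w - a + c * (-I)) (by simpa using h1) (by simpa using h3)
  have c4 := log_sub_log_div_I (a := I * (c * I - w) + b * I) (by simpa using h3)
    (by simpa using h2)
  rw [show -I * (b - w + d * I) = -I * (d * I - w) + b * (-I) by ring] at c1
  rw [show -I * (-I * (d * I - w) + a * (-I)) = w - a + d * (-I) by
    linear_combination (d * I - w + a) * I_sq] at c2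
  rw [show -I * (w - a + c * (-I)) = I * (c * I - w) + a * I by ring] at c3
  rw [show -I * (I * (c * I - w) + b * I) = b - w + c * I by
    linear_combination -(c * I - w + b) * I_sq] at c4
  unfold rectIntegral
  rw [right, left, bot, top]
  linear_combination c1 + c2 + c3 + c4

lemma rectIntegral_smul_const (f : ℂ → ℂ) (x : E) [CompleteSpace E] :
    rectIntegral a b c d (fun ζ => f ζ • x) = rectIntegral a b c d f • x := by
  unfold rectIntegral
  simp only [intervalIntegral.integral_smul_const, sub_smul, add_smul, smul_assoc]

/-- Cauchy's integral formula on a rectangle. -/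
theorem rectIntegral_cauchy [CompleteSpace E] {g : ℂ → E} {U : Set ℂ} (hU : IsOpen U)
    (hsub : closedRect a b c d ⊆ U)
    (hg : DifferentiableOn ℂ g U) (hw : w ∈ Ioo a b ×ℂ Ioo c d) :
    rectIntegral a b c d (fun ζ => (ζ - w)⁻¹ • g ζ) = (2 * Real.pi * I : ℂ) • g w := by
  have hab : a ≤ b := (hw.1.1.trans hw.1.2).le
  have hcd : c ≤ d := (hw.2.1.trans hw.2.2).le
  have hwU : U ∈ 𝓝 w := hU.mem_nhds (hsub ⟨Ioo_subset_Icc_self hw.1, Ioo_subset_Icc_self hw.2⟩)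
  have hds : DifferentiableOn ℂ (dslope g w) U := (differentiableOn_dslope hwU).mpr hg
  have hR : uIcc a b ×ℂ uIcc c d = closedRect a b c d := by
    rw [uIcc_of_le hab, uIcc_of_le hcd]; rfl
  have hzero : rectIntegral a b c d (dslope g w) = 0 := by
    have := integral_boundary_rect_eq_zero_of_differentiableOn (dslope g w) (a + c * I) (b + d * I)
      (hds.mono (by simpa [hR] using hsub))
    simpa [rectIntegral] using this
  have hinv : ContinuousOn (fun ζ : ℂ => (ζ - w)⁻¹ • g w) (closedRect a b c d \ {w}) := by
    refine ContinuousOn.smul (ContinuousOn.inv₀ (by fun_prop) fun ζ hζ => ?_) continuousOn_const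
    exact sub_ne_zero.mpr hζ.2
  rw [rectIntegral_congr (g := fun ζ => dslope g w ζ + (ζ - w)⁻¹ • g w) hab hcd hw,
    rectIntegral_add hab hcd hw (hds.continuousOn.mono (sdiff_subset.trans hsub)) hinv,
    hzero, zero_add, rectIntegral_smul_const, rectIntegral_inv_sub hw]
  intro ζ hζ
  simp only [dslope_of_ne g hζ.2, slope, vsub_eq_sub, smul_sub, sub_add_cancel]

end Rectangle

section Runge

open Complex

variable {m : ℕ}

/-- The product of the closed rectangles `[a j, b j] × [c j, d j]`. -/
def rectBox (a b c d : Fin m → ℝ) : Set (Fin m → ℂ) :=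
  {z | ∀ j, z j ∈ closedRect (a j) (b j) (c j) (d j)}

/-- The `ρ`-neighbourhood of a box, unbounded in the coordinates belonging to `J`. -/
def openCylinder (a b c d : Fin m → ℝ) (ρ : ℝ) (J : Finset (Fin m)) : Set (Fin m → ℂ) :=
  {z | ∀ j ∉ J, z j ∈ Ioo (a j - ρ) (b j + ρ) ×ℂ Ioo (c j - ρ) (d j + ρ)}

variable {a b c d : Fin m → ℝ} {ρ : ℝ} {J : Finset (Fin m)}

lemma isCompact_rectBox : IsCompact (rectBox a b c d) := by
  have : rectBox a b c d = Set.pi univ fun j => closedRect (a j) (b j) (c j) (d j) := by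
    ext z; simp [rectBox]
  rw [this]
  exact isCompact_univ_pi fun j => isCompact_Icc.reProdIm isCompact_Icc

lemma isOpen_openCylinder : IsOpen (openCylinder a b c d ρ J) := by
  have : openCylinder a b c d ρ J = Set.pi (↑(Finset.univ \ J)) fun j =>
      Ioo (a j - ρ) (b j + ρ) ×ℂ Ioo (c j - ρ) (d j + ρ) := by
    ext z; simp [openCylinder, Set.mem_pi]
  rw [this]
  exact isOpen_set_pi (Finset.finite_toSet _) fun j _ => isOpen_Ioo.reProdIm isOpen_Ioo

lemma rectBox_subset_openCylinder (hρ : 0 < ρ) :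
    rectBox a b c d ⊆ openCylinder a b c d ρ J := by
  intro z hz j _
  obtain ⟨⟨h1, h2⟩, h3, h4⟩ := hz j
  exact ⟨⟨by linarith, by linarith⟩, by linarith, by linarith⟩

lemma update_mem_openCylinder {j : Fin m} {z : Fin m → ℂ} {ζ : ℂ}
    (hz : z ∈ openCylinder a b c d ρ (insert j J))
    (hζ : ζ ∈ Ioo (a j - ρ) (b j + ρ) ×ℂ Ioo (c j - ρ) (d j + ρ)) :
    Function.update z j ζ ∈ openCylinder a b c d ρ J := by
  intro i hi
  by_cases h : i = j
  · subst h; simpa using hζ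
  · rw [Function.update_of_ne h]
    exact hz i (by simp [h, hi])

lemma differentiable_update_left (j : Fin m) (ζ : ℂ) :
    Differentiable ℂ fun z : Fin m → ℂ => Function.update z j ζ := by
  rw [differentiable_pi]
  intro i
  by_cases h : i = j
  · subst h; simp
  · simp only [Function.update_of_ne h]; fun_prop

lemma differentiable_update_right (j : Fin m) (z : Fin m → ℂ) :
    Differentiable ℂ fun ζ : ℂ => Function.update z j ζ := by
  rw [differentiable_pi]
  intro i
  by_cases h : i = j
  · subst h; simp
  · simp only [Function.update_of_ne h]; fun_prop

lemma mul_expQuot_kernel {T u x : ℂ} (hx : x ≠ 0) :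
    x⁻¹ - T * u * expQuot (-(T * u * x)) = x⁻¹ * exp (-(T * u * x)) := by
  have h := mul_expQuot (-(T * u * x))
  have hx' : x⁻¹ * x = 1 := inv_mul_cancel₀ hx
  linear_combination x⁻¹ * h + T * u * expQuot (-(T * u * x)) * hx'

/-- Cauchy integrals along an edge are limits of functions entire in the integrated coordinate. -/
lemma exists_approx_edge (hρ : 0 < ρ) {j : Fin m} {f : (Fin m → ℂ) → ℂ}
    (hf : DifferentiableOn ℂ f (openCylinder a b c d ρ J)) {γ : ℝ → ℂ} (hγ : Continuous γ)
    {s t : ℝ} {u : ℂ} {δ : ℝ} (hδ : 0 < δ) (hu : ‖u‖ = 1)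
    (hγm : ∀ τ ∈ uIcc s t, γ τ ∈ Ioo (a j - ρ) (b j + ρ) ×ℂ Ioo (c j - ρ) (d j + ρ))
    (hγu : ∀ τ ∈ uIcc s t, ∀ x ∈ closedRect (a j) (b j) (c j) (d j), δ ≤ (u * (γ τ - x)).re)
    {ε : ℝ} (hε : 0 < ε) :
    ∃ g : (Fin m → ℂ) → ℂ, DifferentiableOn ℂ g (openCylinder a b c d ρ (insert j J)) ∧
      ∀ z ∈ rectBox a b c d,
        ‖(∫ τ in s..t, (γ τ - z j)⁻¹ • f (Function.update z j (γ τ))) - g z‖ < ε := by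
  have hcu : Continuous fun p : (Fin m → ℂ) × ℝ => Function.update p.1 j (γ p.2) :=
    continuous_fst.update j (hγ.comp continuous_snd)
  have hcf : ContinuousOn (fun p : (Fin m → ℂ) × ℝ => f (Function.update p.1 j (γ p.2)))
      (openCylinder a b c d ρ (insert j J) ×ˢ uIcc s t) :=
    hf.continuousOn.comp hcu.continuousOn fun p hp =>
      update_mem_openCylinder hp.1 (hγm _ hp.2)
  have hS : rectBox a b c d ⊆ openCylinder a b c d ρ (insert j J) :=
    rectBox_subset_openCylinder hρ
  obtain ⟨C, hC⟩ := (isCompact_rectBox.prod isCompact_uIcc).exists_bound_of_continuousOn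
    (hcf.mono (prod_mono hS subset_rfl))
  have hC' : ∀ z ∈ rectBox a b c d, ∀ τ ∈ uIcc s t, ‖f (Function.update z j (γ τ))‖ ≤ |C| :=
    fun z hz τ hτ => (hC (z, τ) ⟨hz, hτ⟩).trans (le_abs_self C)
  obtain ⟨T, hT, hTnn⟩ : ∃ T : ℝ, Real.exp (-(T * δ)) * (δ⁻¹ * |C| * |t - s|) < ε ∧ 0 ≤ T := by
    have h1 : Tendsto (fun T : ℝ => Real.exp (-(T * δ)) * (δ⁻¹ * |C| * |t - s|)) atTop
        (𝓝 (0 * (δ⁻¹ * |C| * |t - s|))) :=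
      (Real.tendsto_exp_neg_atTop_nhds_zero.comp (tendsto_id.atTop_mul_const hδ)).mul_const _
    rw [zero_mul] at h1
    exact ((h1.eventually (gt_mem_nhds hε)).and (eventually_ge_atTop 0)).exists
  refine ⟨fun z => ∫ τ in s..t, (T * u * expQuot (-(T * u * (γ τ - z j)))) •
    f (Function.update z j (γ τ)), fun z hz => ?_, fun z hz => ?_⟩
  · refine (differentiableAt_intervalIntegral isOpen_openCylinder (fun τ hτ => ?_) ?_
      hz).differentiableWithinAt
    · refine DifferentiableOn.fun_smul ?_ ?_
      · have := differentiable_expQuot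
        exact Differentiable.differentiableOn (by fun_prop)
      · exact hf.comp (differentiable_update_left j (γ τ)).differentiableOn
          fun z hz => update_mem_openCylinder hz (hγm τ hτ)
    · refine ContinuousOn.fun_smul
        (f := fun p : (Fin m → ℂ) × ℝ => T * u * expQuot (-(T * u * (γ p.2 - p.1 j))))
        (Continuous.continuousOn ?_) hcf
      have := differentiable_expQuot.continuous
      fun_prop
  · have hne : ∀ τ ∈ uIcc s t, δ ≤ ‖γ τ - z j‖ := fun τ hτ => by
      have := (hγu τ hτ _ (hz j)).trans (re_le_norm _)
      rwa [norm_mul, hu, one_mul] at this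
    have hne' : ∀ τ ∈ uIcc s t, γ τ - z j ≠ 0 := fun τ hτ => by
      rw [← norm_pos_iff]; linarith [hne τ hτ]
    have hfz : ContinuousOn (fun τ => f (Function.update z j (γ τ))) (uIcc s t) :=
      hcf.comp (f := fun τ => (z, τ)) (by fun_prop) fun τ hτ => ⟨hS hz, hτ⟩
    rw [← intervalIntegral.integral_sub]
    · have hle : ∀ τ ∈ uIoc s t, ‖(γ τ - z j)⁻¹ • f (Function.update z j (γ τ)) -
          (T * u * expQuot (-(T * u * (γ τ - z j)))) • f (Function.update z j (γ τ))‖ ≤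
          Real.exp (-(T * δ)) * (δ⁻¹ * |C|) := by
        intro τ hτ
        have hτ' := uIoc_subset_uIcc hτ
        rw [← sub_smul, mul_expQuot_kernel (hne' τ hτ'), norm_smul, norm_mul, norm_inv, norm_exp]
        have e1 : (-(T * u * (γ τ - z j))).re ≤ -(T * δ) := by
          have := mul_le_mul_of_nonneg_left (hγu τ hτ' _ (hz j)) hTnn
          rw [mul_assoc, neg_re, re_ofReal_mul]
          linarith
        have e2 : ‖γ τ - z j‖⁻¹ ≤ δ⁻¹ := inv_anti₀ hδ (hne τ hτ')
        have e3 := hC' z hz τ hτ'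
        calc _ ≤ δ⁻¹ * Real.exp (-(T * δ)) * |C| := by gcongr
          _ = _ := by ring
      have := intervalIntegral.norm_integral_le_of_norm_le_const hle
      refine this.trans_lt ?_
      rwa [mul_assoc]
    · refine (ContinuousOn.smul (ContinuousOn.inv₀ (by fun_prop) hne') hfz).intervalIntegrable
    · refine (ContinuousOn.fun_smul
        (f := fun τ => T * u * expQuot (-(T * u * (γ τ - z j))))
        (Continuous.continuousOn ?_) hfz).intervalIntegrable
      have := differentiable_expQuot.continuous
      fun_prop

lemma exists_approx_insert (hρ : 0 < ρ) (j : Fin m) {f : (Fin m → ℂ) → ℂ}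
    (hf : DifferentiableOn ℂ f (openCylinder a b c d ρ J)) {ε : ℝ} (hε : 0 < ε) :
    ∃ g : (Fin m → ℂ) → ℂ, DifferentiableOn ℂ g (openCylinder a b c d ρ (insert j J)) ∧
      ∀ z ∈ rectBox a b c d, ‖f z - g z‖ < ε := by
  rcases (rectBox a b c d).eq_empty_or_nonempty with he | ⟨z₀, hz₀⟩
  · exact ⟨fun _ => 0, differentiableOn_const 0, by simp [he]⟩
  have hab : a j ≤ b j := (hz₀ j).1.1.trans (hz₀ j).1.2
  have hcd : c j ≤ d j := (hz₀ j).2.1.trans (hz₀ j).2.2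
  have hab' : a j - ρ / 2 ≤ b j + ρ / 2 := by linarith
  have hcd' : c j - ρ / 2 ≤ d j + ρ / 2 := by linarith
  have hρ2 : 0 < ρ / 2 := by linarith
  obtain ⟨g₁, hg₁, k₁⟩ := exists_approx_edge hρ hf (j := j)
    (γ := fun x : ℝ => x + (c j - ρ / 2 : ℝ) * I) (by fun_prop)
    (s := a j - ρ / 2) (t := b j + ρ / 2) (u := I) hρ2 (by simp)
    (fun τ hτ => by
      rw [uIcc_of_le hab'] at hτ
      obtain ⟨h1, h2⟩ := hτ
      refine ⟨⟨?_, ?_⟩, ?_, ?_⟩ <;> simp <;> linarith)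
    (fun τ hτ x hx => by obtain ⟨⟨h1, h2⟩, h3, h4⟩ := hx; simp at *; linarith) hε
  obtain ⟨g₂, hg₂, k₂⟩ := exists_approx_edge hρ hf (j := j)
    (γ := fun x : ℝ => x + (d j + ρ / 2 : ℝ) * I) (by fun_prop)
    (s := a j - ρ / 2) (t := b j + ρ / 2) (u := -I) hρ2 (by simp)
    (fun τ hτ => by
      rw [uIcc_of_le hab'] at hτ
      obtain ⟨h1, h2⟩ := hτ
      refine ⟨⟨?_, ?_⟩, ?_, ?_⟩ <;> simp <;> linarith)
    (fun τ hτ x hx => by obtain ⟨⟨h1, h2⟩, h3, h4⟩ := hx; simp at *; linarith) hε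
  obtain ⟨g₃, hg₃, k₃⟩ := exists_approx_edge hρ hf (j := j)
    (γ := fun y : ℝ => (b j + ρ / 2 : ℝ) + y * I) (by fun_prop)
    (s := c j - ρ / 2) (t := d j + ρ / 2) (u := 1) hρ2 (by simp)
    (fun τ hτ => by
      rw [uIcc_of_le hcd'] at hτ
      obtain ⟨h1, h2⟩ := hτ
      refine ⟨⟨?_, ?_⟩, ?_, ?_⟩ <;> simp <;> linarith)
    (fun τ hτ x hx => by obtain ⟨⟨h1, h2⟩, h3, h4⟩ := hx; simp at *; linarith) hε
  obtain ⟨g₄, hg₄, k₄⟩ := exists_approx_edge hρ hf (j := j)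
    (γ := fun y : ℝ => (a j - ρ / 2 : ℝ) + y * I) (by fun_prop)
    (s := c j - ρ / 2) (t := d j + ρ / 2) (u := -1) hρ2 (by simp)
    (fun τ hτ => by
      rw [uIcc_of_le hcd'] at hτ
      obtain ⟨h1, h2⟩ := hτ
      refine ⟨⟨?_, ?_⟩, ?_, ?_⟩ <;> simp <;> linarith)
    (fun τ hτ x hx => by obtain ⟨⟨h1, h2⟩, h3, h4⟩ := hx; simp at *; linarith) hε
  have hpi : (2 * Real.pi * I : ℂ) ≠ 0 := by simp [Real.pi_ne_zero]
  refine ⟨fun z => (2 * Real.pi * I)⁻¹ * (g₁ z - g₂ z + I * g₃ z - I * g₄ z), ?_, fun z hz => ?_⟩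
  · exact ((hg₁.sub hg₂).add (hg₃.const_mul I)).sub (hg₄.const_mul I) |>.const_mul _
  · have hopen : IsOpen (Ioo (a j - ρ) (b j + ρ) ×ℂ Ioo (c j - ρ) (d j + ρ)) :=
      isOpen_Ioo.reProdIm isOpen_Ioo
    have hcauchy := rectIntegral_cauchy (w := z j) (g := fun ζ => f (Function.update z j ζ))
      (a := a j - ρ / 2) (b := b j + ρ / 2) (c := c j - ρ / 2) (d := d j + ρ / 2) hopen
      (fun x hx => by
        obtain ⟨⟨h1, h2⟩, h3, h4⟩ := hx
        exact ⟨⟨by linarith, by linarith⟩, by linarith, by linarith⟩)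
      (hf.comp (differentiable_update_right j z).differentiableOn fun ζ hζ =>
        update_mem_openCylinder (rectBox_subset_openCylinder hρ hz) hζ)
      (by
        obtain ⟨⟨h1, h2⟩, h3, h4⟩ := hz j
        exact ⟨⟨by linarith, by linarith⟩, by linarith, by linarith⟩)
    rw [Function.update_eq_self] at hcauchy
    have hfz : f z = (2 * Real.pi * I)⁻¹ * ((2 * Real.pi * I : ℂ) • f z) := by
      rw [smul_eq_mul, inv_mul_cancel_left₀ hpi]
    rw [hfz, ← hcauchy, ← mul_sub, norm_mul]
    have hn := (k₁ z hz)
    have hn₂ := (k₂ z hz)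
    have hn₃ := (k₃ z hz)
    have hn₄ := (k₄ z hz)
    unfold rectIntegral
    set i₁ := ∫ τ in (a j - ρ / 2)..(b j + ρ / 2), ((τ + (c j - ρ / 2 : ℝ) * I : ℂ) - z j)⁻¹ •
      f (Function.update z j (τ + (c j - ρ / 2 : ℝ) * I))
    set i₂ := ∫ τ in (a j - ρ / 2)..(b j + ρ / 2), ((τ + (d j + ρ / 2 : ℝ) * I : ℂ) - z j)⁻¹ •
      f (Function.update z j (τ + (d j + ρ / 2 : ℝ) * I))
    set i₃ := ∫ τ in (c j - ρ / 2)..(d j + ρ / 2), (((b j + ρ / 2 : ℝ) + τ * I : ℂ) - z j)⁻¹ •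
      f (Function.update z j ((b j + ρ / 2 : ℝ) + τ * I))
    set i₄ := ∫ τ in (c j - ρ / 2)..(d j + ρ / 2), (((a j - ρ / 2 : ℝ) + τ * I : ℂ) - z j)⁻¹ •
      f (Function.update z j ((a j - ρ / 2 : ℝ) + τ * I))
    have hpi' : ‖(2 * Real.pi * I : ℂ)⁻¹‖ ≤ 1 / 4 := by
      rw [norm_inv, norm_mul, norm_mul, norm_I, Complex.norm_real,
        Real.norm_of_nonneg Real.pi_pos.le]
      rw [inv_le_comm₀ (by simp [Real.pi_pos]) (by norm_num)]
      simp; linarith [Real.pi_gt_three]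
    have heq : i₁ - i₂ + I • i₃ - I • i₄ - (g₁ z - g₂ z + I * g₃ z - I * g₄ z) =
      (i₁ - g₁ z) - (i₂ - g₂ z) + I * (i₃ - g₃ z) - I * (i₄ - g₄ z) := by
      simp only [smul_eq_mul]; ring
    rw [heq]
    have hI : ∀ x : ℂ, ‖I * x‖ = ‖x‖ := fun x => by simp
    have h4 : ‖(i₁ - g₁ z) - (i₂ - g₂ z) + I * (i₃ - g₃ z) - I * (i₄ - g₄ z)‖ < 4 * ε := by
      refine (norm_sub_le _ _).trans_lt ?_
      rw [hI]
      have := norm_add_le ((i₁ - g₁ z) - (i₂ - g₂ z)) (I * (i₃ - g₃ z))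
      rw [hI] at this
      linarith [norm_sub_le (i₁ - g₁ z) (i₂ - g₂ z)]
    nlinarith [norm_nonneg ((i₁ - g₁ z) - (i₂ - g₂ z) + I * (i₃ - g₃ z) - I * (i₄ - g₄ z))]

lemma openCylinder_subset_cthickening (hne : (rectBox a b c d).Nonempty) (hρ : 0 < ρ) :
    openCylinder a b c d (ρ / 2) ∅ ⊆ cthickening ρ (rectBox a b c d) := by
  obtain ⟨z₀, hz₀⟩ := hne
  intro z hz
  refine mem_cthickening_of_dist_le z
    (fun j => ⟨max (a j) (min (z j).re (b j)), max (c j) (min (z j).im (d j))⟩) ρ _ ?_ ?_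
  · intro j
    have hab : a j ≤ b j := (hz₀ j).1.1.trans (hz₀ j).1.2
    have hcd : c j ≤ d j := (hz₀ j).2.1.trans (hz₀ j).2.2
    exact ⟨⟨le_max_left _ _, max_le hab (min_le_right _ _)⟩, le_max_left _ _,
      max_le hcd (min_le_right _ _)⟩
  · rw [dist_pi_le_iff hρ.le]
    intro j
    obtain ⟨⟨h1, h2⟩, h3, h4⟩ := hz j (Finset.notMem_empty j)
    have hab : a j ≤ b j := (hz₀ j).1.1.trans (hz₀ j).1.2
    have hcd : c j ≤ d j := (hz₀ j).2.1.trans (hz₀ j).2.2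
    rw [dist_eq_norm]
    refine (norm_le_abs_re_add_abs_im _).trans ?_
    simp only [sub_re, sub_im]
    have e1 : |(z j).re - max (a j) (min (z j).re (b j))| ≤ ρ / 2 := by
      rw [abs_le]; grind
    have e2 : |(z j).im - max (c j) (min (z j).im (d j))| ≤ ρ / 2 := by
      rw [abs_le]; grind
    linarith

/-- Runge approximation on a closed box. -/
theorem exists_entire_approx_rectBox {f : (Fin m → ℂ) → ℂ} (hf : HolNear f (rectBox a b c d))
    {ε : ℝ} (hε : 0 < ε) :
    ∃ g : (Fin m → ℂ) → ℂ, Differentiable ℂ g ∧ ∀ z ∈ rectBox a b c d, ‖f z - g z‖ < ε := by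
  rcases (rectBox a b c d).eq_empty_or_nonempty with he | hne
  · exact ⟨fun _ => 0, differentiable_const 0, by simp [he]⟩
  obtain ⟨U, hU, hSU, hfU⟩ := hf.exists_open
  obtain ⟨ρ, hρ, hρU⟩ := isCompact_rectBox.exists_cthickening_subset_open hU hSU
  have key : ∀ J : Finset (Fin m), ∀ ε > 0, ∃ g : (Fin m → ℂ) → ℂ,
      DifferentiableOn ℂ g (openCylinder a b c d (ρ / 2) J) ∧
      ∀ z ∈ rectBox a b c d, ‖f z - g z‖ < ε := by
    intro J
    induction J using Finset.induction_on with
    | empty =>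
      refine fun ε hε => ⟨f, fun z hz => ?_, fun z _ => by simpa using hε⟩
      exact (hfU.differentiableAt
        (hρU (openCylinder_subset_cthickening hne hρ hz))).differentiableWithinAt
    | insert j J _ ih =>
      intro ε hε
      obtain ⟨g, hg, hfg⟩ := ih (ε / 2) (by positivity)
      obtain ⟨g', hg', hfg'⟩ := exists_approx_insert (by positivity) j hg (half_pos hε)
      refine ⟨g', hg', fun z hz => ?_⟩
      have := norm_sub_le_norm_sub_add_norm_sub (f z) (g z) (g' z)
      linarith [hfg z hz, hfg' z hz]
  obtain ⟨g, hg, hfg⟩ := key Finset.univ ε hε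
  refine ⟨g, fun z => hg.differentiableAt (isOpen_openCylinder.mem_nhds ?_), hfg⟩
  simp [openCylinder]

end Runge

section Strip

open Complex

variable {E : Type*} [NormedAddCommGroup E] [NormedSpace ℂ E]

/-- The Cauchy kernel with a Gaussian convergence factor. -/
def gaussKernel (u : ℂ) : ℂ := u⁻¹ * exp (-u ^ 2)

lemma norm_exp_neg_sq (u : ℂ) : ‖exp (-u ^ 2)‖ = Real.exp (u.im ^ 2) * Real.exp (-u.re ^ 2) := by
  rw [norm_exp, ← Real.exp_add]
  congr 1
  simp [pow_two, sub_eq_add_neg]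

lemma norm_gaussKernel_le {u : ℂ} (hu : u.im ≠ 0) :
    ‖gaussKernel u‖ ≤ |u.im|⁻¹ * Real.exp (u.im ^ 2) * Real.exp (-u.re ^ 2) := by
  rw [gaussKernel, norm_mul, norm_inv, norm_exp_neg_sq, mul_assoc]
  gcongr
  · exact abs_im_le_norm u

lemma differentiableAt_gaussKernel {u : ℂ} (hu : u ≠ 0) : DifferentiableAt ℂ gaussKernel u := by
  unfold gaussKernel
  exact (differentiableAt_inv hu).fun_mul (by fun_prop)

/-- The horizontal strip of half-width `θ`. -/
def hstrip (θ : ℝ) : Set ℂ := {ζ | |ζ.im| < θ}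

lemma isOpen_hstrip (θ : ℝ) : IsOpen (hstrip θ) :=
  isOpen_lt (by fun_prop) continuous_const

lemma line_mem_hstrip {s θ : ℝ} (hs : |s| < θ) (x : ℝ) : (x + s * I : ℂ) ∈ hstrip θ := by
  simpa [hstrip] using hs

lemma integrable_shifted_gaussian (c : ℝ) : Integrable fun x : ℝ => Real.exp (-(x - c) ^ 2) := by
  have := (integrable_exp_neg_mul_sq (b := 1) one_pos).comp_sub_right c
  simpa using this

lemma integral_shifted_gaussian (c : ℝ) : ∫ x : ℝ, Real.exp (-(x - c) ^ 2) = √Real.pi := by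
  have h := integral_gaussian 1
  rw [← integral_sub_right_eq_self _ c] at h
  simpa using h

variable {g : ℂ → E} {θ s M : ℝ} {w : ℂ}

lemma norm_line_kernel_le (hM : ∀ ζ ∈ hstrip θ, ‖g ζ‖ ≤ M) (hs : |s| < θ) (hsw : s ≠ w.im) (x : ℝ) :
    ‖gaussKernel (x + s * I - w) • g (x + s * I)‖ ≤
      |s - w.im|⁻¹ * Real.exp ((s - w.im) ^ 2) * M * Real.exp (-(x - w.re) ^ 2) := by
  have h1 := norm_gaussKernel_le (u := x + s * I - w) (by simpa using sub_ne_zero.mpr hsw)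
  simp only [sub_im, add_im, ofReal_im, mul_im, ofReal_re, I_im, mul_one, I_re, mul_zero, add_zero,
    zero_add, sub_re, add_re, mul_re, sub_zero] at h1
  rw [norm_smul]
  calc _ ≤ |s - w.im|⁻¹ * Real.exp ((s - w.im) ^ 2) * Real.exp (-(x - w.re) ^ 2) * M := by
        gcongr
        exact hM _ (line_mem_hstrip hs x)
    _ = _ := by ring

lemma continuous_line_kernel (hg : ContinuousOn g (hstrip θ)) (hs : |s| < θ) (hsw : s ≠ w.im) :
    Continuous fun x : ℝ => gaussKernel (x + s * I - w) • g (x + s * I) := by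
  refine Continuous.smul ?_ ?_
  · refine continuous_iff_continuousAt.mpr fun x => ?_
    refine ContinuousAt.comp (g := gaussKernel) (f := fun x : ℝ => (x + s * I - w : ℂ)) ?_
      (by fun_prop)
    refine (differentiableAt_gaussKernel fun h => hsw ?_).continuousAt
    have := congrArg im h
    simpa [sub_eq_zero] using this
  · exact hg.comp_continuous (by fun_prop) fun x => line_mem_hstrip hs x

lemma integrable_line_kernel (hg : ContinuousOn g (hstrip θ)) (hM : ∀ ζ ∈ hstrip θ, ‖g ζ‖ ≤ M)
    (hs : |s| < θ) (hsw : s ≠ w.im) :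
    Integrable fun x : ℝ => gaussKernel (x + s * I - w) • g (x + s * I) :=
  ((integrable_shifted_gaussian w.re).const_mul _).mono'
    (continuous_line_kernel hg hs hsw).aestronglyMeasurable
    (.of_forall fun x => norm_line_kernel_le hM hs hsw x)

lemma norm_integral_line_kernel_le (hM : ∀ ζ ∈ hstrip θ, ‖g ζ‖ ≤ M)
    (hs : |s| < θ) (hsw : s ≠ w.im) :
    ‖∫ x : ℝ, gaussKernel (x + s * I - w) • g (x + s * I)‖ ≤
      |s - w.im|⁻¹ * Real.exp ((s - w.im) ^ 2) * M * √Real.pi := by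
  refine (norm_integral_le_of_norm_le ((integrable_shifted_gaussian w.re).const_mul _)
    (.of_forall fun x => norm_line_kernel_le hM hs hsw x)).trans_eq ?_
  rw [integral_const_mul, integral_shifted_gaussian]

lemma tendsto_vertical_kernel (hM : ∀ ζ ∈ hstrip θ, ‖g ζ‖ ≤ M) (hs0 : 0 < s) (hs : s < θ)
    (hw : |w.im| < s) {l : Filter ℝ} {r : ℝ → ℝ} (hr : Tendsto (fun R => |r R - w.re|) l atTop) :
    Tendsto (fun R => ∫ y in (-s)..s, gaussKernel (r R + y * I - w) • g (r R + y * I)) l (𝓝 0) := by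
  have hbound : ∀ᶠ R in l, ‖∫ y in (-s)..s, gaussKernel (r R + y * I - w) • g (r R + y * I)‖ ≤
      (|r R - w.re|)⁻¹ * (Real.exp ((2 * s) ^ 2) * M * |s - -s|) := by
    filter_upwards [hr.eventually (eventually_gt_atTop 0)] with R hR
    refine (intervalIntegral.norm_integral_le_of_norm_le_const (C := (|r R - w.re|)⁻¹ *
      (Real.exp ((2 * s) ^ 2) * M)) fun y hy => ?_).trans_eq (by ring)
    rw [uIoc_of_le (by linarith)] at hy
    have hy' : |y| ≤ s := abs_le.mpr ⟨hy.1.le, hy.2⟩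
    have hyθ : (r R + y * I : ℂ) ∈ hstrip θ := line_mem_hstrip (hy'.trans_lt hs) _
    rw [gaussKernel, norm_smul, norm_mul, norm_inv, norm_exp_neg_sq]
    have e1 : (r R + y * I - w : ℂ).im = y - w.im := by simp
    have e2 : (r R + y * I - w : ℂ).re = r R - w.re := by simp
    have e3 : |r R - w.re| ≤ ‖(r R + y * I - w : ℂ)‖ := e2 ▸ abs_re_le_norm _
    rw [e1, e2]
    have e4 : (y - w.im) ^ 2 ≤ (2 * s) ^ 2 := by
      rw [sq_le_sq, abs_of_pos (by linarith : 0 < 2 * s)]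
      linarith [abs_sub y w.im]
    calc _ ≤ (|r R - w.re|)⁻¹ * (Real.exp ((2 * s) ^ 2) * 1) * M := by
          gcongr
          · simp [sq_nonneg]
          · exact hM _ hyθ
      _ = _ := by ring
  refine squeeze_zero_norm' hbound ?_
  simpa using (tendsto_inv_atTop_zero.comp hr).mul_const (Real.exp ((2 * s) ^ 2) * M * |s - -s|)

/-- Cauchy's formula on a strip for bounded functions. -/
theorem strip_cauchy [CompleteSpace E] (hg : DifferentiableOn ℂ g (hstrip θ))
    (hM : ∀ ζ ∈ hstrip θ, ‖g ζ‖ ≤ M) (hs0 : 0 < s) (hs : s < θ) (hw : |w.im| < s) :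
    (∫ x : ℝ, gaussKernel (x + (-s : ℝ) * I - w) • g (x + (-s : ℝ) * I)) -
      ∫ x : ℝ, gaussKernel (x + s * I - w) • g (x + s * I) = (2 * Real.pi * I : ℂ) • g w := by
  obtain ⟨hw1, hw2⟩ := abs_lt.mp hw
  have habs : |s| < θ := by rwa [abs_of_pos hs0]
  have hlim : Tendsto (fun R : ℝ => rectIntegral (-R) R (-s) s
      (fun ζ => gaussKernel (ζ - w) • g ζ)) atTop
      (𝓝 ((((∫ x : ℝ, gaussKernel (x + (-s : ℝ) * I - w) • g (x + (-s : ℝ) * I)) -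
      ∫ x : ℝ, gaussKernel (x + s * I - w) • g (x + s * I)) + I • 0) - I • 0)) := by
    refine Tendsto.sub (Tendsto.add (Tendsto.sub ?_ ?_) ?_) ?_
    · exact intervalIntegral_tendsto_integral
        (integrable_line_kernel hg.continuousOn hM (by rwa [abs_neg]) hw1.ne)
        tendsto_neg_atTop_atBot tendsto_id
    · exact intervalIntegral_tendsto_integral
        (integrable_line_kernel hg.continuousOn hM habs hw2.ne') tendsto_neg_atTop_atBot tendsto_id
    · refine Tendsto.const_smul (tendsto_vertical_kernel hM hs0 hs hw (r := fun R => R) ?_) I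
      exact tendsto_abs_atTop_atTop.comp (tendsto_atTop_add_const_right _ _ tendsto_id)
    · refine Tendsto.const_smul (tendsto_vertical_kernel hM hs0 hs hw (r := fun R => -R) ?_) I
      exact tendsto_abs_atBot_atTop.comp
        (tendsto_atBot_add_const_right _ _ tendsto_neg_atTop_atBot)
  rw [smul_zero, add_zero, sub_zero] at hlim
  refine tendsto_nhds_unique hlim (tendsto_const_nhds.congr' ?_)
  filter_upwards [eventually_gt_atTop |w.re|] with R hR
  obtain ⟨hR1, hR2⟩ := abs_lt.mp hR
  have hc := rectIntegral_cauchy (a := -R) (b := R) (c := -s) (d := s) (w := w)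
    (g := fun ζ => exp (-(ζ - w) ^ 2) • g ζ) (isOpen_hstrip θ)
    (fun x hx => (abs_le.mpr ⟨hx.2.1, hx.2.2⟩).trans_lt hs)
    (DifferentiableOn.fun_smul (Differentiable.differentiableOn (by fun_prop)) hg)
    ⟨⟨hR1, hR2⟩, hw1, hw2⟩
  simp only [sub_self, ne_eq, OfNat.ofNat_ne_zero, not_false_eq_true, zero_pow, neg_zero, exp_zero,
    one_smul, smul_smul] at hc
  exact hc.symm

end Strip

section Lens

open Complex

variable {m : ℕ} {E : Type*} [NormedAddCommGroup E] [NormedSpace ℂ E]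

/-- A holomorphic coordinate `φ` on `V` with sections `σ z` over a strip. -/
structure IsLens (V : Set (Fin m → ℂ)) (φ : (Fin m → ℂ) → ℂ) (σ : (Fin m → ℂ) → ℂ → (Fin m → ℂ))
    (θ : ℝ) : Prop where
  isOpen : IsOpen V
  pos : 0 < θ
  diff : DifferentiableOn ℂ φ V
  im_le : ∀ z ∈ V, |(φ z).im| ≤ Real.pi
  mem : ∀ z ∈ V, ∀ ζ ∈ hstrip θ, σ z ζ ∈ V
  apply : ∀ z ∈ V, ∀ ζ ∈ hstrip θ, φ (σ z ζ) = ζ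
  apply_self : ∀ z ∈ V, |(φ z).im| < θ → σ z (φ z) = z
  diff_left : ∀ ζ ∈ hstrip θ, DifferentiableOn ℂ (fun z => σ z ζ) V
  diff_right : ∀ z ∈ V, DifferentiableOn ℂ (σ z) (hstrip θ)

/-- The part of `V` below the height `θ`. -/
def lensLeft (V : Set (Fin m → ℂ)) (φ : (Fin m → ℂ) → ℂ) (θ : ℝ) : Set (Fin m → ℂ) :=
  {z ∈ V | (φ z).im < θ}

/-- The part of `V` above the height `-θ`. -/
def lensRight (V : Set (Fin m → ℂ)) (φ : (Fin m → ℂ) → ℂ) (θ : ℝ) : Set (Fin m → ℂ) :=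
  {z ∈ V | -θ < (φ z).im}

variable {V : Set (Fin m → ℂ)} {φ : (Fin m → ℂ) → ℂ} {σ : (Fin m → ℂ) → ℂ → (Fin m → ℂ)} {θ : ℝ}

lemma IsLens.isOpen_left (hL : IsLens V φ σ θ) (s : ℝ) : IsOpen (lensLeft V φ s) :=
  (continuous_im.comp_continuousOn hL.diff.continuousOn).isOpen_inter_preimage hL.isOpen isOpen_Iio

lemma IsLens.isOpen_right (hL : IsLens V φ σ θ) (s : ℝ) : IsOpen (lensRight V φ s) :=
  (continuous_im.comp_continuousOn hL.diff.continuousOn).isOpen_inter_preimage hL.isOpen isOpen_Ioi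

lemma mem_lens_iff {z : Fin m → ℂ} :
    z ∈ lensLeft V φ θ ∩ lensRight V φ θ ↔ z ∈ V ∧ φ z ∈ hstrip θ := by
  simp only [lensLeft, lensRight, hstrip, mem_inter_iff, mem_ofPred_eq, abs_lt]
  tauto

/-- The Cauchy integral over the line of height `s`. -/
def lensIntegral (φ : (Fin m → ℂ) → ℂ) (σ : (Fin m → ℂ) → ℂ → (Fin m → ℂ)) (s : ℝ)
    (h : (Fin m → ℂ) → E) (z : Fin m → ℂ) : E :=
  -(2 * Real.pi * I : ℂ)⁻¹ • ∫ x : ℝ, gaussKernel (x + s * I - φ z) • h (σ z (x + s * I))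

variable {h : (Fin m → ℂ) → E} {M s : ℝ}

lemma IsLens.differentiableOn_section (hL : IsLens V φ σ θ)
    (hh : DifferentiableOn ℂ h (lensLeft V φ θ ∩ lensRight V φ θ)) {z : Fin m → ℂ} (hz : z ∈ V) :
    DifferentiableOn ℂ (fun ζ => h (σ z ζ)) (hstrip θ) :=
  hh.comp (hL.diff_right z hz) fun ζ hζ =>
    mem_lens_iff.mpr ⟨hL.mem z hz ζ hζ, by rwa [hL.apply z hz ζ hζ]⟩

lemma IsLens.norm_section_le {F : Type*} [NormedAddCommGroup F] {h : (Fin m → ℂ) → F}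
    (hL : IsLens V φ σ θ) (hM : ∀ z ∈ lensLeft V φ θ ∩ lensRight V φ θ, ‖h z‖ ≤ M)
    {z : Fin m → ℂ} (hz : z ∈ V) :
    ∀ ζ ∈ hstrip θ, ‖h (σ z ζ)‖ ≤ M := fun ζ hζ =>
  hM _ (mem_lens_iff.mpr ⟨hL.mem z hz ζ hζ, by rwa [hL.apply z hz ζ hζ]⟩)

lemma IsLens.differentiableAt_lensIntegral (hL : IsLens V φ σ θ)
    (hh : DifferentiableOn ℂ h (lensLeft V φ θ ∩ lensRight V φ θ))
    (hM : ∀ z ∈ lensLeft V φ θ ∩ lensRight V φ θ, ‖h z‖ ≤ M) (hs : |s| < θ) {z₀ : Fin m → ℂ}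
    (hz₀ : z₀ ∈ V) (hsz : s ≠ (φ z₀).im) : DifferentiableAt ℂ (lensIntegral φ σ s h) z₀ := by
  unfold lensIntegral
  refine DifferentiableAt.fun_const_smul ?_ _
  have hφc : ContinuousAt φ z₀ := (hL.diff.differentiableAt (hL.isOpen.mem_nhds hz₀)).continuousAt
  have hpos : 0 < |s - (φ z₀).im| := abs_pos.mpr (sub_ne_zero.mpr hsz)
  have e1 : ∀ᶠ z in 𝓝 z₀, |s - (φ z₀).im| / 2 < |s - (φ z).im| := by
    have : ContinuousAt (fun z => |s - (φ z).im|) z₀ := by fun_prop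
    exact this.eventually (lt_mem_nhds (by linarith))
  have e2 : ∀ᶠ z in 𝓝 z₀, |(φ z).re| < |(φ z₀).re| + 1 := by
    have : ContinuousAt (fun z => |(φ z).re|) z₀ := by fun_prop
    exact this.eventually (gt_mem_nhds (by linarith))
  obtain ⟨r, hr, hball⟩ := Metric.eventually_nhds_iff_ball.mp
    ((e1.and e2).and (hL.isOpen.eventually_mem hz₀))
  set d := |s - (φ z₀).im| / 2 with hd
  set c := |(φ z₀).re| + 1 with hc
  have hd0 : 0 < d := by positivity
  have hM0 : 0 ≤ M := (norm_nonneg _).trans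
    (hL.norm_section_le hM hz₀ 0 (by simpa [hstrip] using hL.pos))
  have hne : ∀ z ∈ ball z₀ r, s ≠ (φ z).im := fun z hz heq => by
    have := (hball z hz).1.1
    rw [← heq, sub_self, abs_zero] at this
    linarith
  refine differentiableAt_integral_of_dominated hr
    (g := fun x => (d⁻¹ * Real.exp ((θ + Real.pi) ^ 2) * M * Real.exp (c ^ 2)) *
      Real.exp (-(1 / 2) * x ^ 2)) ?_ ?_ ?_ ?_
  · refine .of_forall fun x z hz => ?_
    have hzV := (hball z hz).2
    have hxθ := line_mem_hstrip hs x
    refine DifferentiableAt.differentiableWithinAt ?_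
    have hφ := hL.diff.differentiableAt (hL.isOpen.mem_nhds hzV)
    refine DifferentiableAt.fun_smul ?_ ?_
    · refine DifferentiableAt.comp (g := gaussKernel) (f := fun z => x + s * I - φ z) z
        (differentiableAt_gaussKernel fun h0 => hne z hz ?_) (hφ.const_sub _)
      have := congrArg im h0
      simpa [sub_eq_zero] using this
    · have hm : σ z (x + s * I) ∈ lensLeft V φ θ ∩ lensRight V φ θ :=
        mem_lens_iff.mpr ⟨hL.mem z hzV _ hxθ, by rwa [hL.apply z hzV _ hxθ]⟩
      exact (hh.differentiableAt (((hL.isOpen_left θ).inter (hL.isOpen_right θ)).mem_nhds hm)).comp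
        (g := h) (f := fun z => σ z (x + s * I)) z
        ((hL.diff_left _ hxθ).differentiableAt (hL.isOpen.mem_nhds hzV))
  · intro z hz
    exact (continuous_line_kernel (hL.differentiableOn_section hh (hball z hz).2).continuousOn hs
      (hne z hz)).aestronglyMeasurable
  · exact (integrable_exp_neg_mul_sq (by norm_num)).const_mul _
  · refine .of_forall fun x z hz => ?_
    have hzV := (hball z hz).2
    refine (norm_line_kernel_le (g := fun ζ => h (σ z ζ)) (hL.norm_section_le hM hzV) hs
      (hne z hz) x).trans ?_
    rw [mul_assoc _ (Real.exp (c ^ 2)), ← Real.exp_add]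
    have h1 := (hball z hz).1.1
    have h2 := (hball z hz).1.2
    have h3 : (s - (φ z).im) ^ 2 ≤ (θ + Real.pi) ^ 2 := by
      rw [sq_le_sq, abs_of_pos (by linarith [hL.pos, Real.pi_pos] : 0 < θ + Real.pi)]
      linarith [abs_sub s (φ z).im, hL.im_le z hzV]
    have h4 : (φ z).re ^ 2 ≤ c ^ 2 := by
      rw [sq_le_sq]; exact h2.le.trans (le_abs_self _)
    have h5 : -(x - (φ z).re) ^ 2 ≤ c ^ 2 + -(1 / 2) * x ^ 2 := by
      nlinarith [sq_nonneg (x - 2 * (φ z).re)]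
    gcongr

lemma IsLens.norm_lensIntegral_le (hL : IsLens V φ σ θ)
    (hM : ∀ z ∈ lensLeft V φ θ ∩ lensRight V φ θ, ‖h z‖ ≤ M) (hs : |s| < θ) {z : Fin m → ℂ}
    (hz : z ∈ V) {η : ℝ} (hη : 0 < η) (hsz : η ≤ |s - (φ z).im|) :
    ‖lensIntegral φ σ s h z‖ ≤ η⁻¹ * Real.exp ((θ + Real.pi) ^ 2) * √Real.pi * M := by
  have hM0 : 0 ≤ M := (norm_nonneg _).trans
    (hL.norm_section_le hM hz 0 (by simpa [hstrip] using hL.pos))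
  have hne : s ≠ (φ z).im := fun heq => by
    rw [← heq, sub_self, abs_zero] at hsz
    linarith
  have h1 := norm_integral_line_kernel_le (g := fun ζ => h (σ z ζ)) (w := φ z)
    (hL.norm_section_le hM hz) hs hne
  have h3 : (s - (φ z).im) ^ 2 ≤ (θ + Real.pi) ^ 2 := by
    rw [sq_le_sq, abs_of_pos (by linarith [hL.pos, Real.pi_pos] : 0 < θ + Real.pi)]
    linarith [abs_sub s (φ z).im, hL.im_le z hz]
  have hpi : ‖-(2 * Real.pi * I : ℂ)⁻¹‖ ≤ 1 := by
    rw [norm_neg, norm_inv, norm_mul, norm_mul, norm_I, Complex.norm_real,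
      Real.norm_of_nonneg Real.pi_pos.le]
    refine inv_le_one_of_one_le₀ ?_
    simp; linarith [Real.pi_gt_three]
  unfold lensIntegral
  rw [norm_smul]
  calc _ ≤ 1 * (|s - (φ z).im|⁻¹ * Real.exp ((s - (φ z).im) ^ 2) * M * √Real.pi) := by gcongr
    _ ≤ 1 * (η⁻¹ * Real.exp ((θ + Real.pi) ^ 2) * M * √Real.pi) := by gcongr
    _ = _ := by ring

lemma IsLens.lensIntegral_sub [CompleteSpace E] (hL : IsLens V φ σ θ)
    (hh : DifferentiableOn ℂ h (lensLeft V φ θ ∩ lensRight V φ θ))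
    (hM : ∀ z ∈ lensLeft V φ θ ∩ lensRight V φ θ, ‖h z‖ ≤ M) (hs0 : 0 < s) (hs : s < θ)
    {z : Fin m → ℂ} (hz : z ∈ V) (hsz : |(φ z).im| < s) :
    lensIntegral φ σ s h z = lensIntegral φ σ (-s) h z + h z := by
  have := strip_cauchy (w := φ z) (hL.differentiableOn_section hh hz) (hL.norm_section_le hM hz)
    hs0 hs hsz
  rw [hL.apply_self z hz (hsz.trans hs)] at this
  have hpi : (2 * Real.pi * I : ℂ) ≠ 0 := by simp [Real.pi_ne_zero]
  have h2 := congrArg (fun y => (2 * Real.pi * I : ℂ)⁻¹ • y) this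
  simp only [smul_sub, inv_smul_smul₀ hpi] at h2
  simp only [lensIntegral, neg_smul, ← h2]
  abel

/-- Additive splitting with bounds over a lens. -/
theorem IsLens.exists_split [CompleteSpace E] (hL : IsLens V φ σ θ) :
    ∃ C > 0, ∀ (M : ℝ) (h : (Fin m → ℂ) → E),
      DifferentiableOn ℂ h (lensLeft V φ θ ∩ lensRight V φ θ) →
      (∀ z ∈ lensLeft V φ θ ∩ lensRight V φ θ, ‖h z‖ ≤ M) →
      ∃ a b : (Fin m → ℂ) → E, DifferentiableOn ℂ a (lensLeft V φ θ) ∧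
        DifferentiableOn ℂ b (lensRight V φ θ) ∧
        (∀ z ∈ lensLeft V φ θ, ‖a z‖ ≤ C * M) ∧ (∀ z ∈ lensRight V φ θ, ‖b z‖ ≤ C * M) ∧
        ∀ z ∈ lensLeft V φ θ ∩ lensRight V φ θ, a z - b z = h z := by
  have hθ := hL.pos
  obtain ⟨s, hs0, hs⟩ := exists_between hθ
  have habs : |s| < θ := by rwa [abs_of_pos hs0]
  have habs' : |-s| < θ := by rwa [abs_neg]
  refine ⟨s⁻¹ * Real.exp ((θ + Real.pi) ^ 2) * √Real.pi + 1, by positivity, fun M h hh hM => ?_⟩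
  set C := s⁻¹ * Real.exp ((θ + Real.pi) ^ 2) * √Real.pi with hC
  have hopen : IsOpen (lensLeft V φ θ ∩ lensRight V φ θ) :=
    (hL.isOpen_left θ).inter (hL.isOpen_right θ)
  have hM0 : ∀ z ∈ V, 0 ≤ M := fun z hz => (norm_nonneg _).trans
    (hL.norm_section_le hM hz 0 (by simpa [hstrip] using hL.pos))
  have hC0 : 0 < C := by positivity
  have eqn : ∀ z ∈ V, |(φ z).im| < s →
      lensIntegral φ σ s h z = lensIntegral φ σ (-s) h z + h z := fun z hz hsz =>
    hL.lensIntegral_sub hh hM hs0 hs hz hsz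
  have bp : ∀ z ∈ V, (φ z).im ≤ 0 → ‖lensIntegral φ σ s h z‖ ≤ C * M := fun z hz h0 =>
    hL.norm_lensIntegral_le hM habs hz hs0 (by rw [abs_of_pos] <;> linarith)
  have bm : ∀ z ∈ V, 0 ≤ (φ z).im → ‖lensIntegral φ σ (-s) h z‖ ≤ C * M := fun z hz h0 =>
    hL.norm_lensIntegral_le hM habs' hz hs0 (by rw [abs_of_neg] <;> linarith)
  refine ⟨fun z => if (φ z).im ≤ 0 then lensIntegral φ σ s h z else lensIntegral φ σ (-s) h z + h z,
    fun z => if (φ z).im < 0 then lensIntegral φ σ s h z - h z else lensIntegral φ σ (-s) h z,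
    fun z hz => ?_, fun z hz => ?_, fun z hz => ?_, fun z hz => ?_, fun z hz => ?_⟩
  · refine DifferentiableAt.differentiableWithinAt ?_
    by_cases h0 : (φ z).im < s
    · refine (hL.differentiableAt_lensIntegral hh hM habs hz.1 h0.ne').congr_of_eventuallyEq ?_
      filter_upwards [(hL.isOpen_left s).mem_nhds ⟨hz.1, h0⟩] with y hy
      split_ifs with hy0
      · rfl
      · exact (eqn y hy.1 (abs_lt.mpr ⟨by linarith, hy.2⟩)).symm
    · have hz' : z ∈ lensLeft V φ θ ∩ lensRight V φ θ := ⟨hz, hz.1, by linarith⟩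
      refine ((hL.differentiableAt_lensIntegral hh hM habs' hz.1 (by linarith)).add
        (hh.differentiableAt (hopen.mem_nhds hz'))).congr_of_eventuallyEq ?_
      filter_upwards [(hL.isOpen_right 0).mem_nhds ⟨hz.1, by linarith⟩] with y hy
      rw [if_neg (by linarith [hy.2])]
      rfl
  · refine DifferentiableAt.differentiableWithinAt ?_
    by_cases h0 : -s < (φ z).im
    · refine (hL.differentiableAt_lensIntegral hh hM habs' hz.1 h0.ne).congr_of_eventuallyEq ?_
      filter_upwards [(hL.isOpen_right s).mem_nhds ⟨hz.1, h0⟩] with y hy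
      split_ifs with hy0
      · rw [eqn y hy.1 (abs_lt.mpr ⟨hy.2, by linarith⟩), add_sub_cancel_right]
      · rfl
    · have hz' : z ∈ lensLeft V φ θ ∩ lensRight V φ θ := ⟨⟨hz.1, by linarith⟩, hz⟩
      refine ((hL.differentiableAt_lensIntegral hh hM habs hz.1 (by linarith)).sub
        (hh.differentiableAt (hopen.mem_nhds hz'))).congr_of_eventuallyEq ?_
      filter_upwards [(hL.isOpen_left 0).mem_nhds ⟨hz.1, by linarith⟩] with y hy
      rw [if_pos (by linarith [hy.2])]
      rfl
  · beta_reduce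
    split_ifs with h0
    · exact (bp z hz.1 h0).trans (by nlinarith [hM0 z hz.1])
    · have h1 := bm z hz.1 (by linarith)
      have h2 := hM z ⟨hz, hz.1, by linarith⟩
      linarith [norm_add_le (lensIntegral φ σ (-s) h z) (h z)]
  · beta_reduce
    split_ifs with h0
    · have h1 := bp z hz.1 (by linarith)
      have h2 := hM z ⟨⟨hz.1, by linarith⟩, hz⟩
      linarith [norm_sub_le (lensIntegral φ σ s h z) (h z)]
    · exact (bm z hz.1 (by linarith)).trans (by nlinarith [hM0 z hz.1])
  · beta_reduce
    rcases lt_trichotomy (φ z).im 0 with h0 | h0 | h0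
    · rw [if_pos h0.le, if_pos h0]; abel
    · rw [if_pos h0.le, if_neg (by linarith), eqn z hz.1.1 (by rw [h0, abs_zero]; exact hs0)]; abel
    · rw [if_neg (by linarith), if_neg (by linarith)]; abel

end Lens

section ConcreteLens

open Complex

variable {c d s : ℝ}

/-- A Möbius map sending the segment from `s + c i` to `s + d i` to the positive half-line. -/
def lensRatio (c d s : ℝ) (w : ℂ) : ℂ := (s + d * I - w) / (w - (s + c * I))

/-- The inverse of the logarithm of `lensRatio`. -/
def lensInv (c d s : ℝ) (ζ : ℂ) : ℂ :=
  (s + d * I + (s + c * I) * exp ζ) / (1 + exp ζ)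

lemma lens_sub_ne_zero {w : ℂ} (hw : c < w.im) : w - (s + c * I) ≠ 0 := fun h => by
  have := congrArg Complex.im h
  simp at this
  linarith

lemma lensRatio_re_im {w : ℂ} (hw : c < w.im) :
    ∃ k > 0, (lensRatio c d s w).re = k * (-(w.re - s) ^ 2 + (d - w.im) * (w.im - c)) ∧
      (lensRatio c d s w).im = k * ((w.re - s) * (d - c)) := by
  refine ⟨(normSq (w - (s + c * I)))⁻¹, inv_pos.mpr (normSq_pos.mpr (lens_sub_ne_zero hw)), ?_, ?_⟩
  · simp only [lensRatio, div_re]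
    simp
    ring
  · simp only [lensRatio, div_im]
    simp
    ring

lemma lensRatio_mem_slitPlane {w : ℂ} (hw : c < w.im) (hw' : w.im < d) :
    lensRatio c d s w ∈ slitPlane := by
  obtain ⟨k, hk, hre, him⟩ := lensRatio_re_im (d := d) (s := s) hw
  rw [mem_slitPlane_iff]
  by_cases h : w.re - s = 0
  · left
    rw [hre, h]
    have := mul_pos (sub_pos.mpr hw') (sub_pos.mpr hw)
    have := mul_pos hk this
    nlinarith
  · right
    rw [him]
    exact mul_ne_zero hk.ne' (mul_ne_zero h (by linarith))

lemma one_add_exp_re {ζ : ℂ} (hζ : |ζ.im| < Real.pi / 2) : 1 < (1 + exp ζ).re := by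
  have : 0 < (exp ζ).re := by
    rw [exp_re]
    exact mul_pos (Real.exp_pos _) (Real.cos_pos_of_mem_Ioo (abs_lt.mp hζ))
  simpa using this

lemma one_add_exp_ne_zero {ζ : ℂ} (hζ : |ζ.im| < Real.pi / 2) : 1 + exp ζ ≠ 0 := fun h => by
  have := one_add_exp_re hζ
  rw [h] at this
  simp at this
  linarith

lemma lensInv_im_mem (hcd : c < d) {ζ : ℂ} (hζ : |ζ.im| < Real.pi / 2) :
    c < (lensInv c d s ζ).im ∧ (lensInv c d s ζ).im < d := by
  have h1 := one_add_exp_ne_zero hζ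
  have h2 := one_add_exp_re hζ
  set E := 1 + exp ζ with hE
  have h3 : lensInv c d s ζ = s + c * I + ((d - c : ℝ) : ℂ) * I * E⁻¹ := by
    have : exp ζ = E - 1 := by rw [hE]; ring
    rw [lensInv, this, show 1 + (E - 1) = E by ring]
    field_simp
    push_cast
    ring
  have h4 : (lensInv c d s ζ).im = c + (d - c) * (E.re / normSq E) := by
    rw [h3]
    simp [inv_re]
  have hn : 0 < normSq E := normSq_pos.mpr h1
  have h5 : 0 < E.re / normSq E := div_pos (by linarith) hn
  have h6 : E.re / normSq E < 1 := by
    rw [div_lt_one hn, normSq_apply]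
    nlinarith [mul_self_nonneg E.im]
  rw [h4]
  constructor <;> nlinarith

lemma lensRatio_lensInv (hcd : c < d) {ζ : ℂ} (hζ : |ζ.im| < Real.pi / 2) :
    lensRatio c d s (lensInv c d s ζ) = exp ζ := by
  have h1 := one_add_exp_ne_zero hζ
  have h2 := lens_sub_ne_zero (s := s) (lensInv_im_mem (s := s) hcd hζ).1
  rw [lensRatio, div_eq_iff h2, lensInv]
  field_simp
  ring

lemma lensInv_log_lensRatio {w : ℂ} (hw : c < w.im) (hw' : w.im < d) :
    lensInv c d s (log (lensRatio c d s w)) = w := by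
  have h1 : lensRatio c d s w ≠ 0 := slitPlane_ne_zero (lensRatio_mem_slitPlane hw hw')
  have h2 := lens_sub_ne_zero (s := s) hw
  have hdc : (d : ℂ) - c ≠ 0 := by
    rw [← ofReal_sub]; exact ofReal_ne_zero.mpr (by linarith)
  have hL : lensRatio c d s w * (w - (s + c * I)) = s + d * I - w := div_mul_cancel₀ _ h2
  have h3 : 1 + lensRatio c d s w ≠ 0 := fun h => by
    refine mul_ne_zero hdc I_ne_zero ?_
    linear_combination (w - (s + c * I)) * h - hL
  rw [lensInv, exp_log h1, div_eq_iff h3]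
  linear_combination -hL

lemma abs_re_sub_lt_of_abs_arg_lt {h : ℝ} (hh : 0 < h) {w : ℂ} (hw : c < w.im) (hw' : w.im < d)
    (harg : |(lensRatio c d s w).arg| < Real.arctan (h / (d - c))) : |w.re - s| < h := by
  obtain ⟨k, hk, hre, him⟩ := lensRatio_re_im (d := d) (s := s) hw
  have hdc : 0 < d - c := by linarith
  have hlt := Real.arctan_lt_pi_div_two (h / (d - c))
  have hre0 : 0 < (lensRatio c d s w).re :=
    (abs_arg_lt_pi_div_two_iff.mp (harg.trans hlt)).resolve_right
      (slitPlane_ne_zero (lensRatio_mem_slitPlane hw hw'))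
  have hgt := abs_lt.mp harg
  have h1 : Real.tan (lensRatio c d s w).arg < h / (d - c) := by
    have := Real.tan_lt_tan_of_lt_of_lt_pi_div_two (by linarith) hlt hgt.2
    rwa [Real.tan_arctan] at this
  have h2 : -(h / (d - c)) < Real.tan (lensRatio c d s w).arg := by
    have := Real.tan_lt_tan_of_lt_of_lt_pi_div_two (by linarith) (by linarith) hgt.1
    rwa [Real.tan_neg, Real.tan_arctan] at this
  rw [tan_arg, div_lt_div_iff₀ hre0 hdc] at h1
  rw [tan_arg, ← neg_div, div_lt_div_iff₀ hdc hre0] at h2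
  rw [him, hre] at h1 h2
  have hle : -(w.re - s) ^ 2 + (d - w.im) * (w.im - c) ≤ (d - c) ^ 2 := by
    nlinarith [sq_nonneg (w.re - s), sq_nonneg (d - w.im), sq_nonneg (w.im - c)]
  have hle' := mul_le_mul_of_nonneg_left hle (mul_pos hh hk).le
  have hpos : 0 < k * (d - c) ^ 2 := by positivity
  rw [abs_lt]
  constructor
  · by_contra hcon
    push Not at hcon
    nlinarith
  · by_contra hcon
    push Not at hcon
    nlinarith

variable {m : ℕ}

/-- The lens over the line `Re (u z_j) = s`. -/
theorem exists_isLens (j : Fin m) {u : ℂ} (hu : u ≠ 0) {O : Set (Fin m → ℂ)} (hO : IsOpen O)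
    (hOj : ∀ z ∈ O, ∀ x : ℂ, Function.update z j x ∈ O) (hcd : c < d) (s : ℝ) {h : ℝ}
    (hh : 0 < h) :
    ∃ φ σ θ, IsLens {z ∈ O | c < (u * z j).im ∧ (u * z j).im < d} φ σ θ ∧
      (∀ z ∈ lensLeft {z ∈ O | c < (u * z j).im ∧ (u * z j).im < d} φ θ, (u * z j).re < s + h) ∧
      (∀ z ∈ lensRight {z ∈ O | c < (u * z j).im ∧ (u * z j).im < d} φ θ, s - h < (u * z j).re) ∧
      ∀ z ∈ O, c < (u * z j).im → (u * z j).im < d → s < (u * z j).re → 0 < (φ z).im := by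
  have hdc : 0 < d - c := by linarith
  set θ := Real.arctan (h / (d - c)) with hθ
  have hθ0 : 0 < θ := Real.arctan_pos.mpr (by positivity)
  have hθ1 : θ < Real.pi / 2 := Real.arctan_lt_pi_div_two _
  have hθ2 : ∀ ζ ∈ hstrip θ, |ζ.im| < Real.pi / 2 := fun ζ hζ => lt_trans hζ hθ1
  set V : Set (Fin m → ℂ) := {z ∈ O | c < (u * z j).im ∧ (u * z j).im < d} with hV
  set φ : (Fin m → ℂ) → ℂ := fun z => log (lensRatio c d s (u * z j)) with hφ
  have hcoord : Differentiable ℂ fun z : Fin m → ℂ => u * z j :=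
    (differentiable_apply (𝕜 := ℂ) (F' := fun _ : Fin m => ℂ) j).const_mul u
  have hpos : ∀ z ∈ V, s < (u * z j).re → 0 < (φ z).im := by
    intro z hz hs
    obtain ⟨k, hk, -, him⟩ := lensRatio_re_im (d := d) (s := s) hz.2.1
    have h0 : 0 < (lensRatio c d s (u * z j)).im := by
      rw [him]; exact mul_pos hk (mul_pos (by linarith) hdc)
    rw [hφ]
    simp only [log_im]
    refine lt_of_le_of_ne (arg_nonneg_iff.mpr h0.le) fun h => ?_
    exact h0.ne' (arg_eq_zero_iff.mp h.symm).2
  have hneg : ∀ z ∈ V, (u * z j).re < s → (φ z).im < 0 := by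
    intro z hz hs
    obtain ⟨k, hk, -, him⟩ := lensRatio_re_im (d := d) (s := s) hz.2.1
    rw [hφ]
    simp only [log_im]
    rw [arg_neg_iff, him]
    exact mul_neg_of_pos_of_neg hk (mul_neg_of_neg_of_pos (by linarith) hdc)
  have habs : ∀ z ∈ V, |(φ z).im| < θ → |(u * z j).re - s| < h := fun z hz hzθ =>
    abs_re_sub_lt_of_abs_arg_lt hh hz.2.1 hz.2.2 (by simpa [hφ, log_im] using hzθ)
  refine ⟨φ, fun z ζ => Function.update z j (u⁻¹ * lensInv c d s ζ), θ, ?_, ?_, ?_, ?_⟩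
  · have hval : ∀ (z : Fin m → ℂ) ζ, u * Function.update z j (u⁻¹ * lensInv c d s ζ) j =
        lensInv c d s ζ := fun z ζ => by
      rw [Function.update_self, mul_inv_cancel_left₀ hu]
    refine ⟨?_, hθ0, ?_, ?_, ?_, ?_, ?_, ?_, ?_⟩
    · have hc : Continuous fun z : Fin m → ℂ => (u * z j).im :=
        continuous_im.comp hcoord.continuous
      exact hO.inter ((isOpen_lt continuous_const hc).inter (isOpen_lt hc continuous_const))
    · intro z hz
      refine DifferentiableAt.differentiableWithinAt ?_
      have h1 : DifferentiableAt ℂ (fun z : Fin m → ℂ => lensRatio c d s (u * z j)) z :=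
        ((differentiableAt_const _).fun_sub (hcoord z)).fun_mul
          (((hcoord z).fun_sub (differentiableAt_const _)).fun_inv (lens_sub_ne_zero hz.2.1))
      exact h1.clog (lensRatio_mem_slitPlane hz.2.1 hz.2.2)
    · intro z _
      simpa [hφ, log_im] using abs_arg_le_pi _
    · intro z hz ζ hζ
      refine ⟨hOj z hz.1 _, ?_⟩
      rw [hval]
      exact lensInv_im_mem hcd (hθ2 ζ hζ)
    · intro z hz ζ hζ
      have h1 := abs_lt.mp (hθ2 ζ hζ)
      have hpi := Real.pi_pos
      simp only [hφ]
      rw [hval, lensRatio_lensInv hcd (hθ2 ζ hζ), log_exp (by linarith) (by linarith)]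
    · intro z hz _
      simp only [hφ]
      rw [lensInv_log_lensRatio hz.2.1 hz.2.2, inv_mul_cancel_left₀ hu, Function.update_eq_self]
    · intro ζ hζ
      refine Differentiable.differentiableOn (differentiable_pi.mpr fun i => ?_)
      rcases eq_or_ne i j with rfl | hne
      · simp
      · simpa [hne] using differentiable_apply (𝕜 := ℂ) (F' := fun _ : Fin m => ℂ) i
    · intro z hz
      refine differentiableOn_pi.mpr fun i => ?_
      rcases eq_or_ne i j with rfl | hne
      · simp only [Function.update_self]
        refine DifferentiableOn.const_mul (fun ζ hζ => ?_) _
        refine DifferentiableAt.differentiableWithinAt ?_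
        exact ((differentiableAt_const _).fun_add ((differentiableAt_const _).fun_mul
          differentiable_exp.differentiableAt)).fun_mul
          (((differentiableAt_const _).fun_add differentiable_exp.differentiableAt).fun_inv
            (one_add_exp_ne_zero (hθ2 ζ hζ)))
      · simp [hne]
  · intro z hz
    by_contra! hcon
    have h1 := hpos z hz.1 (by linarith)
    have h2 := abs_lt.mp (habs z hz.1 (abs_lt.mpr ⟨by linarith, hz.2⟩))
    linarith
  · intro z hz
    by_contra! hcon
    have h1 := hneg z hz.1 (by linarith)
    have h2 := abs_lt.mp (habs z hz.1 (abs_lt.mpr ⟨hz.2, by linarith⟩))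
    linarith
  · exact fun z hz h1 h2 h3 => hpos z ⟨hz, h1, h2⟩ h3

end ConcreteLens

end

noncomputable section

open Filter Topology Set Metric Matrix

section Approximation

variable {𝔼 : Type*} [NormedAddCommGroup 𝔼] [NormedSpace ℂ 𝔼] {ι : Type*} [Fintype ι]

/-- Functions holomorphic near `S` are uniform limits on `S` of entire functions. -/
def RungeSet (S : Set 𝔼) : Prop :=
  ∀ f : 𝔼 → ℂ, HolNear f S → ∀ ε > 0, ∃ g : 𝔼 → ℂ, Differentiable ℂ g ∧ ∀ z ∈ S, ‖f z - g z‖ < ε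

lemma RungeSet.approx_prod {S : Set 𝔼} (hS : RungeSet S) {t : 𝔼 → ℂ × (ι → ℂ)} (ht : HolNear t S)
    {ε : ℝ} (hε : 0 < ε) :
    ∃ g : 𝔼 → ℂ × (ι → ℂ), Differentiable ℂ g ∧ ∀ z ∈ S, ‖t z - g z‖ < ε := by
  obtain ⟨g, hg, h⟩ := hS (fun z => (t z).1) (Filter.Eventually.mono ht fun y hy => hy.fst) ε hε
  choose g' hg' h' using fun i : ι => hS (fun z => (t z).2 i)
    (Filter.Eventually.mono ht fun y hy => differentiableAt_pi.mp hy.snd i) ε hε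
  refine ⟨fun z => (g z, fun i => g' i z), hg.prodMk (differentiable_pi.mpr hg'), fun z hz => ?_⟩
  rw [Prod.norm_def]
  exact max_lt (h z hz) ((pi_norm_lt_iff hε).mpr fun i => h' i z hz)

lemma exists_pos_forall_dist_lt {X Y : Type*} [PseudoMetricSpace X] [PseudoMetricSpace Y]
    {K : Set X} (hK : IsCompact K) {f : X → Y} (hf : ∀ x ∈ K, ContinuousAt f x) {ε : ℝ}
    (hε : 0 < ε) : ∃ δ > 0, ∀ x ∈ K, ∀ y, dist x y < δ → dist (f x) (f y) < ε := by
  obtain ⟨δ, hδ, h⟩ := Metric.mem_uniformity_dist.mp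
    (hK.uniformContinuousAt_of_continuousAt f hf (dist_mem_uniformity hε))
  exact ⟨δ, hδ, fun x hx y hxy => h hxy hx⟩

/-- Moves over a Runge compact can be approximated by moves over a larger set. -/
theorem exists_reach_approx {N : ℕ} {e v : 𝔼 → ι → ℂ} {S B : Set 𝔼} (hSc : IsCompact S)
    (hS : RungeSet S) (hSB : S ⊆ B) {p₀ p : 𝔼 → ℕ → ι → ℂ} (h₀ : ChainOn N e v B p₀)
    (h : Reach N S p₀ p) {ε : ℝ} (hε : 0 < ε) :
    ∃ p', Reach N B p₀ p' ∧ ∀ x ∈ S, ∀ k, ‖p' x k - p x k‖ < ε := by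
  induction h generalizing ε with
  | refl => exact ⟨p₀, .refl, fun x _ k => by simpa using hε⟩
  | @tail p p'' hr hs ih =>
    obtain ⟨k, hk, hkN, t, ht, hp''⟩ := hs
    have hp : ChainOn N e v S p := (h₀.mono hSB).reach hr
    have hc : ContinuousOn (fun x => (t x, p x (k - 1), p x k, p x (k + 1))) S := fun x hx =>
      ((ht.continuousAt hx).prodMk (((hp.hol _).continuousAt hx).prodMk
        (((hp.hol _).continuousAt hx).prodMk ((hp.hol _).continuousAt hx)))).continuousWithinAt
    obtain ⟨δ, hδ, hδm⟩ := exists_pos_forall_dist_lt (hSc.image_of_continuousOn hc)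
      (fun x _ => (contDiff_moveFun (ι := ι) (n := 1)).continuous.continuousAt) hε
    obtain ⟨t', ht', htt⟩ := hS.approx_prod ht hδ
    obtain ⟨p', hp', hpp⟩ := ih (lt_min hδ hε)
    refine ⟨fun x => moveAt k (t' x) (p' x), hp'.tail ⟨k, hk, hkN, t', .of_forall ht',
      .of_forall fun _ => rfl⟩, fun x hx j => ?_⟩
    beta_reduce
    rw [(eventually_nhdsSet_iff_forall.mp hp'' x hx).self_of_nhds]
    by_cases hj : j = k
    · subst hj
      rw [moveAt_same, moveAt_same, ← dist_eq_norm, dist_comm]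
      have hd : ∀ i, dist (p x i) (p' x i) < δ := fun i => by
        rw [dist_comm, dist_eq_norm]; exact (hpp x hx i).trans_le (min_le_left _ _)
      refine hδm _ (mem_image_of_mem _ hx) (t' x, p' x (j - 1), p' x j, p' x (j + 1)) ?_
      simp only [Prod.dist_eq, max_lt_iff]
      exact ⟨max_lt_iff.mp ((dist_eq_norm (t x) (t' x)).trans_lt (htt x hx)), hd _, hd _, hd _⟩
    · rw [moveAt_of_ne hj, moveAt_of_ne hj]
      exact (hpp x hx j).trans_le (min_le_right _ _)

end Approximation

section Linearization

variable {ι : Type*} [Fintype ι]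

lemma fderiv_moveFun_apply (b q b' : ι → ℂ) (h : ℂ × (ι → ℂ)) :
    fderiv ℂ (moveFun (ι := ι)) (0, b, q, b') (h, 0) =
      h.1 • q + (b' ⬝ᵥ q) • moveDir b q h.2 := by
  have hF := ((contDiff_moveFun (ι := ι) (n := 1)).differentiable (by simp)
    (0, b, q, b')).hasFDerivAt
  have hline : HasDerivAt (fun s : ℂ => ((s • h, b, q, b') :
      (ℂ × (ι → ℂ)) × (ι → ℂ) × (ι → ℂ) × (ι → ℂ))) (h, 0) 0 := by
    have := ((hasDerivAt_id (0 : ℂ)).smul_const h).prodMk (hasDerivAt_const (0 : ℂ) (b, q, b'))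
    simpa using this
  have h1 := HasFDerivAt.comp_hasDerivAt (0 : ℂ) (l := moveFun (ι := ι)) (by simpa using hF) hline
  have hlin : ∀ s : ℂ, moveDir b q (s • h.2) = s • moveDir b q h.2 := fun s => by
    simp only [moveDir, dotProduct_smul, smul_sub, smul_smul, smul_eq_mul, mul_comm s]
  have h2 : HasDerivAt (fun s : ℂ => moveFun (s • h, b, q, b'))
      (h.1 • q + (b' ⬝ᵥ q) • moveDir b q h.2) 0 := by
    have he : HasDerivAt (fun s : ℂ => Complex.exp (s * h.1)) h.1 0 := by
      have := ((hasDerivAt_id (0 : ℂ)).mul_const h.1).cexp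
      simpa using this
    have hc : HasDerivAt (fun s : ℂ => s * expQuot (s * (b' ⬝ᵥ moveDir b q h.2))) 1 0 := by
      have h3 := (differentiable_expQuot (0 * (b' ⬝ᵥ moveDir b q h.2))).hasDerivAt.comp (0 : ℂ)
        ((hasDerivAt_id (0 : ℂ)).mul_const (b' ⬝ᵥ moveDir b q h.2))
      exact ((hasDerivAt_id (0 : ℂ)).mul h3).congr_deriv (by simp [expQuot_zero])
    have h4 := he.smul (((hc.const_mul (b' ⬝ᵥ q)).smul_const (moveDir b q h.2)).const_add q)
    refine (h4.congr_deriv (by simp [add_comm])).congr_of_eventuallyEq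
      (Eventually.of_forall fun s => ?_)
    simp only [moveFun, moveVec, Prod.smul_fst, Prod.smul_snd, hlin, dotProduct_smul, smul_eq_mul,
      Pi.smul_apply', smul_smul]
    congr 3
    ring
  exact h1.unique h2

/-- A right inverse of the linearized move. -/
def moveInv (B : (ι → ℂ) × (ι → ℂ) × (ι → ℂ)) (δ : ι → ℂ) : ℂ × (ι → ℂ) :=
  ((B.1 ⬝ᵥ δ) / (B.1 ⬝ᵥ B.2.1), ((B.2.2 ⬝ᵥ B.2.1) * (B.1 ⬝ᵥ B.2.1))⁻¹ •
    (δ - ((B.1 ⬝ᵥ δ) / (B.1 ⬝ᵥ B.2.1)) • B.2.1))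

lemma fderiv_moveFun_moveInv {B : (ι → ℂ) × (ι → ℂ) × (ι → ℂ)} (h1 : B.1 ⬝ᵥ B.2.1 ≠ 0)
    (h2 : B.2.2 ⬝ᵥ B.2.1 ≠ 0) (δ : ι → ℂ) :
    fderiv ℂ (moveFun (ι := ι)) (0, B) (moveInv B δ, 0) = δ := by
  rw [show ((0, B) : (ℂ × (ι → ℂ)) × _) = (0, B.1, B.2.1, B.2.2) from rfl, fderiv_moveFun_apply]
  have h3 : B.1 ⬝ᵥ (moveInv B δ).2 = 0 := by
    simp only [moveInv, dotProduct_smul, dotProduct_sub, smul_eq_mul]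
    field_simp
    simp
  rw [moveDir, h3]
  simp only [moveInv, zero_smul, sub_zero, smul_smul]
  rw [← mul_assoc, mul_inv_cancel₀ (mul_ne_zero h2 h1)]
  simp

lemma moveInv_smul (B : (ι → ℂ) × (ι → ℂ) × (ι → ℂ)) (c : ℂ) (δ : ι → ℂ) :
    moveInv B (c • δ) = c • moveInv B δ := by
  ext
  · simp [moveInv, dotProduct_smul, mul_div_assoc]
  · simp only [moveInv, dotProduct_smul, smul_eq_mul, Pi.smul_apply, Pi.sub_apply, Prod.smul_snd]
    ring

lemma differentiableAt_moveInv {𝔼 : Type*} [NormedAddCommGroup 𝔼] [NormedSpace ℂ 𝔼]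
    {B : 𝔼 → (ι → ℂ) × (ι → ℂ) × (ι → ℂ)} {δ : 𝔼 → ι → ℂ} {x : 𝔼} (hB : DifferentiableAt ℂ B x)
    (hδ : DifferentiableAt ℂ δ x) (h1 : (B x).1 ⬝ᵥ (B x).2.1 ≠ 0)
    (h2 : (B x).2.2 ⬝ᵥ (B x).2.1 ≠ 0) : DifferentiableAt ℂ (fun y => moveInv (B y) (δ y)) x := by
  have hq : DifferentiableAt ℂ (fun y => (B y).2.1) x := hB.snd.fst
  have h3 := DifferentiableAt.dotProduct' (f := fun y => (B y).1) hB.fst hδ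
  have h4 := DifferentiableAt.dotProduct' (f := fun y => (B y).1) hB.fst hq
  have h5 := DifferentiableAt.dotProduct' (f := fun y => (B y).2.2) hB.snd.snd hq
  have h6 := h3.fun_mul (h4.fun_inv h1)
  have h7 := (h5.fun_mul h4).fun_inv (mul_ne_zero h2 h1)
  simp only [moveInv, div_eq_mul_inv]
  exact h6.prodMk (h7.fun_smul (hδ.fun_sub (h6.fun_smul hq)))

lemma exists_norm_moveInv_le {K : Set ((ι → ℂ) × (ι → ℂ) × (ι → ℂ))} (hK : IsCompact K)
    (hgood : ∀ B ∈ K, B.1 ⬝ᵥ B.2.1 ≠ 0 ∧ B.2.2 ⬝ᵥ B.2.1 ≠ 0) :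
    ∃ C > 0, ∀ B ∈ K, ∀ δ, ‖moveInv B δ‖ ≤ C * ‖δ‖ := by
  obtain ⟨C, hC⟩ := (hK.prod (isCompact_closedBall (0 : ι → ℂ) 1)).exists_bound_of_continuousOn
    (f := fun x => moveInv x.1 x.2) fun x hx => ContinuousAt.continuousWithinAt
      (differentiableAt_moveInv differentiableAt_fst differentiableAt_snd (hgood _ hx.1).1
        (hgood _ hx.1).2).continuousAt
  refine ⟨|C| + 1, by positivity, fun B hB δ => ?_⟩
  rcases eq_or_ne δ 0 with rfl | hδ
  · have := moveInv_smul B 0 0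
    rw [zero_smul, zero_smul] at this
    simp [this]
  · have hn : (‖δ‖ : ℂ) ≠ 0 := by simpa using hδ
    have h1 : δ = (‖δ‖ : ℂ) • ((‖δ‖ : ℂ)⁻¹ • δ) := by rw [smul_smul, mul_inv_cancel₀ hn, one_smul]
    have h2 := hC (B, (‖δ‖ : ℂ)⁻¹ • δ) ⟨hB, by
      rw [mem_closedBall_zero_iff, norm_smul, norm_inv, Complex.norm_real, norm_norm,
        inv_mul_cancel₀ (norm_ne_zero_iff.mpr hδ)]⟩
    conv_lhs => rw [h1]
    rw [moveInv_smul, norm_smul, Complex.norm_real, norm_norm, mul_comm]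
    have := le_abs_self C
    exact mul_le_mul_of_nonneg_right (by simpa using h2.trans (by linarith)) (norm_nonneg _)

/-- Uniform strict differentiability of moves in the parameter. -/
lemma exists_moveFun_linear_approx {K : Set ((ι → ℂ) × (ι → ℂ) × (ι → ℂ))} (hK : IsCompact K)
    {κ : ℝ} (hκ : 0 < κ) :
    ∃ r > 0, ∀ B₀ ∈ K, ∀ B, ‖B - B₀‖ < r → ∀ t t' : ℂ × (ι → ℂ), ‖t‖ < r → ‖t'‖ < r →
      ‖moveFun (t', B) - moveFun (t, B) - fderiv ℂ (moveFun (ι := ι)) (0, B₀) (t' - t, 0)‖ ≤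
        κ * ‖t' - t‖ := by
  have hcont : Continuous (fderiv ℂ (moveFun (ι := ι))) :=
    (contDiff_moveFun (ι := ι) (n := 1)).continuous_fderiv (by simp)
  obtain ⟨r, hr, h⟩ := exists_pos_forall_dist_lt
    ((isCompact_singleton (x := (0 : ℂ × (ι → ℂ)))).prod hK)
    (fun x _ => hcont.continuousAt (x := x)) hκ
  refine ⟨r, hr, fun B₀ hB₀ B hB t t' ht ht' => ?_⟩
  set s : Set ((ℂ × (ι → ℂ)) × (ι → ℂ) × (ι → ℂ) × (ι → ℂ)) := ball (0, B₀) r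
  have key := Convex.norm_image_sub_le_of_norm_fderiv_le' (𝕜 := ℂ) (s := s)
    (f := moveFun (ι := ι)) (C := κ) (x := (t, B)) (y := (t', B))
    (φ := fderiv ℂ (moveFun (ι := ι)) (0, B₀))
    (fun x _ => (contDiff_moveFun (ι := ι) (n := 1)).differentiable (by simp) x)
    (fun x hx => by
      rw [← dist_eq_norm, dist_comm]
      exact (h (0, B₀) ⟨rfl, hB₀⟩ x (by rw [dist_comm]; exact hx)).le)
    (convex_ball _ _)
    (by
      rw [mem_ball, Prod.dist_eq]
      exact max_lt (by simpa using ht) (by simpa [dist_eq_norm] using hB))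
    (by
      rw [mem_ball, Prod.dist_eq]
      exact max_lt (by simpa using ht') (by simpa [dist_eq_norm] using hB))
  simpa [Prod.norm_def] using key

end Linearization

section Gluing

variable {ι : Type*} [Fintype ι] {m : ℕ}
  {V : Set (Fin m → ℂ)} {φ : (Fin m → ℂ) → ℂ} {σ : (Fin m → ℂ) → ℂ → (Fin m → ℂ)} {θ : ℝ}

lemma exists_seq_of_forall_exists {X : Type*} (P : ℕ → X → Prop) (R : ℕ → X → X → Prop)
    {x₀ : X} (h₀ : P 0 x₀) (h : ∀ n x, P n x → ∃ y, P (n + 1) y ∧ R n x y) :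
    ∃ f : ℕ → X, f 0 = x₀ ∧ (∀ n, P n (f n)) ∧ ∀ n, R n (f n) (f (n + 1)) := by
  choose g hg hg' using h
  let F : ∀ n, {x // P n x} := fun n =>
    Nat.rec ⟨x₀, h₀⟩ (fun n x => ⟨g n x.1 x.2, hg n x.1 x.2⟩) n
  exact ⟨fun n => (F n).1, rfl, fun n => (F n).2, fun n => hg' n (F n).1 (F n).2⟩

lemma exists_limit_of_le_geometric {F : Type*} [NormedAddCommGroup F] [NormedSpace ℂ F]
    [CompleteSpace F] {𝔼 : Type*} [NormedAddCommGroup 𝔼] [NormedSpace ℂ 𝔼] {U : Set 𝔼}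
    (hU : IsOpen U) {f : ℕ → 𝔼 → F} (hf : ∀ n, DifferentiableOn ℂ (f n) U) {C : ℝ}
    (h : ∀ n, ∀ x ∈ U, ‖f (n + 1) x - f n x‖ ≤ C / 2 / 2 ^ n) :
    ∃ g : 𝔼 → F, DifferentiableOn ℂ g U ∧ (∀ x ∈ U, Tendsto (fun n => f n x) atTop (𝓝 (g x))) ∧
      ∀ n, ∀ x ∈ U, ‖f n x - g x‖ ≤ C / 2 ^ n := by
  have hd : ∀ x ∈ U, ∀ n, dist (f n x) (f (n + 1) x) ≤ C / 2 / 2 ^ n := fun x hx n => by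
    rw [dist_comm, dist_eq_norm]; exact h n x hx
  have hlim : ∀ x ∈ U, Tendsto (fun n => f n x) atTop (𝓝 (limUnder atTop fun n => f n x)) :=
    fun x hx => (cauchySeq_of_le_geometric_two (hd x hx)).tendsto_limUnder
  have hle : ∀ n, ∀ x ∈ U, ‖f n x - limUnder atTop fun n => f n x‖ ≤ C / 2 ^ n :=
    fun n x hx => by
      rw [← dist_eq_norm]
      exact dist_le_of_le_geometric_two_of_tendsto (hd x hx) (hlim x hx) n
  refine ⟨fun x => limUnder atTop fun n => f n x, ?_, hlim, hle⟩
  refine differentiableOn_of_tendstoUniformlyOn hU hf ?_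
  rw [Metric.tendstoUniformlyOn_iff]
  intro ε hε
  have ht : Tendsto (fun n : ℕ => C / 2 ^ n) atTop (𝓝 0) :=
    tendsto_const_nhds.div_atTop (tendsto_pow_atTop_atTop_of_one_lt one_lt_two)
  filter_upwards [ht.eventually_lt_const hε] with n hn x hx
  rw [dist_comm, dist_eq_norm]
  exact (hle n x hx).trans_lt hn

/-- Nonlinear splitting at one vertex. -/
theorem IsLens.exists_glue_vertex (hL : IsLens V φ σ θ)
    {K : Set ((ι → ℂ) × (ι → ℂ) × (ι → ℂ))} (hK : IsCompact K)
    (hgood : ∀ B ∈ K, B.1 ⬝ᵥ B.2.1 ≠ 0 ∧ B.2.2 ⬝ᵥ B.2.1 ≠ 0) {ρ : ℝ} (hρ : 0 < ρ) :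
    ∃ ε > 0, ∀ B₀ B B' : (Fin m → ℂ) → (ι → ℂ) × (ι → ℂ) × (ι → ℂ),
      DifferentiableOn ℂ B₀ (lensLeft V φ θ ∩ lensRight V φ θ) →
      DifferentiableOn ℂ B (lensLeft V φ θ ∩ lensRight V φ θ) →
      DifferentiableOn ℂ B' (lensLeft V φ θ ∩ lensRight V φ θ) →
      (∀ x ∈ lensLeft V φ θ ∩ lensRight V φ θ,
        B₀ x ∈ K ∧ ‖B x - B₀ x‖ < ε ∧ ‖B' x - B₀ x‖ < ε) →
      ∃ α β : (Fin m → ℂ) → ℂ × (ι → ℂ), DifferentiableOn ℂ α (lensLeft V φ θ) ∧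
        DifferentiableOn ℂ β (lensRight V φ θ) ∧
        ∀ x ∈ lensLeft V φ θ ∩ lensRight V φ θ, moveFun (α x, B x) = moveFun (β x, B' x) ∧
          ‖moveFun (α x, B x) - (B₀ x).2.1‖ < ρ := by
  obtain ⟨C₁, hC₁, hsplit⟩ := hL.exists_split (E := ℂ × (ι → ℂ))
  obtain ⟨C₂, hC₂, hinv⟩ := exists_norm_moveInv_le hK hgood
  set C := C₁ * C₂ with hC
  have hC0 : 0 < C := mul_pos hC₁ hC₂
  obtain ⟨r₁, hr₁, hlin⟩ := exists_moveFun_linear_approx hK (κ := (4 * C)⁻¹) (by positivity)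
  have hFd : Differentiable ℂ (moveFun (ι := ι)) :=
    (contDiff_moveFun (ι := ι) (n := 1)).differentiable (by simp)
  obtain ⟨r₂, hr₂, hunif⟩ := exists_pos_forall_dist_lt
    ((isCompact_singleton (x := (0 : ℂ × (ι → ℂ)))).prod hK)
    (fun x _ => hFd.continuous.continuousAt (x := x)) hρ
  set r := min r₁ r₂ with hr
  have hr0 : 0 < r := lt_min hr₁ hr₂
  refine ⟨min r (r / (8 * C)), by positivity, fun B₀ B B' hB₀ hB hB' hx => ?_⟩
  set ε := min r (r / (8 * C)) with hε
  have hε0 : 0 < ε := by positivity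
  have hεr : ε ≤ r := min_le_left _ _
  have hCε : 2 * C * (2 * ε) < r := by
    have : ε ≤ r / (8 * C) := min_le_right _ _
    rw [le_div_iff₀ (by positivity)] at this
    linarith
  set M : ℝ := 2 * ε with hM
  have hM0 : 0 < M := by positivity
  set UA := lensLeft V φ θ with hUA
  set UB := lensRight V φ θ with hUB
  have hUAo : IsOpen UA := hL.isOpen_left θ
  have hUBo : IsOpen UB := hL.isOpen_right θ
  let P : ℕ → ((Fin m → ℂ) → ℂ × (ι → ℂ)) × ((Fin m → ℂ) → ℂ × (ι → ℂ)) → Prop := fun n s =>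
    DifferentiableOn ℂ s.1 UA ∧ DifferentiableOn ℂ s.2 UB ∧
    (∀ x ∈ UA, ‖s.1 x‖ ≤ 2 * C * M * (1 - 1 / 2 ^ n)) ∧
    (∀ x ∈ UB, ‖s.2 x‖ ≤ 2 * C * M * (1 - 1 / 2 ^ n)) ∧
    ∀ x ∈ UA ∩ UB, ‖moveFun (s.1 x, B x) - moveFun (s.2 x, B' x)‖ ≤ M / 2 ^ n
  let R : ℕ → ((Fin m → ℂ) → ℂ × (ι → ℂ)) × ((Fin m → ℂ) → ℂ × (ι → ℂ)) →
      ((Fin m → ℂ) → ℂ × (ι → ℂ)) × ((Fin m → ℂ) → ℂ × (ι → ℂ)) → Prop := fun n s s' =>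
    (∀ x ∈ UA, ‖s'.1 x - s.1 x‖ ≤ 2 * C * M / 2 / 2 ^ n) ∧
    ∀ x ∈ UB, ‖s'.2 x - s.2 x‖ ≤ 2 * C * M / 2 / 2 ^ n
  have hP0 : P 0 (0, 0) := by
    refine ⟨differentiableOn_const 0, differentiableOn_const 0, by simp, by simp, fun x hxs => ?_⟩
    obtain ⟨-, h1, h2⟩ := hx x hxs
    simp only [moveFun, Pi.zero_apply, moveVec_zero, pow_zero, div_one]
    have h3 : ‖(B x).2.1 - (B' x).2.1‖ ≤ ‖B x - B' x‖ :=
      (norm_fst_le ((B x).2 - (B' x).2)).trans (norm_snd_le (B x - B' x))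
    have h4 : ‖B x - B' x‖ ≤ ‖B x - B₀ x‖ + ‖B' x - B₀ x‖ := by
      have := norm_sub_le (B x - B₀ x) (B' x - B₀ x)
      simpa using this
    linarith
  have hsmall : ∀ n : ℕ, 2 * C * M * (1 - 1 / 2 ^ n) < r := fun n => by
    have h2 : (0 : ℝ) < 1 / 2 ^ n := by positivity
    have h3 : 0 < 2 * C * M := by positivity
    nlinarith
  have hstep : ∀ n s, P n s → ∃ s', P (n + 1) s' ∧ R n s s' := by
    rintro n ⟨α, β⟩ ⟨hα, hβ, hαn, hβn, hdef⟩
    simp only at hα hβ hαn hβn hdef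
    set D : (Fin m → ℂ) → ι → ℂ := fun x => moveFun (α x, B x) - moveFun (β x, B' x) with hD
    have hDd : DifferentiableOn ℂ D (UA ∩ UB) := by
      have h1 : DifferentiableOn ℂ (fun x => moveFun (α x, B x)) (UA ∩ UB) :=
        hFd.comp_differentiableOn ((hα.mono inter_subset_left).prodMk hB)
      have h2 : DifferentiableOn ℂ (fun x => moveFun (β x, B' x)) (UA ∩ UB) :=
        hFd.comp_differentiableOn ((hβ.mono inter_subset_right).prodMk hB')
      exact h1.sub h2
    have hno : IsOpen (UA ∩ UB) := hUAo.inter hUBo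
    have hh : DifferentiableOn ℂ (fun x => -moveInv (B₀ x) (D x)) (UA ∩ UB) := fun x hxs =>
      (differentiableAt_moveInv (hB₀.differentiableAt (hno.mem_nhds hxs))
        (hDd.differentiableAt (hno.mem_nhds hxs)) (hgood _ (hx x hxs).1).1
        (hgood _ (hx x hxs).1).2).fun_neg.differentiableWithinAt
    have hhb : ∀ x ∈ UA ∩ UB, ‖-moveInv (B₀ x) (D x)‖ ≤ C₂ * (M / 2 ^ n) := fun x hxs => by
      rw [norm_neg]
      exact (hinv _ (hx x hxs).1 _).trans (mul_le_mul_of_nonneg_left (hdef x hxs) hC₂.le)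
    obtain ⟨a, b, ha, hb, han, hbn, hab⟩ := hsplit _ _ hh hhb
    have hCM : C₁ * (C₂ * (M / 2 ^ n)) = C * M / 2 ^ n := by rw [hC]; ring
    rw [hCM] at han hbn
    have hsum : 2 * C * M * (1 - 1 / 2 ^ n) + C * M / 2 ^ n = 2 * C * M * (1 - 1 / 2 ^ (n + 1)) := by
      rw [pow_succ]; field_simp; ring
    have hα' : ∀ x ∈ UA, ‖α x + a x‖ ≤ 2 * C * M * (1 - 1 / 2 ^ (n + 1)) := fun x hxs => by
      rw [← hsum]; exact (norm_add_le _ _).trans (add_le_add (hαn x hxs) (han x hxs))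
    have hβ' : ∀ x ∈ UB, ‖β x + b x‖ ≤ 2 * C * M * (1 - 1 / 2 ^ (n + 1)) := fun x hxs => by
      rw [← hsum]; exact (norm_add_le _ _).trans (add_le_add (hβn x hxs) (hbn x hxs))
    refine ⟨(fun x => α x + a x, fun x => β x + b x), ⟨hα.add ha, hβ.add hb, hα', hβ', ?_⟩, ?_, ?_⟩
    · intro x hxs
      obtain ⟨hxK, h1, h2⟩ := hx x hxs
      have hrr : r ≤ r₁ := min_le_left _ _
      have e1 := hlin _ hxK (B x) (by linarith) (α x) (α x + a x)
        (by linarith [hαn x hxs.1, hsmall n]) (by linarith [hα' x hxs.1, hsmall (n + 1)])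
      have e2 := hlin _ hxK (B' x) (by linarith) (β x) (β x + b x)
        (by linarith [hβn x hxs.2, hsmall n]) (by linarith [hβ' x hxs.2, hsmall (n + 1)])
      rw [add_sub_cancel_left] at e1 e2
      have e3 : fderiv ℂ (moveFun (ι := ι)) (0, B₀ x) (a x, 0) -
          fderiv ℂ (moveFun (ι := ι)) (0, B₀ x) (b x, 0) = -D x := by
        rw [← map_sub, Prod.mk_sub_mk, sub_zero, hab x hxs]
        have := fderiv_moveFun_moveInv (hgood _ hxK).1 (hgood _ hxK).2 (D x)
        rw [show ((-moveInv (B₀ x) (D x), 0) : (ℂ × (ι → ℂ)) × (ι → ℂ) × (ι → ℂ) × (ι → ℂ)) =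
          -(moveInv (B₀ x) (D x), 0) by simp, map_neg, this]
      have e4 : moveFun (α x + a x, B x) - moveFun (β x + b x, B' x) =
          (moveFun (α x + a x, B x) - moveFun (α x, B x) -
            fderiv ℂ (moveFun (ι := ι)) (0, B₀ x) (a x, 0)) -
          (moveFun (β x + b x, B' x) - moveFun (β x, B' x) -
            fderiv ℂ (moveFun (ι := ι)) (0, B₀ x) (b x, 0)) := by
        have : D x = moveFun (α x, B x) - moveFun (β x, B' x) := rfl
        have e5 : fderiv ℂ (moveFun (ι := ι)) (0, B₀ x) (a x, 0) =
          fderiv ℂ (moveFun (ι := ι)) (0, B₀ x) (b x, 0) - D x := by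
            rw [sub_eq_iff_eq_add] at e3
            rw [e3]
            abel
        rw [e5, this]
        abel
      simp only
      rw [e4]
      refine (norm_sub_le _ _).trans ((add_le_add e1 e2).trans ?_)
      have k1 := mul_le_mul_of_nonneg_left (han x hxs.1) (show 0 ≤ (4 * C)⁻¹ by positivity)
      have k2 := mul_le_mul_of_nonneg_left (hbn x hxs.2) (show 0 ≤ (4 * C)⁻¹ by positivity)
      refine (add_le_add k1 k2).trans (le_of_eq ?_)
      rw [pow_succ]; field_simp; ring
    · intro x hxs
      simp only [add_sub_cancel_left]
      exact (han x hxs).trans (le_of_eq (by ring))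
    · intro x hxs
      simp only [add_sub_cancel_left]
      exact (hbn x hxs).trans (le_of_eq (by ring))
  obtain ⟨f, -, hfP, hfR⟩ := exists_seq_of_forall_exists P R hP0 hstep
  obtain ⟨α, hα, hαl, -⟩ := exists_limit_of_le_geometric hUAo (f := fun n => (f n).1)
    (fun n => (hfP n).1) (fun n => (hfR n).1)
  obtain ⟨β, hβ, hβl, -⟩ := exists_limit_of_le_geometric hUBo (f := fun n => (f n).2)
    (fun n => (hfP n).2.1) (fun n => (hfR n).2)
  refine ⟨α, β, hα, hβ, fun x hxs => ⟨?_, ?_⟩⟩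
  · have h1 : Tendsto (fun n => moveFun ((f n).1 x, B x) - moveFun ((f n).2 x, B' x)) atTop
        (𝓝 (moveFun (α x, B x) - moveFun (β x, B' x))) :=
      ((hFd.continuous.tendsto _).comp ((hαl x hxs.1).prodMk_nhds tendsto_const_nhds)).sub
        ((hFd.continuous.tendsto _).comp ((hβl x hxs.2).prodMk_nhds tendsto_const_nhds))
    have h2 : Tendsto (fun n => moveFun ((f n).1 x, B x) - moveFun ((f n).2 x, B' x)) atTop
        (𝓝 0) := by
      refine squeeze_zero_norm (fun n => (hfP n).2.2.2.2 x hxs) ?_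
      exact tendsto_const_nhds.div_atTop (tendsto_pow_atTop_atTop_of_one_lt one_lt_two)
    exact sub_eq_zero.mp (tendsto_nhds_unique h1 h2)
  · obtain ⟨hxK, h1, -⟩ := hx x hxs
    have hαx : ‖α x‖ < r := by
      refine lt_of_le_of_lt (le_of_tendsto (hαl x hxs.1).norm
        (Eventually.of_forall fun n => ?_)) hCε
      refine ((hfP n).2.2.1 x hxs.1).trans ?_
      have h2 : (0 : ℝ) < 1 / 2 ^ n := by positivity
      have h3 : 0 < 2 * C * M := by positivity
      nlinarith
    have := hunif (0, B₀ x) ⟨rfl, hxK⟩ (α x, B x) (by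
      rw [dist_comm, Prod.dist_eq]
      have hrr : r ≤ r₂ := min_le_right _ _
      exact max_lt (by simpa using hαx.trans_le hrr)
        (by rw [dist_eq_norm]; exact h1.trans_le (hεr.trans hrr)))
    rw [dist_comm, dist_eq_norm] at this
    simpa [moveFun, moveVec_zero] using this

end Gluing

section ChainGluing

variable {ι : Type*} [Fintype ι] {m : ℕ}
  {V : Set (Fin m → ℂ)} {φ : (Fin m → ℂ) → ℂ} {σ : (Fin m → ℂ) → ℂ → (Fin m → ℂ)} {θ : ℝ}

lemma ChainOn.of_forall {𝔼 : Type*} [NormedAddCommGroup 𝔼] [NormedSpace ℂ 𝔼] {N : ℕ}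
    {e v : 𝔼 → ι → ℂ} {S : Set 𝔼} {p : 𝔼 → ℕ → ι → ℂ}
    (h : ∀ x ∈ S, ∃ p', ChainOn N e v {x} p' ∧ ∀ᶠ y in 𝓝 x, p y = p' y) : ChainOn N e v S p := by
  refine ⟨eventually_nhdsSet_iff_forall.mpr fun x hx => ?_,
    fun k => eventually_nhdsSet_iff_forall.mpr fun x hx => ?_⟩
  · obtain ⟨p', hp', he⟩ := h x hx
    have := hp'.gallery
    rw [nhdsSet_singleton] at this
    filter_upwards [this, he] with y h1 h2
    rwa [h2]
  · obtain ⟨p', hp', he⟩ := h x hx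
    have : HolNear (fun z => p z k) {x} :=
      (hp'.hol k).congr (by rw [nhdsSet_singleton]; exact he.mono fun y hy => by rw [hy])
    rwa [HolNear, nhdsSet_singleton] at this

lemma HolNear.differentiableOn {𝔼 : Type*} [NormedAddCommGroup 𝔼] [NormedSpace ℂ 𝔼]
    {F : Type*} [NormedAddCommGroup F] [NormedSpace ℂ F] {f : 𝔼 → F} {S : Set 𝔼}
    (h : HolNear f S) : DifferentiableOn ℂ f S :=
  fun _ hx => (h.differentiableAt hx).differentiableWithinAt

lemma IsOpen.holNear {𝔼 : Type*} [NormedAddCommGroup 𝔼] [NormedSpace ℂ 𝔼]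
    {F : Type*} [NormedAddCommGroup F] [NormedSpace ℂ F] {f : 𝔼 → F} {S : Set 𝔼}
    (hS : IsOpen S) (h : DifferentiableOn ℂ f S) : HolNear f S :=
  eventually_nhdsSet_of_open hS subset_rfl fun _ hy => h.differentiableAt (hS.mem_nhds hy)

lemma IsLens.exists_glue_vertices (hL : IsLens V φ σ θ) {N : ℕ} {e v : (Fin m → ℂ) → ι → ℂ}
    {S : Set (Fin m → ℂ)} (hS : IsCompact S) (hov : lensLeft V φ θ ∩ lensRight V φ θ ⊆ S)
    {p : (Fin m → ℂ) → ℕ → ι → ℂ} (hp : ChainOn N e v S p) (j : ℕ) (hj : j < N) {ρ : ℝ}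
    (hρ : 0 < ρ) :
    ∃ ε > 0, ∀ q, ChainOn N e v S q → (∀ x ∈ S, ∀ k, ‖q x k - p x k‖ < ε) →
      ∃ p' q', Reach N (lensLeft V φ θ) p p' ∧ Reach N (lensRight V φ θ) q q' ∧
        ∀ x ∈ lensLeft V φ θ ∩ lensRight V φ θ, (∀ k ≤ j, p' x k = q' x k) ∧
          ∀ k, ‖p' x k - p x k‖ < ρ ∧ ‖q' x k - p x k‖ < ρ := by
  set U := lensLeft V φ θ ∩ lensRight V φ θ with hU
  have hUo : IsOpen U := (hL.isOpen_left θ).inter (hL.isOpen_right θ)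
  induction j generalizing ρ with
  | zero =>
    refine ⟨ρ, hρ, fun q hq hclose => ⟨p, q, .refl, .refl, fun x hx => ⟨fun k hk => ?_,
      fun k => ⟨by simpa using hρ, hclose x (hov hx) k⟩⟩⟩⟩
    obtain rfl : k = 0 := by omega
    rw [(hp.gallery_at (hov hx)).left, (hq.gallery_at (hov hx)).left]
  | succ j ih =>
    set B₀ : (Fin m → ℂ) → (ι → ℂ) × (ι → ℂ) × (ι → ℂ) :=
      fun x => (p x j, p x (j + 1), p x (j + 2)) with hB₀
    have hd : ∀ {r : (Fin m → ℂ) → ℕ → ι → ℂ}, ChainOn N e v U r →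
        DifferentiableOn ℂ (fun x => (r x j, r x (j + 1), r x (j + 2))) U := fun h =>
      (h.hol j).differentiableOn.prodMk
        ((h.hol (j + 1)).differentiableOn.prodMk (h.hol (j + 2)).differentiableOn)
    have hB₀c : ContinuousOn B₀ S := (hp.hol j).differentiableOn.continuousOn.prodMk
      ((hp.hol (j + 1)).differentiableOn.continuousOn.prodMk
        (hp.hol (j + 2)).differentiableOn.continuousOn)
    obtain ⟨ε₁, hε₁, hglue⟩ := hL.exists_glue_vertex (hS.image_of_continuousOn hB₀c)
      (by
        rintro _ ⟨x, hx, rfl⟩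
        have hg := hp.gallery_at hx
        refine ⟨hg.ne j (by omega), ?_⟩
        rw [dotProduct_comm]
        exact hg.ne (j + 1) hj) hρ
    obtain ⟨ε, hε, h⟩ := ih (by omega) (lt_min hε₁ hρ)
    refine ⟨ε, hε, fun q hq hclose => ?_⟩
    obtain ⟨p', q', hp', hq', hpq⟩ := h q hq hclose
    have hp'U : ChainOn N e v U p' := (hp.mono hov).reach (Reach.mono hp' inter_subset_left)
    have hq'U : ChainOn N e v U q' := (hq.mono hov).reach (Reach.mono hq' inter_subset_right)
    obtain ⟨α, β, hα, hβ, hαβ⟩ := hglue B₀ (fun x => (p' x j, p' x (j + 1), p' x (j + 2)))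
      (fun x => (q' x j, q' x (j + 1), q' x (j + 2))) (hd (hp.mono hov)) (hd hp'U) (hd hq'U)
      (fun x hx => ⟨mem_image_of_mem _ (hov hx), by
        have h1 := fun k => ((hpq x hx).2 k).1.trans_le (min_le_left _ _)
        exact max_lt (h1 j) (max_lt (h1 (j + 1)) (h1 (j + 2))), by
        have h1 := fun k => ((hpq x hx).2 k).2.trans_le (min_le_left _ _)
        exact max_lt (h1 j) (max_lt (h1 (j + 1)) (h1 (j + 2)))⟩)
    refine ⟨fun x => moveAt (j + 1) (α x) (p' x), fun x => moveAt (j + 1) (β x) (q' x),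
      hp'.tail ⟨j + 1, by omega, hj, α, (hL.isOpen_left θ).holNear hα, Eventually.of_forall
        fun _ => rfl⟩,
      hq'.tail ⟨j + 1, by omega, hj, β, (hL.isOpen_right θ).holNear hβ, Eventually.of_forall
        fun _ => rfl⟩, fun x hx => ⟨fun k hk => ?_, fun k => ?_⟩⟩
    · rcases eq_or_ne k (j + 1) with rfl | hne
      · simp only [moveAt_same]
        exact (hαβ x hx).1
      · simp only [moveAt_of_ne hne]
        exact (hpq x hx).1 k (by omega)
    · rcases eq_or_ne k (j + 1) with rfl | hne
      · simp only [moveAt_same]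
        have h1 := (hαβ x hx).2
        refine ⟨h1, ?_⟩
        rw [(hαβ x hx).1] at h1
        exact h1
      · simp only [moveAt_of_ne hne]
        exact ⟨((hpq x hx).2 k).1.trans_le (min_le_right _ _),
          ((hpq x hx).2 k).2.trans_le (min_le_right _ _)⟩

/-- Gluing two nearby chains along a lens. -/
theorem IsLens.exists_glue (hL : IsLens V φ σ θ) {N : ℕ} (hN : 2 ≤ N)
    {e v : (Fin m → ℂ) → ι → ℂ} {S : Set (Fin m → ℂ)} (hS : IsCompact S)
    (hov : lensLeft V φ θ ∩ lensRight V φ θ ⊆ S) {p : (Fin m → ℂ) → ℕ → ι → ℂ}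
    (hp : ChainOn N e v S p) :
    ∃ ε > 0, ∀ q, ChainOn N e v S q → (∀ x ∈ S, ∀ k, ‖q x k - p x k‖ < ε) →
      ∃ w, (∀ T ⊆ V, ChainOn N e v (T ∩ lensLeft V φ θ) p →
          ChainOn N e v (T ∩ lensRight V φ θ) q → ChainOn N e v T w) ∧
        ∀ T ⊆ V, (∀ x ∈ T, 0 < (φ x).im) → Reach N T q w := by
  obtain ⟨ε, hε, h⟩ := hL.exists_glue_vertices hS hov hp (N - 1) (by omega) one_pos
  refine ⟨ε, hε, fun q hq hclose => ?_⟩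
  obtain ⟨p', q', hp', hq', hpq⟩ := h q hq hclose
  have hUo : IsOpen (lensLeft V φ θ ∩ lensRight V φ θ) :=
    (hL.isOpen_left θ).inter (hL.isOpen_right θ)
  have heq : ∀ x ∈ lensLeft V φ θ ∩ lensRight V φ θ, p' x = q' x := fun x hx => by
    ext1 k
    by_cases hk : k < N
    · exact (hpq x hx).1 k (by omega)
    · rw [(((hp.mono hov).reach (Reach.mono hp' inter_subset_left)).gallery_at hx).right k
        (by omega), (((hq.mono hov).reach (Reach.mono hq' inter_subset_right)).gallery_at hx).right k
        (by omega)]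
  have hpos : IsOpen {z ∈ V | 0 < (φ z).im} := by simpa [lensRight] using hL.isOpen_right 0
  have hneg : IsOpen {z ∈ V | (φ z).im < 0} := by simpa [lensLeft] using hL.isOpen_left 0
  refine ⟨fun x => if (φ x).im < 0 then p' x else q' x, fun T hT hTp hTq => ?_, fun T hT hT0 => ?_⟩
  · have hθ := hL.pos
    refine ChainOn.of_forall fun x hx => ?_
    have hleft : x ∈ lensLeft V φ θ → ChainOn N e v {x} p' := fun hxl =>
      ((hTp.mono (singleton_subset_iff.mpr ⟨hx, hxl⟩)).reach
        (Reach.mono hp' (singleton_subset_iff.mpr hxl)))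
    have hright : x ∈ lensRight V φ θ → ChainOn N e v {x} q' := fun hxl =>
      ((hTq.mono (singleton_subset_iff.mpr ⟨hx, hxl⟩)).reach
        (Reach.mono hq' (singleton_subset_iff.mpr hxl)))
    by_cases h1 : (φ x).im < θ
    · refine ⟨p', hleft ⟨hT hx, h1⟩, ?_⟩
      by_cases h2 : -θ < (φ x).im
      · filter_upwards [hUo.mem_nhds ⟨⟨hT hx, h1⟩, ⟨hT hx, h2⟩⟩] with y hy
        rw [heq y hy, ite_self]
      · filter_upwards [hneg.mem_nhds ⟨hT hx, by linarith⟩] with y hy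
        rw [if_pos hy.2]
    · refine ⟨q', hright ⟨hT hx, by linarith⟩, ?_⟩
      filter_upwards [hpos.mem_nhds ⟨hT hx, by linarith⟩] with y hy
      rw [if_neg hy.2.not_gt]
  · have hTr : T ⊆ lensRight V φ θ := fun x hx => ⟨hT hx, by linarith [hL.pos, hT0 x hx]⟩
    refine (Reach.mono hq' hTr).trans (Reach.of_eventually_eq hN ?_)
    refine eventually_nhdsSet_of_open hpos (fun x hx => ⟨hT hx, hT0 x hx⟩) fun y hy => ?_
    rw [if_neg hy.2.not_gt]

end ChainGluing

section Boxes

variable {m : ℕ}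

/-- The real coordinates of `ℂ^m`: real parts for `false`, imaginary parts for `true`. -/
def realCoord (k : Fin m × Bool) (z : Fin m → ℂ) : ℝ := bif k.2 then (z k.1).im else (z k.1).re

/-- A closed box described by its real coordinates. -/
def coordBox (l r : Fin m × Bool → ℝ) : Set (Fin m → ℂ) :=
  {z | ∀ k, l k ≤ realCoord k z ∧ realCoord k z ≤ r k}

variable {l r l' r' : Fin m × Bool → ℝ}

lemma coordBox_eq_rectBox (l r : Fin m × Bool → ℝ) : coordBox l r =
    rectBox (fun j => l (j, false)) (fun j => r (j, false)) (fun j => l (j, true))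
      (fun j => r (j, true)) := by
  ext z
  simp only [coordBox, rectBox, closedRect, mem_ofPred_eq, Complex.mem_reProdIm, mem_Icc, realCoord,
    Prod.forall, Bool.forall_bool, cond_true, cond_false]

lemma isCompact_coordBox : IsCompact (coordBox l r) := by
  rw [coordBox_eq_rectBox]; exact isCompact_rectBox

lemma rungeSet_coordBox : RungeSet (coordBox l r) := by
  rw [coordBox_eq_rectBox]; exact fun f hf ε hε => exists_entire_approx_rectBox hf hε

lemma coordBox_subset (hl : l' ≤ l) (hr : r ≤ r') : coordBox l r ⊆ coordBox l' r' :=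
  fun _ hz k => ⟨(hl k).trans (hz k).1, (hz k).2.trans (hr k)⟩

lemma continuous_realCoord (k : Fin m × Bool) : Continuous (realCoord k) := by
  unfold realCoord
  rcases k with ⟨j, _ | _⟩
  · exact Complex.continuous_re.comp (continuous_apply j)
  · exact Complex.continuous_im.comp (continuous_apply j)

lemma convex_coordBox : Convex ℝ (coordBox l r) := by
  have hlin : ∀ k : Fin m × Bool, ∀ (x y : Fin m → ℂ) (a b : ℝ),
      realCoord k (a • x + b • y) = a * realCoord k x + b * realCoord k y := by
    rintro ⟨j, _ | _⟩ x y a b <;> simp [realCoord]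
  intro x hx y hy a b ha hb hab k
  have h1 := hx k
  have h2 := hy k
  rw [hlin]
  obtain rfl : b = 1 - a := by linarith
  constructor <;> nlinarith

lemma coordBox_nonempty (h : l ≤ r) : (coordBox l r).Nonempty := by
  refine ⟨fun j => ⟨l (j, false), l (j, true)⟩, ?_⟩
  rintro ⟨j, _ | _⟩
  · exact ⟨le_rfl, h _⟩
  · exact ⟨le_rfl, h _⟩

lemma exists_enlarged_coordBox_subset {U : Set (Fin m → ℂ)} (hU : IsOpen U)
    (h : coordBox l r ⊆ U) :
    ∃ ρ > 0, coordBox (fun k => l k - ρ) (fun k => r k + ρ) ⊆ U := by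
  have : Nonempty {ρ : ℝ // 0 < ρ} := ⟨⟨1, one_pos⟩⟩
  obtain ⟨ρ, hρ⟩ := exists_subset_nhds_of_isCompact (U := U)
    (V := fun ρ : {ρ : ℝ // 0 < ρ} => coordBox (fun k => l k - ρ) (fun k => r k + ρ))
    (fun a b => ⟨⟨min a.1 b.1, lt_min a.2 b.2⟩,
      coordBox_subset (fun k => sub_le_sub_left (min_le_left _ _) _)
        (fun k => add_le_add_right (min_le_left _ _) _),
      coordBox_subset (fun k => sub_le_sub_left (min_le_right _ _) _)
        (fun k => add_le_add_right (min_le_right _ _) _)⟩)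
    (fun _ => isCompact_coordBox) (fun x hx => hU.mem_nhds (h fun k => by
      simp only [mem_iInter] at hx
      exact ⟨le_of_forall_pos_le_add fun ε hε => by linarith [(hx ⟨ε, hε⟩ k).1],
        le_of_forall_pos_le_add fun ε hε => (hx ⟨ε, hε⟩ k).2⟩))
  exact ⟨ρ.1, ρ.2, hρ⟩

/-- A lens crossing a box transversally to the direction `k`. -/
lemma exists_isLens_coordBox (k : Fin m × Bool) (hlr : ∀ i, l i < r i) (s : ℝ) {h : ℝ}
    (hh : 0 < h) :
    ∃ φ σ θ, IsLens {z | ∀ i ≠ k, l i < realCoord i z ∧ realCoord i z < r i} φ σ θ ∧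
      (∀ z ∈ lensLeft {z | ∀ i ≠ k, l i < realCoord i z ∧ realCoord i z < r i} φ θ,
        realCoord k z < s + h) ∧
      (∀ z ∈ lensRight {z | ∀ i ≠ k, l i < realCoord i z ∧ realCoord i z < r i} φ θ,
        s - h < realCoord k z) ∧
      ∀ z ∈ {z | ∀ i ≠ k, l i < realCoord i z ∧ realCoord i z < r i},
        s < realCoord k z → 0 < (φ z).im := by
  set O : Set (Fin m → ℂ) := {z | ∀ i : Fin m × Bool, i.1 ≠ k.1 →
    l i < realCoord i z ∧ realCoord i z < r i} with hOdef
  have hO : IsOpen O := by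
    have : O = ⋂ i : Fin m × Bool, ⋂ _ : i.1 ≠ k.1,
        {z | l i < realCoord i z ∧ realCoord i z < r i} := by
      ext z; simp [hOdef]
    rw [this]
    refine isOpen_iInter_of_finite fun i => isOpen_iInter_of_finite fun _ => ?_
    exact (isOpen_lt continuous_const (continuous_realCoord i)).inter
      (isOpen_lt (continuous_realCoord i) continuous_const)
  have hOj : ∀ z ∈ O, ∀ x : ℂ, Function.update z k.1 x ∈ O := fun z hz x i hi => by
    have : realCoord i (Function.update z k.1 x) = realCoord i z := by
      simp [realCoord, Function.update_of_ne hi]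
    rw [this]; exact hz i hi
  obtain ⟨j, b⟩ := k
  cases b with
  | false =>
    have hre : ∀ z : Fin m → ℂ, (1 * z j).re = realCoord (j, false) z := fun z => by
      simp [realCoord]
    have him : ∀ z : Fin m → ℂ, (1 * z j).im = realCoord (j, true) z := fun z => by
      simp [realCoord]
    obtain ⟨φ, σ, θ, hL, h1, h2, h3⟩ := exists_isLens j one_ne_zero hO hOj (hlr (j, true)) s hh
    have hV : {z ∈ O | l (j, true) < (1 * z j).im ∧ (1 * z j).im < r (j, true)} =
        {z | ∀ i ≠ (j, false), l i < realCoord i z ∧ realCoord i z < r i} := by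
      ext z
      simp only [him]
      refine ⟨fun hz i hi => ?_, fun hz => ⟨fun i hi => hz i (by rintro rfl; exact hi rfl),
        hz (j, true) (by simp)⟩⟩
      by_cases hij : i.1 = j
      · obtain ⟨i, _ | _⟩ := i
        · exact absurd (by rw [← hij]) hi
        · obtain rfl : i = j := hij
          exact hz.2
      · exact hz.1 i hij
    rw [hV] at hL h1 h2
    refine ⟨φ, σ, θ, hL, fun z hz => hre z ▸ h1 z hz, fun z hz => hre z ▸ h2 z hz,
      fun z hz hs => ?_⟩
    have hz' := hV.symm.subset hz
    exact h3 z hz'.1 hz'.2.1 hz'.2.2 (by rw [hre]; exact hs)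
  | true =>
    have hre : ∀ z : Fin m → ℂ, (-Complex.I * z j).re = realCoord (j, true) z := fun z => by
      simp [realCoord]
    have him : ∀ z : Fin m → ℂ, (-Complex.I * z j).im = -realCoord (j, false) z := fun z => by
      simp [realCoord]
    obtain ⟨φ, σ, θ, hL, h1, h2, h3⟩ := exists_isLens j (neg_ne_zero.mpr Complex.I_ne_zero) hO hOj
      (neg_lt_neg (hlr (j, false))) s hh
    have hV : {z ∈ O | -r (j, false) < (-Complex.I * z j).im ∧
        (-Complex.I * z j).im < -l (j, false)} =
        {z | ∀ i ≠ (j, true), l i < realCoord i z ∧ realCoord i z < r i} := by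
      ext z
      simp only [him, neg_lt_neg_iff]
      refine ⟨fun hz i hi => ?_, fun hz => ⟨fun i hi => hz i (by rintro rfl; exact hi rfl),
        (hz (j, false) (by simp)).symm⟩⟩
      by_cases hij : i.1 = j
      · obtain ⟨i, _ | _⟩ := i
        · obtain rfl : i = j := hij
          exact hz.2.symm
        · exact absurd (by rw [← hij]) hi
      · exact hz.1 i hij
    rw [hV] at hL h1 h2
    refine ⟨φ, σ, θ, hL, fun z hz => hre z ▸ h1 z hz, fun z hz => hre z ▸ h2 z hz,
      fun z hz hs => ?_⟩
    have hz' := hV.symm.subset hz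
    exact h3 z hz'.1 hz'.2.1 hz'.2.2 (by rw [hre]; exact hs)

end Boxes

section Vectors

variable {ι : Type*} [Fintype ι]

lemma differentiable_mulVec_const {𝔼 : Type*} [NormedAddCommGroup 𝔼] [NormedSpace ℂ 𝔼]
    {A : 𝔼 → Matrix ι ι ℂ} (hA : ∀ a b, Differentiable ℂ fun y => A y a b) (e₀ : ι → ℂ) :
    Differentiable ℂ fun x => A x *ᵥ e₀ := by
  refine differentiable_pi.mpr fun i => ?_
  simp only [mulVec, dotProduct]
  exact Differentiable.fun_sum fun j _ => (hA i j).mul_const _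

open scoped ComplexOrder in
lemma exists_dot_ne_zero {e v : ι → ℂ} (he : e ≠ 0) (hv : v ≠ 0) :
    ∃ c : ι → ℂ, e ⬝ᵥ c ≠ 0 ∧ c ⬝ᵥ v ≠ 0 := by
  have he' : e ⬝ᵥ star e ≠ 0 := fun h => he (dotProduct_self_star_eq_zero.mp h)
  have hv' : star v ⬝ᵥ v ≠ 0 := fun h => hv (dotProduct_star_self_eq_zero.mp h)
  by_cases h1 : star e ⬝ᵥ v = 0
  · by_cases h2 : e ⬝ᵥ star v = 0
    · exact ⟨star e + star v, by rwa [dotProduct_add, h2, add_zero],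
        by rwa [add_dotProduct, h1, zero_add]⟩
    · exact ⟨star v, h2, hv'⟩
  · exact ⟨star e, he', h1⟩

end Vectors

section UniformLength

variable {m N : ℕ} {ι : Type*} [Fintype ι] [DecidableEq ι] {e₀ : ι → ℂ}
  {A B : (Fin m → ℂ) → Matrix ι ι ℂ}

/-- Extending a chain across an overlap of two boxes. -/
lemma exists_extend_chain (hN : 2 ≤ N) (hAB : ∀ x, A x * B x = 1)
    (hA : ∀ a b, Differentiable ℂ fun y => A y a b)
    (hB : ∀ a b, Differentiable ℂ fun y => B y a b) {k : Fin m × Bool}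
    {l r : Fin m × Bool → ℝ} {t₀ t₁ t₂ : ℝ} (hlr : ∀ i ≠ k, l i ≤ r i) (hl : l k ≤ t₀)
    (h₀₁ : t₀ ≤ t₁) (h₁₂ : t₁ ≤ t₂) {w u u' : (Fin m → ℂ) → ℕ → ι → ℂ}
    (hw : ChainOn (3 * N) (fun _ => e₀) (fun x => A x *ᵥ e₀)
      (coordBox l (Function.update r k t₁)) w)
    (hu : ChainOn N (fun _ => e₀) (fun x => A x *ᵥ e₀)
      (coordBox (Function.update l k t₀) (Function.update r k t₁)) u)
    (huw : Reach (3 * N) (coordBox (Function.update l k t₀) (Function.update r k t₁))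
      (tripled N u u) w)
    (hu' : ChainOn N (fun _ => e₀) (fun x => A x *ᵥ e₀)
      (coordBox (Function.update l k t₀) (Function.update r k t₂)) u') :
    ∃ w', ChainOn (3 * N) (fun _ => e₀) (fun x => A x *ᵥ e₀)
        (coordBox l (Function.update r k t₂)) w' ∧
      Reach (3 * N) (coordBox (Function.update l k t₁) (Function.update r k t₂))
        (tripled N u' u') w' := by
  have hv := differentiable_mulVec_const hA e₀
  set R := coordBox (Function.update l k t₀) (Function.update r k t₁) with hR
  set Q := coordBox (Function.update l k t₀) (Function.update r k t₂) with hQ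
  have hle : Function.update l k t₀ ≤ Function.update r k t₁ := by
    intro i
    rcases eq_or_ne i k with rfl | hne
    · simpa using h₀₁
    · simpa [hne] using hlr i hne
  have hll : l ≤ Function.update l k t₀ := le_update_iff.mpr ⟨hl, fun _ _ => le_rfl⟩
  have hrr : Function.update r k t₁ ≤ Function.update r k t₂ :=
    update_le_update_iff.mpr ⟨h₁₂, fun _ _ => le_rfl⟩
  have hRQ : R ⊆ Q := coordBox_subset le_rfl hrr
  have hRP : R ⊆ coordBox l (Function.update r k t₁) := coordBox_subset hll le_rfl
  have hreach : Reach (3 * N) R (tripled N u' u') w :=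
    (reach_tripled hN hAB hA hB isCompact_coordBox convex_coordBox (coordBox_nonempty hle)
      (hu'.mono hRQ) hu).trans huw
  obtain ⟨U₁, hU₁, hRU₁, hreach⟩ := Reach.exists_open hreach
  obtain ⟨U₂, hU₂, hRU₂, hwU⟩ := (hw.mono hRP).exists_open hv
  obtain ⟨U₃, hU₃, hQU₃, huU⟩ := hu'.exists_open hv
  obtain ⟨ρ₁, hρ₁, hS₁⟩ := exists_enlarged_coordBox_subset (hU₁.inter hU₂) (subset_inter hRU₁ hRU₂)
  obtain ⟨ρ₂, hρ₂, hS₂⟩ := exists_enlarged_coordBox_subset hU₃ hQU₃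
  set ρ := min ρ₁ ρ₂ with hρ
  have hρ0 : 0 < ρ := lt_min hρ₁ hρ₂
  set S := coordBox (fun i => Function.update l k t₀ i - ρ)
    (fun i => Function.update r k t₁ i + ρ) with hS
  set Q' := coordBox (fun i => Function.update l k t₀ i - ρ)
    (fun i => Function.update r k t₂ i + ρ) with hQ'
  have hSU : S ⊆ U₁ ∩ U₂ := (coordBox_subset
    (fun i => sub_le_sub_left (min_le_left _ _) _)
    (fun i => add_le_add_right (min_le_left _ _) _)).trans hS₁
  have hQU : Q' ⊆ U₃ := (coordBox_subset
    (fun i => sub_le_sub_left (min_le_right _ _) _)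
    (fun i => add_le_add_right (min_le_right _ _) _)).trans hS₂
  have hSQ : S ⊆ Q' := coordBox_subset le_rfl (fun i => add_le_add_left (hrr i) _)
  obtain ⟨φ, σ, θ, hL, hleft, hright, hpos⟩ := exists_isLens_coordBox k
    (l := fun i => Function.update l k t₀ i - ρ) (r := fun i => Function.update r k t₁ i + ρ)
    (fun i => by linarith [hle i]) (t₁ - ρ / 2) (half_pos hρ0)
  set V : Set (Fin m → ℂ) := {z | ∀ i ≠ k, Function.update l k t₀ i - ρ < realCoord i z ∧
    realCoord i z < Function.update r k t₁ i + ρ} with hV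
  have hov : lensLeft V φ θ ∩ lensRight V φ θ ⊆ S := by
    rintro z ⟨hz, hz'⟩ i
    rcases eq_or_ne i k with rfl | hne
    · have h1 := hleft z hz
      have h2 := hright z hz'
      simp only [Function.update_self]
      constructor <;> linarith
    · exact ⟨(hz.1 i hne).1.le, (hz.1 i hne).2.le⟩
  obtain ⟨ε, hε, hglue⟩ := hL.exists_glue (by omega) isCompact_coordBox hov
    (hwU.mono (hSU.trans inter_subset_right))
  have htr : ChainOn (3 * N) (fun _ => e₀) (fun x => A x *ᵥ e₀) Q' (tripled N u' u') :=
    chainOn_tripled (huU.mono hQU) (huU.mono hQU)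
  obtain ⟨q, hq, hqw⟩ := exists_reach_approx isCompact_coordBox rungeSet_coordBox hSQ htr
    (Reach.mono hreach (hSU.trans inter_subset_left)) hε
  have hqQ := htr.reach hq
  obtain ⟨w', hw', hqw'⟩ := hglue q (hqQ.mono hSQ) hqw
  have hVmem : ∀ z ∈ coordBox l (Function.update r k t₂), z ∈ V := fun z hz i hne => by
    have := hz i
    simp only [Function.update_of_ne hne] at this ⊢
    constructor <;> linarith
  refine ⟨w', hw' _ hVmem (hw.mono ?_) (hqQ.mono ?_), (Reach.mono hq ?_).trans (hqw' _ ?_ ?_)⟩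
  · rintro z ⟨hz, hz'⟩ i
    have h1 := hz i
    rcases eq_or_ne i k with rfl | hne
    · have h2 := hleft z hz'
      simp only [Function.update_self]
      exact ⟨h1.1, by linarith⟩
    · simpa [hne] using h1
  · rintro z ⟨hz, hz'⟩ i
    have h1 := hz i
    rcases eq_or_ne i k with rfl | hne
    · have h2 := hright z hz'
      simp only [Function.update_self] at h1 ⊢
      constructor <;> linarith
    · simp only [Function.update_of_ne hne] at h1 ⊢
      constructor <;> linarith
  · intro z hz i
    have h1 := hz i
    rcases eq_or_ne i k with rfl | hne
    · simp only [Function.update_self] at h1 ⊢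
      constructor <;> linarith
    · simp only [Function.update_of_ne hne] at h1 ⊢
      constructor <;> linarith
  · refine fun z hz => hVmem z (coordBox_subset ?_ le_rfl hz)
    exact le_update_iff.mpr ⟨hl.trans h₀₁, fun _ _ => le_rfl⟩
  · intro z hz
    refine hpos z (hVmem z (coordBox_subset ?_ le_rfl hz)) ?_
    · exact le_update_iff.mpr ⟨hl.trans h₀₁, fun _ _ => le_rfl⟩
    · have h1 := (hz k).1
      rw [Function.update_self] at h1
      linarith

/-- Short chains over small boxes. -/
lemma exists_chain_of_small (hAB : ∀ x, A x * B x = 1)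
    (hA : ∀ a b, Differentiable ℂ fun y => A y a b) (he₀ : e₀ ≠ 0) (L R : Fin m × Bool → ℝ) :
    ∃ δ > 0, ∀ l r, L ≤ l → r ≤ R → l ≤ r → (∀ k, r k - l k ≤ δ) →
      ∃ p, ChainOn 2 (fun _ => e₀) (fun x => A x *ᵥ e₀) (coordBox l r) p := by
  have hv := differentiable_mulVec_const hA e₀
  have hv0 : ∀ x, A x *ᵥ e₀ ≠ 0 := fun x h => he₀ (by
    have hBA : B x * A x = 1 := mul_eq_one_comm.mp (hAB x)
    have := congrArg (B x *ᵥ ·) h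
    simpa [mulVec_mulVec, hBA] using this)
  let U : {c : ι → ℂ // e₀ ⬝ᵥ c ≠ 0} → Set (Fin m → ℂ) := fun c => {x | c.1 ⬝ᵥ (A x *ᵥ e₀) ≠ 0}
  have hU : ∀ c, IsOpen (U c) := fun c => isOpen_ne_fun
    (continuous_iff_continuousAt.mpr fun x => continuousAt_const.dotProduct'
      (hv x).continuousAt) continuous_const
  obtain ⟨δ, hδ, h⟩ := lebesgue_number_lemma_of_metric (isCompact_coordBox (l := L) (r := R)) hU
    (fun x _ => by
      obtain ⟨c, hc, hc'⟩ := exists_dot_ne_zero he₀ (hv0 x)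
      exact mem_iUnion.mpr ⟨⟨c, hc⟩, hc'⟩)
  refine ⟨δ / 3, by positivity, fun l r hl hr hlr hside => ?_⟩
  obtain ⟨x, hx⟩ := coordBox_nonempty hlr
  obtain ⟨c, hc⟩ := h x (coordBox_subset hl hr hx)
  have hsub : coordBox l r ⊆ U c := fun y hy => hc (by
    rw [mem_ball, dist_pi_lt_iff hδ]
    intro j
    have h1 := hx (j, false)
    have h2 := hx (j, true)
    have h3 := hy (j, false)
    have h4 := hy (j, true)
    have h5 := hside (j, false)
    have h6 := hside (j, true)
    simp only [realCoord, cond_true, cond_false] at h1 h2 h3 h4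
    rw [dist_eq_norm]
    have h7 : |(y j - x j).re| ≤ δ / 3 := by
      rw [Complex.sub_re, abs_le]; constructor <;> linarith
    have h8 : |(y j - x j).im| ≤ δ / 3 := by
      rw [Complex.sub_im, abs_le]; constructor <;> linarith
    have := Complex.norm_le_abs_re_add_abs_im (y j - x j)
    linarith)
  refine ⟨fun x k => if k = 0 then e₀ else if k = 1 then c.1 else A x *ᵥ e₀, ?_, fun k => ?_⟩
  · refine eventually_nhdsSet_of_open (hU c) hsub fun y hy => ⟨rfl, fun k hk => ?_, fun k hk => ?_⟩
    · rw [if_neg (by omega), if_neg (by omega)]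
    · interval_cases k
      · simpa using c.2
      · exact hy
  · refine Eventually.of_forall fun y => ?_
    by_cases h0 : k = 0
    · simp [h0]
    · by_cases h1 : k = 1
      · simp [h1]
      · simpa [h0, h1] using hv y

/-- Chains over boxes whose length depends only on the dimension. -/
theorem exists_chain_coordBox (hAB : ∀ x, A x * B x = 1)
    (hA : ∀ a b, Differentiable ℂ fun y => A y a b)
    (hB : ∀ a b, Differentiable ℂ fun y => B y a b) (he₀ : e₀ ≠ 0) {L R : Fin m × Bool → ℝ}
    (hLR : L ≤ R) :
    ∃ p, ChainOn (2 * 3 ^ (Finset.univ : Finset (Fin m × Bool)).card) (fun _ => e₀)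
      (fun x => A x *ᵥ e₀) (coordBox L R) p := by
  obtain ⟨δ, hδ, hsmall⟩ := exists_chain_of_small hAB hA he₀ L R
  suffices H : ∀ T : Finset (Fin m × Bool), ∀ l r, L ≤ l → r ≤ R → l ≤ r →
      (∀ k ∉ T, r k - l k ≤ δ) → ∃ p, ChainOn (2 * 3 ^ T.card) (fun _ => e₀)
        (fun x => A x *ᵥ e₀) (coordBox l r) p from
    H Finset.univ L R le_rfl le_rfl hLR (by simp)
  intro T
  induction T using Finset.induction_on with
  | empty => simpa using hsmall
  | insert k T hkT ih =>
    intro l r hl hr hlr hside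
    rw [Finset.card_insert_of_notMem hkT, pow_succ, show 2 * (3 ^ T.card * 3) =
      3 * (2 * 3 ^ T.card) by ring]
    set N := 2 * 3 ^ T.card with hN
    have hN2 : 2 ≤ N := by have := Nat.one_le_pow T.card 3 (by norm_num); omega
    obtain ⟨M', hM'⟩ := exists_nat_ge ((r k - l k) / (δ / 2))
    set M := M' + 1 with hM
    have hM0 : (0 : ℝ) < M := by positivity
    set h := (r k - l k) / M with hh
    have hh0 : 0 ≤ h := div_nonneg (sub_nonneg.mpr (hlr k)) hM0.le
    have hMh : M * h = r k - l k := mul_div_cancel₀ _ hM0.ne'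
    have hhδ : 2 * h ≤ δ := by
      have h1 : (r k - l k) / (δ / 2) ≤ M := hM'.trans (by rw [hM]; push_cast; linarith)
      rw [div_le_iff₀ (by positivity)] at h1
      have : h ≤ δ / 2 := by rw [hh, div_le_iff₀ hM0]; linarith
      linarith
    have hsub : ∀ a b : ℝ, l k ≤ a → a ≤ b → b ≤ r k → b - a ≤ δ →
        ∃ p, ChainOn N (fun _ => e₀) (fun x => A x *ᵥ e₀)
          (coordBox (Function.update l k a) (Function.update r k b)) p := by
      intro a b ha hab hb hδ'
      refine ih _ _ (hl.trans (le_update_iff.mpr ⟨ha, fun _ _ => le_rfl⟩))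
        ((update_le_iff.mpr ⟨hb, fun _ _ => le_rfl⟩).trans hr)
        (update_le_update_iff.mpr ⟨hab, fun i _ => hlr i⟩) fun i hi => ?_
      rcases eq_or_ne i k with rfl | hne
      · simpa using hδ'
      · simpa [hne] using hside i (by simp [hne, hi])
    have key : ∀ i : ℕ, i < M → ∃ u w,
        ChainOn (3 * N) (fun _ => e₀) (fun x => A x *ᵥ e₀)
          (coordBox l (Function.update r k (l k + (i + 1) * h))) w ∧
        ChainOn N (fun _ => e₀) (fun x => A x *ᵥ e₀)
          (coordBox (Function.update l k (l k + i * h))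
            (Function.update r k (l k + (i + 1) * h))) u ∧
        Reach (3 * N) (coordBox (Function.update l k (l k + i * h))
            (Function.update r k (l k + (i + 1) * h))) (tripled N u u) w := by
      intro i
      induction i with
      | zero =>
        intro hi
        have h1 : (1 : ℝ) ≤ M := by rw [hM]; push_cast; linarith [Nat.cast_nonneg (α := ℝ) M']
        obtain ⟨u, hu⟩ := hsub (l k) (l k + h) le_rfl (by linarith) (by nlinarith) (by linarith)
        simp only [Nat.cast_zero, zero_mul, add_zero, zero_add, one_mul, Function.update_eq_self]
        rw [Function.update_eq_self] at hu
        exact ⟨u, _, chainOn_tripled hu hu, hu, .refl⟩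
      | succ i ih' =>
        intro hi
        obtain ⟨u, w, hw, hu, huw⟩ := ih' (by omega)
        have hi0 : (0 : ℝ) ≤ i := Nat.cast_nonneg i
        have hiM : (i : ℝ) + 2 ≤ M := by
          have : i + 2 ≤ M := hi
          exact_mod_cast this
        have hmul := mul_le_mul_of_nonneg_right hiM hh0
        have hmul0 := mul_nonneg hi0 hh0
        obtain ⟨u', hu'⟩ := hsub (l k + i * h) (l k + (i + 2) * h) (by linarith) (by linarith)
          (by linarith) (by linarith)
        obtain ⟨w', hw', huw'⟩ := exists_extend_chain hN2 hAB hA hB (fun i _ => hlr i)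
          (by linarith) (by linarith) (by linarith) hw hu huw hu'
        have e1 : l k + ((i + 1 : ℕ) : ℝ) * h = l k + (i + 1) * h := by push_cast; ring
        have e2 : l k + (((i + 1 : ℕ) : ℝ) + 1) * h = l k + (i + 2) * h := by push_cast; ring
        rw [e1, e2]
        refine ⟨u', w', hw', hu'.mono (coordBox_subset ?_ le_rfl), huw'⟩
        exact update_le_update_iff.mpr ⟨by linarith, fun _ _ => le_rfl⟩
    obtain ⟨u, w, hw, -, -⟩ := key M' (by omega)
    have e1 : l k + ((M' : ℝ) + 1) * h = r k := by
      have : (M : ℝ) = M' + 1 := by rw [hM]; push_cast; rfl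
      rw [← this, hMh]; ring
    rw [e1, Function.update_eq_self] at hw
    exact ⟨w, hw⟩

end UniformLength

section Exhaustion

/-- The pairings of a chain over a compact set survive small perturbations. -/
lemma ChainOn.exists_stable {𝔼 : Type*} [NormedAddCommGroup 𝔼] [NormedSpace ℂ 𝔼] {ι : Type*}
    [Fintype ι] {N : ℕ} {e v : 𝔼 → ι → ℂ} {S : Set 𝔼} {p : 𝔼 → ℕ → ι → ℂ} (hS : IsCompact S)
    (h : ChainOn N e v S p) : ∃ η > 0, ∀ x ∈ S, ∀ c : ℕ → ι → ℂ, (∀ k, ‖p x k - c k‖ ≤ η) →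
      ∀ k < N, c k ⬝ᵥ c (k + 1) ≠ 0 := by
  let U : Set (Fin (N + 1) → ι → ℂ) := {c | ∀ k : Fin N, c k.castSucc ⬝ᵥ c k.succ ≠ 0}
  have hU : IsOpen U := by
    simp only [U, ofPred_forall]
    exact isOpen_iInter_of_finite fun k => isOpen_ne_fun
      (continuous_iff_continuousAt.mpr fun x => ContinuousAt.dotProduct'
        (continuous_apply _).continuousAt (continuous_apply _).continuousAt) continuous_const
  have hc : ContinuousOn (fun x (k : Fin (N + 1)) => p x k) S :=
    continuousOn_pi.mpr fun k => (h.hol k).differentiableOn.continuousOn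
  obtain ⟨η, hη, hsub⟩ := (hS.image_of_continuousOn hc).exists_cthickening_subset_open hU (by
    rintro _ ⟨x, hx, rfl⟩ k
    exact (h.gallery_at hx).ne k k.2)
  refine ⟨η, hη, fun x hx c hxc k hk => ?_⟩
  have := hsub (mem_cthickening_of_dist_le (fun k : Fin (N + 1) => c k) _ _ _
    (mem_image_of_mem _ hx) ((dist_pi_le_iff hη.le).mpr fun k => by
      rw [dist_comm, dist_eq_norm]; exact hxc k)) ⟨k, hk⟩
  exact this

variable {m : ℕ} {ι : Type*} [Fintype ι] [DecidableEq ι] {e₀ : ι → ℂ}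
  {A B : (Fin m → ℂ) → Matrix ι ι ℂ}

/-- Global chains, obtained from an exhaustion by boxes. -/
theorem exists_entire_chain (hAB : ∀ x, A x * B x = 1)
    (hA : ∀ a b, Differentiable ℂ fun y => A y a b)
    (hB : ∀ a b, Differentiable ℂ fun y => B y a b) (he₀ : e₀ ≠ 0) :
    ∃ (K : ℕ) (q : (Fin m → ℂ) → ℕ → ι → ℂ), (∀ k, Differentiable ℂ fun x => q x k) ∧
      ∀ x, Gallery (2 * K) e₀ (A x *ᵥ e₀) (q x) := by
  set c := 3 ^ (Finset.univ : Finset (Fin m × Bool)).card with hc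
  have hc2 : 2 ≤ 2 * c := by have : 1 ≤ c := Nat.one_le_pow _ _ (by norm_num); omega
  let D : ℕ → Set (Fin m → ℂ) := fun n => coordBox (fun _ => -(n + 1 : ℝ)) (fun _ => n + 1)
  have hDD : ∀ {n n'}, n ≤ n' → D n ⊆ D n' := fun {n n'} hn => by
    have : (n : ℝ) ≤ n' := by exact_mod_cast hn
    exact coordBox_subset (fun _ => by linarith) (fun _ => by linarith)
  have hle : ∀ n : ℕ, (fun _ => -(n + 1) : Fin m × Bool → ℝ) ≤ fun _ => (n + 1 : ℝ) := fun n _ => by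
    have := Nat.cast_nonneg (α := ℝ) n
    simp only; linarith
  have hball : ∀ n : ℕ, ball (0 : Fin m → ℂ) (n + 1) ⊆ D n := by
    intro n z hz
    rw [mem_ball_zero_iff] at hz
    have hn := fun j => (norm_le_pi_norm z j).trans hz.le
    rintro ⟨j, _ | _⟩
    · exact abs_le.mp ((Complex.abs_re_le_norm _).trans (hn j))
    · exact abs_le.mp ((Complex.abs_im_le_norm _).trans (hn j))
  choose u hu using fun n => exists_chain_coordBox hAB hA hB he₀ (hle n)
  have htr : ∀ n, ChainOn (3 * (2 * c)) (fun _ => e₀) (fun x => A x *ᵥ e₀) (D n)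
      (tripled (2 * c) (u n) (u n)) := fun n => chainOn_tripled (hu n) (hu n)
  let P : ℕ → ((Fin m → ℂ) → ℕ → ι → ℂ) × ℝ → Prop := fun n s =>
    Reach (3 * (2 * c)) (D n) (tripled (2 * c) (u n) (u n)) s.1 ∧ 0 < s.2 ∧
      ∀ x ∈ D n, ∀ q : ℕ → ι → ℂ, (∀ k, ‖s.1 x k - q k‖ ≤ s.2) →
        ∀ k < 3 * (2 * c), q k ⬝ᵥ q (k + 1) ≠ 0
  let Q : ℕ → ((Fin m → ℂ) → ℕ → ι → ℂ) × ℝ → ((Fin m → ℂ) → ℕ → ι → ℂ) × ℝ → Prop :=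
    fun n s s' => (∀ x ∈ D n, ∀ k, ‖s'.1 x k - s.1 x k‖ ≤ s.2 / 2) ∧ s'.2 ≤ s.2 / 2
  obtain ⟨η₀, hη₀, hst₀⟩ := (htr 0).exists_stable isCompact_coordBox
  obtain ⟨f, -, hfP, hfQ⟩ := exists_seq_of_forall_exists P Q
    (x₀ := (tripled (2 * c) (u 0) (u 0), η₀)) ⟨.refl, hη₀, hst₀⟩ (by
      rintro n ⟨p, η⟩ ⟨hr, hη, -⟩
      have hr' : Reach (3 * (2 * c)) (D n) (tripled (2 * c) (u (n + 1)) (u (n + 1))) p :=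
        (reach_tripled hc2 hAB hA hB isCompact_coordBox convex_coordBox
          (coordBox_nonempty (hle n)) ((hu (n + 1)).mono (hDD n.le_succ)) (hu n)).trans hr
      obtain ⟨p', hp', hpp⟩ := exists_reach_approx isCompact_coordBox rungeSet_coordBox
        (hDD n.le_succ) (htr (n + 1)) hr' (half_pos hη)
      obtain ⟨η', hη', hst⟩ := ((htr (n + 1)).reach hp').exists_stable isCompact_coordBox
      exact ⟨(p', min η' (η / 2)), ⟨hp', lt_min hη' (half_pos hη), fun x hx q hq =>
        hst x hx q fun k => (hq k).trans (min_le_left _ _)⟩,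
        fun x hx k => (hpp x hx k).le, min_le_right _ _⟩)
  have hchain : ∀ n, ChainOn (3 * (2 * c)) (fun _ => e₀) (fun x => A x *ᵥ e₀) (D n) (f n).1 :=
    fun n => (htr n).reach (hfP n).1
  have hη : ∀ n i, (f (n + i)).2 ≤ (f n).2 / 2 ^ i := by
    intro n i
    induction i with
    | zero => simp
    | succ i ih =>
      refine (hfQ (n + i)).2.trans ?_
      rw [pow_succ, ← div_div]
      linarith
  have hlim : ∀ (n k : ℕ), ∃ g : (Fin m → ℂ) → ι → ℂ, DifferentiableOn ℂ g (ball 0 (n + 1)) ∧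
      (∀ x ∈ ball (0 : Fin m → ℂ) (n + 1), Tendsto (fun i => (f i).1 x k) atTop (𝓝 (g x))) ∧
      ∀ x ∈ ball (0 : Fin m → ℂ) (n + 1), ‖(f n).1 x k - g x‖ ≤ (f n).2 := by
    intro n k
    obtain ⟨g, hg, hgl, hgn⟩ := exists_limit_of_le_geometric (isOpen_ball (x := (0 : Fin m → ℂ))
      (ε := n + 1)) (f := fun i x => (f (n + i)).1 x k) (C := (f n).2)
      (fun i => ((hchain (n + i)).hol k).differentiableOn.mono
        ((hball n).trans (hDD (Nat.le_add_right n i))))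
      (fun i x hx => ((hfQ (n + i)).1 x (hDD (Nat.le_add_right n i) (hball n hx)) k).trans (by
        have := hη n i
        rw [div_right_comm]
        linarith))
    refine ⟨g, hg, fun x hx => ?_, fun x hx => by simpa using hgn 0 x hx⟩
    have := hgl x hx
    simp only [add_comm n] at this
    exact (tendsto_add_atTop_iff_nat n).mp this
  choose g hg hgl hgn using hlim
  let q : (Fin m → ℂ) → ℕ → ι → ℂ := fun x k => limUnder atTop fun i => (f i).1 x k
  have hq : ∀ (n k : ℕ), ∀ x ∈ ball (0 : Fin m → ℂ) (n + 1), q x k = g n k x := fun n k x hx =>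
    (hgl n k x hx).limUnder_eq
  have hmem : ∀ x : Fin m → ℂ, ∃ n : ℕ, x ∈ ball (0 : Fin m → ℂ) (n + 1) := fun x => by
    obtain ⟨n, hn⟩ := exists_nat_ge ‖x‖
    exact ⟨n, mem_ball_zero_iff.mpr (by linarith)⟩
  have hN : 2 * (3 * c) = 3 * (2 * c) := by ring
  refine ⟨3 * c, q, fun k x => ?_, fun x => ?_⟩
  · obtain ⟨n, hn⟩ := hmem x
    refine ((hg n k).differentiableAt (isOpen_ball.mem_nhds hn)).congr_of_eventuallyEq ?_
    filter_upwards [isOpen_ball.mem_nhds hn] with y hy using hq n k y hy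
  · obtain ⟨n, hn⟩ := hmem x
    have hev : ∀ᶠ i in atTop, Gallery (3 * (2 * c)) e₀ (A x *ᵥ e₀) ((f i).1 x) :=
      (eventually_ge_atTop n).mono fun i hi => (hchain i).gallery_at (hDD hi (hball n hn))
    rw [hN]
    refine ⟨?_, fun k hk => ?_, (hfP n).2.2 x (hball n hn) (q x) fun k => ?_⟩
    · exact (tendsto_const_nhds.congr' (hev.mono fun i hi => hi.left.symm)).limUnder_eq
    · exact (tendsto_const_nhds.congr' (hev.mono fun i hi => (hi.right k hk).symm)).limUnder_eq
    · rw [hq n k x hn]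
      exact hgn n k x hn

end Exhaustion

lemma differentiable_adjugate {W : Type*} [NormedAddCommGroup W] [NormedSpace ℂ W] {ι : Type*}
    [Fintype ι] [DecidableEq ι] {A : W → Matrix ι ι ℂ}
    (hA : ∀ a b, Differentiable ℂ fun w => A w a b) (a b : ι) :
    Differentiable ℂ fun w => (A w).adjugate a b := by
  let A' : Matrix ι ι (entireRing W) := Matrix.of fun a b => ⟨fun w => A w a b, hA a b⟩
  have h : (fun w => (A w).adjugate a b) = (A'.adjugate a b : W → ℂ) := by
    ext w
    exact (congrFun (congrFun ((entireEval w).map_adjugate A') a) b).symm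
  exact h ▸ (A'.adjugate a b).2

lemma hasEntireChains_euclideanSpace (m : ℕ) : HasEntireChains (EuclideanSpace ℂ (Fin m)) := by
  intro n G hG hdet
  have hof : Differentiable ℂ (WithLp.ofLp : EuclideanSpace ℂ (Fin m) → Fin m → ℂ) :=
    (EuclideanSpace.equiv (Fin m) ℂ).differentiable
  have hto : Differentiable ℂ (WithLp.toLp 2 : (Fin m → ℂ) → EuclideanSpace ℂ (Fin m)) :=
    (EuclideanSpace.equiv (Fin m) ℂ).symm.differentiable
  have hA : ∀ a b, Differentiable ℂ fun x : Fin m → ℂ => G (WithLp.toLp 2 x) a b :=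
    fun a b => (hG a b).comp hto
  obtain ⟨K, q, hq, h⟩ := exists_entire_chain (e₀ := firstVec ℂ n)
    (A := fun x => G (WithLp.toLp 2 x)) (B := fun x => (G (WithLp.toLp 2 x)).adjugate)
    (fun x => by rw [mul_adjugate, hdet, one_smul]) hA
    (differentiable_adjugate hA)
    (fun h => one_ne_zero (α := ℂ) (by simpa [firstVec] using congrFun h 0))
  refine ⟨K, fun w => q (WithLp.ofLp w), fun k => (hq k).comp hof,
    fun w => ⟨(h _).left, ?_, (h _).ne⟩⟩
  exact (h _).right _ le_rfl

end

/-- the Ivarsson–Kutzschebauch solution to the Vaserstein problem for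
`W = ℂ^m`: every holomorphic map `G : ℂ^m → SL_n(ℂ)` factors as a finite product of
holomorphic maps into unipotent lower/upper triangular matrices, alternating starting
with a lower triangular factor (here `i : Fin M` is the `(i.1+1)`-st factor, so odd
factors are lower triangular and even factors are upper triangular). -/
theorem vaserstein_factorization_Cm
    (m n : ℕ) (hm : 1 ≤ m) (hn : 2 ≤ n)
    (G : EuclideanSpace ℂ (Fin m) → Matrix (Fin n) (Fin n) ℂ)
    (hGholo : ∀ a b, Differentiable ℂ (fun w => G w a b))
    (hGdet : ∀ w, (G w).det = 1) :
    ∃ (M : ℕ) (_ : 1 ≤ M)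
      (E : Fin M → EuclideanSpace ℂ (Fin m) → Matrix (Fin n) (Fin n) ℂ),
      (∀ i a b, Differentiable ℂ (fun w => E i w a b)) ∧
      (∀ i : Fin M, Odd (i.1 + 1) → ∀ w,
        (∀ a, E i w a a = 1) ∧ (∀ a b : Fin n, a < b → E i w a b = 0)) ∧
      (∀ i : Fin M, Even (i.1 + 1) → ∀ w,
        (∀ a, E i w a a = 1) ∧ (∀ a b : Fin n, b < a → E i w a b = 0)) ∧
      (∀ w, G w = (List.ofFn fun i => E i w).prod) :=
  exists_factorization_of_hasEntireChains (hasEntireChains_euclideanSpace m) n G hGholo hGdet
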